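/- Let U be an open neighborhood of the origin in ℝⁿ and let f : U → ℝ be C^∞ with f(0)=0, ∇f(0)=0 and Γ₊(f) ≠ ∅, satisfying condition (C). If the support of φ is contained in a sufficiently small neighborhood of the origin, then I(t;φ) admits an asymptotic expansion I(t;φ) ~ Σ_α Σ_{k=1}^n C_{αk}(φ) t^α (log t)^{k−1} as t → +∞, where α runs over the set {−(⟨a⟩+ν)/l(a) : ν ∈ ℤ₊, a ∈ Σ̃^(1)} ∪ (−ℕ) with ⟨a⟩ = a₁+⋯+aₙ; in particular the exponents α belong to finitely many arithmetic progressions of negative rational numbers determined only by the Newton polyhedron Γ₊(f). -/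

import Mathlib

open scoped BigOperators Topology
open Filter MeasureTheory Set

namespace KN

variable {n : ℕ}

/-- The standard inner product on `ℝⁿ`. -/
def dot (a x : Fin n → ℝ) : ℝ := ∑ i, a i * x i

/-- The hyperplane `H(a,l) = {x | ⟨a,x⟩ = l}`. -/
def Hplane (a : Fin n → ℝ) (l : ℝ) : Set (Fin n → ℝ) := {x | dot a x = l}

/-- The closed half-space `H⁺(a,l) = {x | ⟨a,x⟩ ≥ l}`. -/
def Hhalf (a : Fin n → ℝ) (l : ℝ) : Set (Fin n → ℝ) := {x | l ≤ dot a x}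

/-- View an integer vector as a real vector. -/
def intPt (a : Fin n → ℤ) : Fin n → ℝ := fun i => (a i : ℝ)

/-- View a vector of naturals as a real vector. -/
def natPt (a : Fin n → ℕ) : Fin n → ℝ := fun i => (a i : ℝ)

/-- The nonnegative octant `ℝ₊ⁿ`. -/
def octant (n : ℕ) : Set (Fin n → ℝ) := {x | ∀ i, 0 ≤ x i}

/-- A (convex rational) polyhedron: a finite intersection of closed half-spaces with
integral data. -/
def IsPolyhedron (P : Set (Fin n → ℝ)) : Prop :=
  ∃ (N : ℕ) (a : Fin N → Fin n → ℤ) (l : Fin N → ℤ),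
    P = ⋂ j, Hhalf (intPt (a j)) ((l j : ℝ))

/-- `(a,l) ∈ ℤⁿ × ℤ` is valid for `P` if `P ⊆ H⁺(a,l)`. -/
def ValidPair (P : Set (Fin n → ℝ)) (a : Fin n → ℤ) (l : ℤ) : Prop :=
  P ⊆ Hhalf (intPt a) (l : ℝ)

/-- A face of a polyhedron `P`: a set of the form `P ∩ H(a,l)` with `(a,l)` valid for `P`. -/
def IsFaceOf (P F : Set (Fin n → ℝ)) : Prop :=
  ∃ (a : Fin n → ℤ) (l : ℤ), ValidPair P a l ∧ F = P ∩ Hplane (intPt a) (l : ℝ)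

/-- Dimension of a subset of `ℝⁿ`: the dimension of its affine hull. -/
noncomputable def setDim (s : Set (Fin n → ℝ)) : ℕ :=
  Module.finrank ℝ (affineSpan ℝ s).direction

/-- First-order partial derivative in the `i`-th coordinate direction. -/
noncomputable def pderiv1 (i : Fin n) (f : (Fin n → ℝ) → ℝ) : (Fin n → ℝ) → ℝ :=
  fun x => fderiv ℝ f x (Pi.single i 1)

/-- Iterated partial derivative `∂^α` for a multi-index `α ∈ ℤ₊ⁿ`. -/
noncomputable def mderiv (α : Fin n → ℕ) (f : (Fin n → ℝ) → ℝ) : (Fin n → ℝ) → ℝ :=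
  (List.finRange n).foldr (fun i g => (pderiv1 i)^[α i] g) f

/-- Taylor coefficient `c_α = ∂^α f(0)/α!`. -/
noncomputable def taylorCoeff (f : (Fin n → ℝ) → ℝ) (α : Fin n → ℕ) : ℝ :=
  mderiv α f 0 / ((∏ i, Nat.factorial (α i) : ℕ) : ℝ)

/-- The Newton polyhedron `Γ₊(f)`: the convex hull of `⋃ {α + ℝ₊ⁿ : c_α ≠ 0}`. -/
def NewtonPolyhedron (f : (Fin n → ℝ) → ℝ) : Set (Fin n → ℝ) :=
  convexHull ℝ {x | ∃ α : Fin n → ℕ, taylorCoeff f α ≠ 0 ∧ ∀ i, (α i : ℝ) ≤ x i}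

/-- The pair `(a,l) ∈ ℤ₊ⁿ × ℤ₊` is valid for `P` and defines the face `γ = P ∩ H(a,l)`. -/
def DefinesFace (P : Set (Fin n → ℝ)) (a : Fin n → ℕ) (l : ℕ) (γ : Set (Fin n → ℝ)) : Prop :=
  P ⊆ Hhalf (natPt a) (l : ℝ) ∧ γ = P ∩ Hplane (natPt a) (l : ℝ)

/-- The anisotropic dilation `x ↦ (t^{a₁}x₁, …, t^{aₙ}xₙ)`. -/
def scaleAction (a : Fin n → ℕ) (t : ℝ) (x : Fin n → ℝ) : Fin n → ℝ :=
  fun i => t ^ (a i) * x i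

/-- `f` admits the `γ`-part on `U` (w.r.t. the polyhedron `P`): for every `x ∈ U` the limit
`lim_{t→0⁺} f(t^{a₁}x₁,…,t^{aₙ}xₙ)/t^l` exists for all valid pairs `(a,l) ∈ ℤ₊ⁿ×ℤ₊`
defining `γ`. -/
def AdmitsGammaPartOn (f : (Fin n → ℝ) → ℝ) (U P γ : Set (Fin n → ℝ)) : Prop :=
  ∀ x ∈ U, ∀ (a : Fin n → ℕ) (l : ℕ), DefinesFace P a l γ →
    ∃ c : ℝ, Filter.Tendsto (fun t : ℝ => f (scaleAction a t x) / t ^ l) (𝓝[>] (0:ℝ)) (𝓝 c)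

/-- Membership in the class `Ê[P](U)`. -/
def MemEhatP (P U : Set (Fin n → ℝ)) (f : (Fin n → ℝ) → ℝ) : Prop :=
  ContDiffOn ℝ (⊤ : ℕ∞) f U ∧ NewtonPolyhedron f ⊆ P ∧
    ∀ γ, IsFaceOf P γ → AdmitsGammaPartOn f U P γ

/-- Membership in the class `Ê(U) = {f : f ∈ Ê[Γ₊(f)](U)}`, where `Ê[∅](U) = {0}`. -/
def MemEhat (U : Set (Fin n → ℝ)) (f : (Fin n → ℝ) → ℝ) : Prop :=
  (NewtonPolyhedron f = ∅ ∧ ∀ x ∈ U, f x = 0) ∨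
  (NewtonPolyhedron f ≠ ∅ ∧ MemEhatP (NewtonPolyhedron f) U f)

/-- The polynomial `γ`-part `Σ_{α ∈ γ ∩ ℤ₊ⁿ} c_α x^α`. -/
noncomputable def gammaPartPoly (f : (Fin n → ℝ) → ℝ) (γ : Set (Fin n → ℝ))
    (x : Fin n → ℝ) : ℝ :=
  ∑' α : {α : Fin n → ℕ // natPt α ∈ γ}, taylorCoeff f α.1 * ∏ i, x i ^ (α.1 i)

/-- `V(γ) = {k : γ + ℝ₊ e_k ⊆ γ}`. -/
def Vset (γ : Set (Fin n → ℝ)) : Set (Fin n) :=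
  {k | ∀ x ∈ γ, ∀ r : ℝ, 0 ≤ r → x + r • (Pi.single k (1:ℝ) : Fin n → ℝ) ∈ γ}

/-- `W(γ) = {1,…,n} \ V(γ)`. -/
def Wset (γ : Set (Fin n → ℝ)) : Set (Fin n) := (Vset γ)ᶜ

open Classical in
/-- `T_I` replaces the coordinates indexed by `I` with `0`. -/
noncomputable def TI (I : Set (Fin n)) (x : Fin n → ℝ) : Fin n → ℝ :=
  fun i => if i ∈ I then 0 else x i

open Classical in
/-- `T_I^r` replaces the coordinates indexed by `I` with `r`. -/
noncomputable def TIr (I : Set (Fin n)) (r : ℝ) (x : Fin n → ℝ) : Fin n → ℝ :=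
  fun i => if i ∈ I then r else x i

/-- The canonical `γ`-part function
`f_γ(x) = Σ_{α ∈ γ_V} (1/α!) (∂^α f)(T_{W(γ)}(x)) x^α`, with `γ_V = T_{V(γ)}(γ) ∩ ℤ₊ⁿ`. -/
noncomputable def gammaFn (f : (Fin n → ℝ) → ℝ) (γ : Set (Fin n → ℝ)) (x : Fin n → ℝ) : ℝ :=
  ∑' α : {α : Fin n → ℕ // natPt α ∈ TI (Vset γ) '' γ},
    mderiv α.1 f (TI (Wset γ) x) * (∏ i, x i ^ (α.1 i)) /
      ((∏ i, Nat.factorial (α.1 i) : ℕ) : ℝ)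

/-- `f` is nondegenerate over `ℝ` w.r.t. its Newton polyhedron: for every nonempty compact
face `γ` of `Γ₊(f)` the gradient of the polynomial `f_γ` does not vanish on
`U ∩ (ℝ \ {0})ⁿ`. -/
def Nondegenerate (f : (Fin n → ℝ) → ℝ) (U : Set (Fin n → ℝ)) : Prop :=
  ∀ γ, IsFaceOf (NewtonPolyhedron f) γ → γ.Nonempty → IsCompact γ →
    ∀ x ∈ U, (∀ i, x i ≠ 0) → fderiv ℝ (gammaPartPoly f γ) x ≠ 0

/-- Condition (C): `f ∈ Ê(U)` and `f` is nondegenerate over `ℝ` w.r.t. `Γ₊(f)`. -/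
def ConditionC (U : Set (Fin n → ℝ)) (f : (Fin n → ℝ) → ℝ) : Prop :=
  MemEhat U f ∧ Nondegenerate f U

/-- The Newton distance `d(f)`: the coordinate of the point where the diagonal meets
the boundary of `Γ₊(f)`. -/
noncomputable def newtonDist (f : (Fin n → ℝ) → ℝ) : ℝ :=
  sInf {t : ℝ | (fun _ : Fin n => t) ∈ NewtonPolyhedron f}

/-- `τ` is the principal face of `Γ₊(f)`: its relative interior contains
`q_* = (d(f),…,d(f))`. -/
def IsPrincipalFace (f : (Fin n → ℝ) → ℝ) (τ : Set (Fin n → ℝ)) : Prop :=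
  IsFaceOf (NewtonPolyhedron f) τ ∧
    (fun _ : Fin n => newtonDist f) ∈ intrinsicInterior ℝ τ

/-- The oscillatory integral `I(t;φ) = ∫ e^{itf(x)} φ(x) dx`. -/
noncomputable def oscInt (f : (Fin n → ℝ) → ℝ) (φ : (Fin n → ℝ) → ℂ) (t : ℝ) : ℂ :=
  ∫ x : Fin n → ℝ, Complex.exp (Complex.I * t * f x) * φ x

/-- `Z₊(s;φ) = ∫ f(x)₊^s φ(x) dx`. -/
noncomputable def zetaPlus (f : (Fin n → ℝ) → ℝ) (φ : (Fin n → ℝ) → ℂ) (s : ℂ) : ℂ :=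
  ∫ x : Fin n → ℝ, ((max (f x) 0 : ℝ) : ℂ) ^ s * φ x

/-- `Z₋(s;φ) = ∫ f(x)₋^s φ(x) dx`. -/
noncomputable def zetaMinus (f : (Fin n → ℝ) → ℝ) (φ : (Fin n → ℝ) → ℂ) (s : ℂ) : ℂ :=
  ∫ x : Fin n → ℝ, ((max (-f x) 0 : ℝ) : ℂ) ^ s * φ x

/-- The local zeta function `Z(s;φ) = ∫ |f(x)|^s φ(x) dx`. -/
noncomputable def zetaAbs (f : (Fin n → ℝ) → ℝ) (φ : (Fin n → ℝ) → ℂ) (s : ℂ) : ℂ :=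
  ∫ x : Fin n → ℝ, ((|f x| : ℝ) : ℂ) ^ s * φ x

/-- An amplitude: a `C^∞` function with compact support contained in `U ∩ V`. -/
def IsAmplitude (U V : Set (Fin n → ℝ)) (φ : (Fin n → ℝ) → ℂ) : Prop :=
  ContDiff ℝ (⊤ : ℕ∞) φ ∧ HasCompactSupport φ ∧ tsupport φ ⊆ U ∩ V

/-- Partial sum `Σ_{α ∈ E, α ≥ -M} Σ_{k=1}^n C_{αk} t^α (log t)^{k-1}`. -/
noncomputable def partialSum (n : ℕ) (E : Set ℝ) (C : ℝ → ℕ → ℂ) (M t : ℝ) : ℂ :=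
  ∑ᶠ α ∈ {β ∈ E | -M ≤ β}, ∑ k ∈ Finset.Icc 1 n,
    C α k * ((t ^ α : ℝ) : ℂ) * (((Real.log t) ^ (k - 1) : ℝ) : ℂ)

/-- `g(t)` admits the asymptotic expansion `Σ_{α ∈ E} Σ_{k=1}^n C_{αk} t^α (log t)^{k-1}`
as `t → +∞`. -/
def HasAsympExpansion (n : ℕ) (g : ℝ → ℂ) (E : Set ℝ) (C : ℝ → ℕ → ℂ) : Prop :=
  (∀ α k, C α k ≠ 0 → α ∈ E ∧ 1 ≤ k ∧ k ≤ n) ∧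
  ∀ M : ℝ, ∃ K : ℝ, ∀ t : ℝ, 2 ≤ t →
    ‖g t - partialSum n E C M t‖ ≤ K * t ^ (-M)

/-- A set of exponents consisting of negative numbers, finite above any `-M`. -/
def LocallyFiniteBelow (E : Set ℝ) : Prop :=
  E ⊆ Set.Iio 0 ∧ ∀ M : ℝ, {β ∈ E | -M ≤ β}.Finite

/-- The set `S(f)` of pairs `(α,k)` appearing with a nonzero coefficient in the asymptotic
expansion of `I(t;φ)` for amplitudes `φ` supported arbitrarily close to the origin. -/
def OscSet (U : Set (Fin n → ℝ)) (f : (Fin n → ℝ) → ℝ) : Set (ℝ × ℕ) :=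
  {p | ∀ V ∈ 𝓝 (0 : Fin n → ℝ), ∃ φ : (Fin n → ℝ) → ℂ, IsAmplitude U V φ ∧
      ∃ E C, LocallyFiniteBelow E ∧ HasAsympExpansion n (oscInt f φ) E C ∧ C p.1 p.2 ≠ 0}

/-- The cone spanned by the vectors `g j`, `j ∈ s`. -/
def coneSpanSub (g : Fin n → (Fin n → ℝ)) (s : Finset (Fin n)) : Set (Fin n → ℝ) :=
  {x | ∃ c : Fin n → ℝ, (∀ j, 0 ≤ c j) ∧ (∀ j ∉ s, c j = 0) ∧ x = ∑ j, c j • g j}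

/-- The cone spanned by all the vectors `g j`. -/
def coneSpan (g : Fin n → (Fin n → ℝ)) : Set (Fin n → ℝ) := coneSpanSub g Finset.univ

/-- `l(a) = min {⟨a,α⟩ : α ∈ Γ}`. -/
noncomputable def lval (Γ : Set (Fin n → ℝ)) (a : Fin n → ℝ) : ℝ := sInf (dot a '' Γ)

/-- Real matrix of skeleton vectors. -/
def genR (a : Fin n → (Fin n → ℕ)) : Fin n → (Fin n → ℝ) := fun j => natPt (a j)

/-- A simplicial subdivision `Σ` of the fan `Σ₀` associated with `Γ`, presented via the
skeletons of its `n`-dimensional cones: each maximal cone is unimodular (its skeleton can be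
completed to a basis of the lattice `ℤⁿ`), the cones cover `ℝ₊ⁿ`, each cone lies in a cone
`closure(γ*)` of the fan `Σ₀`, and two cones intersect in a common face. -/
structure SimplicialSubdivision (n : ℕ) (Γ : Set (Fin n → ℝ)) where
  ι : Type
  fin : Fintype ι
  gen : ι → Fin n → (Fin n → ℕ)
  unimodular : ∀ σ, (Matrix.det (Matrix.of fun j k => (gen σ j k : ℤ))).natAbs = 1
  covers : ∀ x ∈ octant n, ∃ σ, x ∈ coneSpan (genR (gen σ))
  subordinate : ∀ σ, ∃ γ, IsFaceOf Γ γ ∧ γ.Nonempty ∧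
      ∀ j, ∀ y ∈ γ, dot (natPt (gen σ j)) y = lval Γ (natPt (gen σ j))
  compatible : ∀ σ τ, ∃ s : Finset (Fin n),
      (∀ j ∈ s, gen σ j ∈ Set.range (gen τ)) ∧
      coneSpan (genR (gen σ)) ∩ coneSpan (genR (gen τ)) = coneSpanSub (genR (gen σ)) s

/-- The set `Σ^{(1)}` of primitive generators of the one-dimensional cones of `Σ`. -/
def sigma1 {n : ℕ} {Γ : Set (Fin n → ℝ)} (S : SimplicialSubdivision n Γ) :
    Set (Fin n → ℕ) :=
  {a | ∃ σ j, S.gen σ j = a}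

/-- The set `{-(⟨a⟩+ν)/l(a) : ν ∈ ℤ₊, a ∈ Σ̃^{(1)}}`. -/
noncomputable def expSetMain {n : ℕ} (Γ : Set (Fin n → ℝ))
    (S : SimplicialSubdivision n Γ) : Set ℝ :=
  {r | ∃ a ∈ sigma1 S, 0 < lval Γ (natPt a) ∧
        ∃ ν : ℕ, r = -((∑ i, (a i : ℝ)) + (ν : ℝ)) / lval Γ (natPt a)}

/-- The full candidate set `{-(⟨a⟩+ν)/l(a)} ∪ (-ℕ)`. -/
noncomputable def expSet {n : ℕ} (Γ : Set (Fin n → ℝ))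
    (S : SimplicialSubdivision n Γ) : Set ℝ :=
  expSetMain Γ S ∪ {r | ∃ m : ℕ, r = -((m : ℝ) + 1)}

/-- `G` has at `s₀` a pole of order at most `m` (in particular `G` may be analytic there). -/
def PoleOrderAtMost (G : ℂ → ℂ) (s₀ : ℂ) (m : ℕ) : Prop :=
  ∃ h : ℂ → ℂ, AnalyticAt ℂ h s₀ ∧ ∀ᶠ s in 𝓝[≠] s₀, (s - s₀) ^ m * G s = h s


open Classical in
/-- `A_V(N) = {α ∈ T_V(ℤ₊ⁿ) : ⟨α⟩ < N}`. -/
noncomputable def ASetF (n : ℕ) (V : Finset (Fin n)) (N : ℕ) : Finset (Fin n → ℕ) :=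
  (Fintype.piFinset fun _ : Fin n => Finset.range (N + 1)).filter
    (fun α => (∀ j ∈ V, α j = 0) ∧ ∑ i, α i < N)

open Classical in
/-- `B_V(N) = {α ∈ T_V(ℤ₊ⁿ) : ⟨α⟩ = N}`. -/
noncomputable def BSetF (n : ℕ) (V : Finset (Fin n)) (N : ℕ) : Finset (Fin n → ℕ) :=
  (Fintype.piFinset fun _ : Fin n => Finset.range (N + 1)).filter
    (fun α => (∀ j ∈ V, α j = 0) ∧ ∑ i, α i = N)

/-- `v` is a vertex (0-dimensional face) of `P`. -/
def IsVertex (P : Set (Fin n → ℝ)) (v : Fin n → ℝ) : Prop := IsFaceOf P {v}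

/-- Membership in the class `Ě[P](U)`: an element of `Ê[P](U)` expressible as
`Σ_{p∈S} x^p ψ_p(x)` with `S ⊆ P ∩ ℤ₊ⁿ` finite containing all vertices of `P`, and
`ψ_p(0) ≠ 0` for each vertex `p`. -/
def MemEcheck (P U : Set (Fin n → ℝ)) (f : (Fin n → ℝ) → ℝ) : Prop :=
  MemEhatP P U f ∧
  ∃ S : Finset (Fin n → ℕ), (∀ p ∈ S, natPt p ∈ P) ∧
    (∀ v, IsVertex P v → ∃ p ∈ S, natPt p = v) ∧
    ∃ ψ : (Fin n → ℕ) → (Fin n → ℝ) → ℝ,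
      (∀ p ∈ S, ContDiffOn ℝ (⊤ : ℕ∞) (ψ p) U) ∧
      (∀ p ∈ S, IsVertex P (natPt p) → ψ p 0 ≠ 0) ∧
      ∀ x ∈ U, f x = ∑ p ∈ S, (∏ i, x i ^ p i) * ψ p x

/-- Membership in the class `Ẽ(U)`: functions of the form `Σ_{p∈S} x^p ψ_p(x)` with
`ψ_p(0) ≠ 0` for all `p ∈ S`. -/
def MemEtilde (U : Set (Fin n → ℝ)) (f : (Fin n → ℝ) → ℝ) : Prop :=
  ∃ S : Finset (Fin n → ℕ), ∃ ψ : (Fin n → ℕ) → (Fin n → ℝ) → ℝ,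
    (∀ p ∈ S, ContDiffOn ℝ (⊤ : ℕ∞) (ψ p) U) ∧ (∀ p ∈ S, ψ p 0 ≠ 0) ∧
    ∀ x ∈ U, f x = ∑ p ∈ S, (∏ i, x i ^ p i) * ψ p x

/-- Membership in the Denjoy–Carleman class `ℰ_M(U)`. -/
def MemDC (M : ℕ → ℝ) (U : Set (Fin n → ℝ)) (f : (Fin n → ℝ) → ℝ) : Prop :=
  ContDiffOn ℝ (⊤ : ℕ∞) f U ∧
  ∀ K : Set (Fin n → ℝ), K ⊆ U → IsCompact K →
    ∃ A B : ℝ, 0 < A ∧ 0 < B ∧ ∀ x ∈ K, ∀ α : Fin n → ℕ,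
      |mderiv α f x| ≤ A * B ^ (∑ i, α i) * ((∏ i, Nat.factorial (α i) : ℕ) : ℝ) *
        M (∑ i, α i)

open Classical in
/-- The multi-index `α - 1` from the proof of Proposition 9.5:
`(α-1)_j = l_jλ - m_j` for `j ∈ B_λ`, `(α-1)_n = λ - 1`, and `0` otherwise. -/
noncomputable def alphaIdx (n lam : ℕ) (l m : Fin n → ℕ) (Bl : Finset (Fin n)) :
    Fin (n+1) → ℕ :=
  fun i => if h : i = Fin.last n then lam - 1
    else if i.castPred h ∈ Bl then l (i.castPred h) * lam - m (i.castPred h) else 0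

open Classical in
/-- The constant `C_λ` of Proposition 9.5. -/
noncomputable def Cval (n lam : ℕ) (l m : Fin n → ℕ) (Bl : Finset (Fin n))
    (η : (Fin (n+1) → ℝ) → ℝ) : ℝ :=
  (1 / (Nat.factorial (lam - 1) : ℝ)) *
  (∏ j ∈ Bl, ((l j : ℝ) *
      ∏ ν ∈ Finset.Icc 1 (l j * lam - m j),
        (((l j * lam : ℕ) : ℝ) - (m j : ℝ) + 1 - (ν : ℝ)))⁻¹) *
  (if Bl = Finset.univ then mderiv (alphaIdx n lam l m Bl) η 0
   else ∫ z : {j : Fin n // j ∉ Bl} → ℝ in {z | ∀ j, 0 ≤ z j},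
     mderiv (alphaIdx n lam l m Bl) η
       (fun i => if h : i = Fin.last n then 0
         else if hj : i.castPred h ∈ Bl then 0 else z ⟨i.castPred h, hj⟩))

section Division

/-- Integration in a parameter over `[0,1]` preserves finite smoothness. -/
theorem contDiff_nat_integral_param {E : Type} [NormedAddCommGroup E] [NormedSpace ℝ E]
    [ProperSpace E] (k : ℕ) :
    ∀ {F : Type} [NormedAddCommGroup F] [NormedSpace ℝ F] [CompleteSpace F] (g : E × ℝ → F),
      ContDiff ℝ (⊤ : ℕ∞) g →
        ContDiff ℝ k (fun x => ∫ s in (0:ℝ)..1, g (x, s)) ∧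
        ∀ x, HasFDerivAt (fun x => ∫ s in (0:ℝ)..1, g (x, s))
          (∫ s in (0:ℝ)..1, (fderiv ℝ g (x, s)).comp (ContinuousLinearMap.inl ℝ E ℝ)) x := by
  have key : ∀ {F : Type} [NormedAddCommGroup F] [NormedSpace ℝ F] [CompleteSpace F]
      (g : E × ℝ → F), ContDiff ℝ (⊤ : ℕ∞) g →
      ∀ x, HasFDerivAt (fun x => ∫ s in (0:ℝ)..1, g (x, s))
          (∫ s in (0:ℝ)..1, (fderiv ℝ g (x, s)).comp (ContinuousLinearMap.inl ℝ E ℝ)) x := by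
    intro F _ _ _ g hg x
    have hg' : Continuous (fun q : E × ℝ =>
        (fderiv ℝ g q).comp (ContinuousLinearMap.inl ℝ E ℝ)) :=
      (hg.continuous_fderiv (by simp)).clm_comp continuous_const
    obtain ⟨C, hC⟩ := ((isCompact_closedBall x 1).prod
      (isCompact_Icc (a := (0:ℝ)) (b := 1))).exists_bound_of_continuousOn hg'.continuousOn
    refine (intervalIntegral.hasFDerivAt_integral_of_dominated_of_fderiv_le
      (F := fun x s => g (x, s))
      (F' := fun x s => (fderiv ℝ g (x, s)).comp (ContinuousLinearMap.inl ℝ E ℝ))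
      (bound := fun _ => C) (s := Metric.ball x 1) (Metric.ball_mem_nhds x one_pos)
      ?_ ?_ ?_ ?_ ?_ ?_)
    · exact Eventually.of_forall fun y =>
        (hg.continuous.comp (Continuous.prodMk_right y)).aestronglyMeasurable
    · exact (hg.continuous.comp (Continuous.prodMk_right x)).intervalIntegrable _ _
    · exact (hg'.comp (Continuous.prodMk_right x)).aestronglyMeasurable
    · refine Eventually.of_forall fun s hs y hy => hC (y, s) ⟨Metric.ball_subset_closedBall hy, ?_⟩
      rw [uIoc_of_le zero_le_one] at hs
      exact ⟨hs.1.le, hs.2⟩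
    · simp
    · refine Eventually.of_forall fun s _ y _ => ?_
      have h1 : HasFDerivAt g (fderiv ℝ g (y, s)) (y, s) :=
        (hg.differentiable (by simp)).differentiableAt.hasFDerivAt
      exact h1.comp y (hasFDerivAt_prodMk_left y s)
  induction k with
  | zero =>
    intro F _ _ _ g hg
    refine ⟨?_, key g hg⟩
    have hc : Continuous (fun x : E => ∫ s in (0:ℝ)..1, g (x, s)) :=
      continuous_iff_continuousAt.2 fun x => (key g hg x).continuousAt
    simpa using (contDiff_zero (𝕜 := ℝ)).2 hc
  | succ k ih =>
    intro F _ _ _ g hg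
    refine ⟨?_, key g hg⟩
    have e : fderiv ℝ (fun x => ∫ s in (0:ℝ)..1, g (x, s)) =
        fun x => ∫ s in (0:ℝ)..1, (fderiv ℝ g (x, s)).comp (ContinuousLinearMap.inl ℝ E ℝ) :=
      funext fun x => (key g hg x).fderiv
    push_cast
    rw [contDiff_succ_iff_fderiv]
    refine ⟨fun x => (key g hg x).differentiableAt, by simp, ?_⟩
    rw [e]
    exact (ih (fun q : E × ℝ => (fderiv ℝ g q).comp (ContinuousLinearMap.inl ℝ E ℝ))
      ((hg.fderiv_right (by simp)).clm_comp contDiff_const)).1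

theorem contDiff_integral_param {E F : Type} [NormedAddCommGroup E] [NormedSpace ℝ E]
    [ProperSpace E] [NormedAddCommGroup F] [NormedSpace ℝ F] [CompleteSpace F] {g : E × ℝ → F}
    (hg : ContDiff ℝ (⊤ : ℕ∞) g) :
    ContDiff ℝ (⊤ : ℕ∞) (fun x => ∫ s in (0:ℝ)..1, g (x, s)) :=
  contDiff_infty.2 fun k => (contDiff_nat_integral_param k g hg).1

theorem contDiff_update_mul (i : Fin n) :
    ContDiff ℝ (⊤ : ℕ∞) (fun q : (Fin n → ℝ) × ℝ => Function.update q.1 i (q.2 * q.1 i)) := by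
  rw [contDiff_pi]
  intro j
  by_cases h : j = i
  · subst h
    simp only [Function.update_self]
    fun_prop
  · simp only [Function.update_of_ne h]
    fun_prop

/-- The quotient `(h(x) - h(x|_{x_i=0})) / x_i` as an integral. -/
noncomputable def divCoord (i : Fin n) (h : (Fin n → ℝ) → ℝ) : (Fin n → ℝ) → ℝ :=
  fun x => ∫ s in (0:ℝ)..1, fderiv ℝ h (Function.update x i (s * x i)) (Pi.single i 1)

theorem contDiff_divCoord (i : Fin n) {h : (Fin n → ℝ) → ℝ} (hh : ContDiff ℝ (⊤ : ℕ∞) h) :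
    ContDiff ℝ (⊤ : ℕ∞) (divCoord i h) := by
  refine contDiff_integral_param
    (g := fun q : (Fin n → ℝ) × ℝ =>
      fderiv ℝ h (Function.update q.1 i (q.2 * q.1 i)) (Pi.single i 1)) ?_
  exact ((hh.fderiv_right (m := (⊤ : ℕ∞)) (by simp)).comp
    (contDiff_update_mul i)).clm_apply contDiff_const

theorem eq_add_mul_divCoord (i : Fin n) {h : (Fin n → ℝ) → ℝ} (hh : ContDiff ℝ (⊤ : ℕ∞) h)
    (x : Fin n → ℝ) : h x = h (Function.update x i 0) + x i * divCoord i h x := by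
  have hd : ∀ s : ℝ, HasDerivAt (fun s : ℝ => h (Function.update x i (s * x i)))
      (x i * fderiv ℝ h (Function.update x i (s * x i)) (Pi.single i 1)) s := by
    intro s
    have h1 : HasDerivAt (fun s : ℝ => Function.update x i (s * x i)) (x i • Pi.single i 1) s := by
      rw [hasDerivAt_pi]
      intro j
      by_cases hj : j = i
      · subst hj
        simpa using (hasDerivAt_id s).mul_const (x j)
      · simp only [Function.update_of_ne hj]
        simpa [hj] using hasDerivAt_const s (x j)
    have h2 := ((hh.differentiable (by simp)).differentiableAt
      (x := Function.update x i (s * x i))).hasFDerivAt.comp_hasDerivAt s h1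
    rw [map_smul, smul_eq_mul] at h2
    exact h2
  have hc : Continuous fun s : ℝ =>
      x i * fderiv ℝ h (Function.update x i (s * x i)) (Pi.single i 1) := by
    refine continuous_const.mul (Continuous.clm_apply ?_ continuous_const)
    exact (hh.continuous_fderiv (by simp)).comp
      ((contDiff_update_mul i).continuous.comp (Continuous.prodMk_right x))
  have := intervalIntegral.integral_eq_sub_of_hasDerivAt (a := 0) (b := 1)
    (fun s _ => hd s) (hc.intervalIntegrable _ _)
  rw [intervalIntegral.integral_const_mul] at this
  simp only [zero_mul, one_mul, Function.update_eq_self] at this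
  simp only [divCoord]
  linarith

theorem DependsOn.divCoord {h : (Fin n → ℝ) → ℝ} {T : Set (Fin n)} (i : Fin n)
    (hT : DependsOn h T) : DependsOn (divCoord i h) (insert i T) := by
  intro x y hxy
  have hfd : ∀ u v : Fin n → ℝ, (∀ j ∈ T, u j = v j) → fderiv ℝ h u = fderiv ℝ h v := by
    intro u v huv
    have e : h = fun z => h (z + (v - u)) := by
      funext z
      refine hT fun j hj => ?_
      simp [huv j hj]
    conv_lhs => rw [e]
    rw [fderiv_comp_add_right]
    simp
  simp only [KN.divCoord]
  congr 1
  funext s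
  congr 1
  refine hfd _ _ fun j hj => ?_
  by_cases hji : j = i
  · subst hji
    simp [hxy j (mem_insert _ _)]
  · simp [Function.update_of_ne hji, hxy j (mem_insert_of_mem _ hj)]

theorem taylor_one_coord (N : ℕ) (i : Fin n) (T : Set (Fin n)) :
    ∀ h : (Fin n → ℝ) → ℝ, ContDiff ℝ (⊤ : ℕ∞) h → DependsOn h (insert i T) →
      ∃ g : Fin (N + 1) → (Fin n → ℝ) → ℝ,
        (∀ k, ContDiff ℝ (⊤ : ℕ∞) (g k)) ∧
        (∀ k, DependsOn (g k) (insert i T)) ∧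
        (∀ k : Fin (N + 1), (k : ℕ) < N → DependsOn (g k) (T \ {i})) ∧
        ∀ x, h x = ∑ k : Fin (N + 1), x i ^ (k : ℕ) * g k x := by
  induction N with
  | zero =>
    intro h hh hd
    exact ⟨fun _ => h, fun _ => hh, fun _ => hd, fun k hk => absurd hk (by simp),
      fun x => by simp⟩
  | succ N ih =>
    intro h hh hd
    obtain ⟨g, g1, g2, g3, g4⟩ := ih (divCoord i h) (contDiff_divCoord i hh)
      (by simpa using DependsOn.divCoord i hd)
    have hz : DependsOn (fun x => h (Function.update x i 0)) (T \ {i}) := by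
      intro x y hxy
      refine hd fun j hj => ?_
      by_cases hji : j = i
      · subst hji; simp
      · simp only [Function.update_of_ne hji]
        exact hxy j ⟨by simpa [hji] using hj, hji⟩
    have hzs : ContDiff ℝ (⊤ : ℕ∞) (fun x => h (Function.update x i 0)) := by
      have : ContDiff ℝ (⊤ : ℕ∞) (fun x : Fin n → ℝ => Function.update x i (0:ℝ)) := by
        have := (contDiff_update_mul (n := n) i).comp
          (contDiff_id.prodMk (contDiff_const (c := (0:ℝ))))
        simpa [Function.comp_def] using this
      exact hh.comp this
    refine ⟨Fin.cons (fun x => h (Function.update x i 0)) g, ?_, ?_, ?_, ?_⟩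
    · intro k
      refine Fin.cases ?_ (fun k => ?_) k
      · simpa using hzs
      · simpa using g1 k
    · intro k
      refine Fin.cases ?_ (fun k => ?_) k
      · simp only [Fin.cons_zero]
        exact fun x y hxy => hz fun j hj => hxy j (mem_insert_of_mem _ hj.1)
      · simpa using g2 k
    · intro k
      refine Fin.cases ?_ (fun k => ?_) k
      · intro _
        simpa using hz
      · intro hk
        simpa using g3 k (by simpa using hk)
    · intro x
      rw [Fin.sum_univ_succ, eq_add_mul_divCoord i hh x, g4 x, Finset.mul_sum]
      simp [pow_succ]
      exact Finset.sum_congr rfl fun k _ => by ring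

/-- The monomial `x^p`. -/
def mono (p : Fin n → ℕ) (x : Fin n → ℝ) : ℝ := ∏ i, x i ^ p i

theorem mono_add (p q : Fin n → ℕ) (x : Fin n → ℝ) : mono (p + q) x = mono p x * mono q x := by
  simp [mono, pow_add, Finset.prod_mul_distrib]

theorem mono_single (i : Fin n) (k : ℕ) (x : Fin n → ℝ) : mono (Pi.single i k) x = x i ^ k := by
  rw [mono, Finset.prod_eq_single i]
  · simp
  · intro j _ hj; simp [hj]
  · simp

theorem contDiff_mono (p : Fin n → ℕ) : ContDiff ℝ (⊤ : ℕ∞) (mono p) := by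
  unfold mono
  fun_prop

theorem taylor_coords (N : ℕ) {h : (Fin n → ℝ) → ℝ} (hh : ContDiff ℝ (⊤ : ℕ∞) h)
    (T : Finset (Fin n)) :
    ∃ (κ : Type) (_ : Fintype κ) (p : κ → Fin n → ℕ) (g : κ → (Fin n → ℝ) → ℝ),
      (∀ k, ContDiff ℝ (⊤ : ℕ∞) (g k)) ∧
      (∀ k i, i ∉ T → p k i = 0) ∧
      (∀ k, DependsOn (g k) {i | i ∈ T → N ≤ p k i}) ∧
      ∀ x, h x = ∑ k, mono (p k) x * g k x := by
  classical
  induction T using Finset.induction_on with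
  | empty =>
    refine ⟨Unit, inferInstance, fun _ => 0, fun _ => h, fun _ => hh, by simp, ?_, ?_⟩
    · intro _ x y hxy
      exact congrArg h (funext fun i => hxy i (by simp))
    · intro x; simp [mono]
  | insert i T hi ih =>
    obtain ⟨κ, _, p, g, g1, g2, g3, g4⟩ := ih
    have hk : ∀ k, insert i {j | j ∈ T → N ≤ p k j} = {j | j ∈ T → N ≤ p k j} := by
      intro k
      refine insert_eq_of_mem ?_
      simp [hi]
    choose G G1 G2 G3 G4 using fun k => taylor_one_coord N i {j | j ∈ T → N ≤ p k j} (g k) (g1 k)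
      (by rw [hk]; exact g3 k)
    refine ⟨κ × Fin (N + 1), inferInstance, fun q => p q.1 + Pi.single i (q.2 : ℕ),
      fun q => G q.1 q.2, fun q => G1 _ _, ?_, ?_, ?_⟩
    · intro q j hj
      rw [Finset.mem_insert, not_or] at hj
      simp [g2 q.1 j hj.2, hj.1]
    · rintro ⟨k, m⟩ x y hxy
      simp only at hxy ⊢
      by_cases hm : (m : ℕ) < N
      · refine G3 k m hm fun j hj => hxy j ?_
        have : j ≠ i := hj.2
        have h2 := hj.1
        simp only [mem_ofPred_eq, Finset.mem_insert, this, false_or, Pi.add_apply,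
          Pi.single_eq_of_ne this, add_zero] at h2 ⊢
        exact h2
      · refine G2 k m fun j hj => hxy j ?_
        by_cases hji : j = i
        · subst hji
          intro _
          simp
          omega
        · rw [hk] at hj
          simpa [hji] using hj
    · intro x
      rw [g4 x, Fintype.sum_prod_type]
      refine Finset.sum_congr rfl fun k _ => ?_
      rw [G4 k x, Finset.mul_sum]
      refine Finset.sum_congr rfl fun m _ => ?_
      simp only [mono_add, mono_single]
      ring

/-- Multivariable Taylor expansion: `h = ∑ x^p g_p`, where `g_p` depends only on the coordinates
`i` with `N ≤ p_i`. -/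
theorem taylor_box (N : ℕ) {h : (Fin n → ℝ) → ℝ} (hh : ContDiff ℝ (⊤ : ℕ∞) h) :
    ∃ (κ : Type) (_ : Fintype κ) (p : κ → Fin n → ℕ) (g : κ → (Fin n → ℝ) → ℝ),
      (∀ k, ContDiff ℝ (⊤ : ℕ∞) (g k)) ∧
      (∀ k, DependsOn (g k) {i | N ≤ p k i}) ∧
      ∀ x, h x = ∑ k, mono (p k) x * g k x := by
  obtain ⟨κ, i, p, g, g1, _, g3, g4⟩ := taylor_coords N hh Finset.univ
  exact ⟨κ, i, p, g, g1, by simpa using g3, g4⟩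

end Division

section Taylor

theorem contDiff_pderiv1 (i : Fin n) {h : (Fin n → ℝ) → ℝ} (hh : ContDiff ℝ (⊤ : ℕ∞) h) :
    ContDiff ℝ (⊤ : ℕ∞) (pderiv1 i h) :=
  (hh.fderiv_right (m := (⊤ : ℕ∞)) (by simp)).clm_apply contDiff_const

theorem pderiv1_sum {κ : Type} (P : Finset κ) (i : Fin n) {h : κ → (Fin n → ℝ) → ℝ}
    (hh : ∀ k, ContDiff ℝ (⊤ : ℕ∞) (h k)) :
    pderiv1 i (fun x => ∑ k ∈ P, h k x) = fun x => ∑ k ∈ P, pderiv1 i (h k) x := by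
  funext x
  simp only [pderiv1]
  rw [fderiv_fun_sum fun k _ => ((hh k).differentiable (by simp)).differentiableAt]
  simp

theorem pderiv1_congr (i : Fin n) {h h' : (Fin n → ℝ) → ℝ} (e : h =ᶠ[𝓝 0] h') :
    pderiv1 i h =ᶠ[𝓝 0] pderiv1 i h' := by
  filter_upwards [e.fderiv (𝕜 := ℝ)] with x hx
  simp [pderiv1, hx]

/-- Iterated partial derivatives along the coordinates of a list. -/
noncomputable def lderiv (α : Fin n → ℕ) (L : List (Fin n)) (f : (Fin n → ℝ) → ℝ) :
    (Fin n → ℝ) → ℝ := L.foldr (fun i g => (pderiv1 i)^[α i] g) f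

theorem contDiff_iterate_pderiv1 (i : Fin n) (m : ℕ) {h : (Fin n → ℝ) → ℝ}
    (hh : ContDiff ℝ (⊤ : ℕ∞) h) : ContDiff ℝ (⊤ : ℕ∞) ((pderiv1 i)^[m] h) := by
  induction m with
  | zero => simpa using hh
  | succ m ih =>
    rw [Function.iterate_succ_apply']
    exact contDiff_pderiv1 i ih

theorem contDiff_lderiv (α : Fin n → ℕ) (L : List (Fin n)) {h : (Fin n → ℝ) → ℝ}
    (hh : ContDiff ℝ (⊤ : ℕ∞) h) : ContDiff ℝ (⊤ : ℕ∞) (lderiv α L h) := by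
  induction L with
  | nil => simpa [lderiv] using hh
  | cons i L ih => exact contDiff_iterate_pderiv1 i (α i) ih

theorem lderiv_sum {κ : Type} (P : Finset κ) (α : Fin n → ℕ) (L : List (Fin n))
    {h : κ → (Fin n → ℝ) → ℝ} (hh : ∀ k, ContDiff ℝ (⊤ : ℕ∞) (h k)) :
    lderiv α L (fun x => ∑ k ∈ P, h k x) = fun x => ∑ k ∈ P, lderiv α L (h k) x := by
  have it : ∀ (i : Fin n) (m : ℕ) (h : κ → (Fin n → ℝ) → ℝ)
      (_ : ∀ k, ContDiff ℝ (⊤ : ℕ∞) (h k)),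
      (pderiv1 i)^[m] (fun x => ∑ k ∈ P, h k x) = fun x => ∑ k ∈ P, (pderiv1 i)^[m] (h k) x := by
    intro i m
    induction m with
    | zero => simp
    | succ m ih =>
      intro h hh
      rw [Function.iterate_succ_apply, pderiv1_sum P i hh, ih _ fun k => contDiff_pderiv1 i (hh k)]
      rfl
  induction L with
  | nil => rfl
  | cons i L ih =>
    change (pderiv1 i)^[α i] (lderiv α L _) = _
    rw [ih, it i (α i) _ fun k => contDiff_lderiv α L (hh k)]
    rfl

theorem lderiv_congr (α : Fin n → ℕ) (L : List (Fin n)) {h h' : (Fin n → ℝ) → ℝ}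
    (e : h =ᶠ[𝓝 0] h') : lderiv α L h =ᶠ[𝓝 0] lderiv α L h' := by
  have it : ∀ (i : Fin n) (m : ℕ) {h h' : (Fin n → ℝ) → ℝ}, h =ᶠ[𝓝 0] h' →
      (pderiv1 i)^[m] h =ᶠ[𝓝 0] (pderiv1 i)^[m] h' := by
    intro i m
    induction m with
    | zero => simp
    | succ m ih => intro h h' e; exact ih (pderiv1_congr i e)
  induction L with
  | nil => exact e
  | cons i L ih => exact it i (α i) ih

theorem pderiv1_pow_mul (i j : Fin n) (m : ℕ) {h : (Fin n → ℝ) → ℝ}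
    (hh : ContDiff ℝ (⊤ : ℕ∞) h) (x : Fin n → ℝ) :
    pderiv1 j (fun x => x i ^ m * h x) x =
      x i ^ m * pderiv1 j h x + (if i = j then m * x i ^ (m - 1) * h x else 0) := by
  have h1 : HasFDerivAt (fun x : Fin n → ℝ => x i ^ m)
      ((m * x i ^ (m - 1)) • ContinuousLinearMap.proj (R := ℝ) (φ := fun _ : Fin n => ℝ) i) x := by
    simpa [smul_smul] using (hasFDerivAt_apply (𝕜 := ℝ) (F' := fun _ : Fin n => ℝ) i x).pow m
  have h2 := (hh.differentiable (by simp)).differentiableAt (x := x) |>.hasFDerivAt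
  have h3 := (h1.mul h2).fderiv
  simp only [pderiv1]
  have e : (fun x => x i ^ m * h x) = (fun x : Fin n → ℝ => x i ^ m) * h := rfl
  rw [e, h3]
  simp only [add_apply, smul_apply, smul_eq_mul,
    ContinuousLinearMap.proj_apply, Pi.single_apply]
  split_ifs <;> ring

/-- `h` is divisible by `x_i^m` among smooth functions. -/
def DivPow (i : Fin n) (m : ℕ) (h : (Fin n → ℝ) → ℝ) : Prop :=
  ∃ q, ContDiff ℝ (⊤ : ℕ∞) q ∧ h = fun x => x i ^ m * q x

theorem DivPow.pderiv1_ne {i j : Fin n} (hij : i ≠ j) {m : ℕ} {h : (Fin n → ℝ) → ℝ}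
    (hh : DivPow i m h) : DivPow i m (pderiv1 j h) := by
  obtain ⟨q, hq, rfl⟩ := hh
  refine ⟨pderiv1 j q, contDiff_pderiv1 j hq, funext fun x => ?_⟩
  rw [pderiv1_pow_mul i j m hq, if_neg hij, add_zero]

theorem DivPow.pderiv1_self {i : Fin n} {m : ℕ} {h : (Fin n → ℝ) → ℝ}
    (hh : DivPow i (m + 1) h) : DivPow i m (pderiv1 i h) := by
  obtain ⟨q, hq, rfl⟩ := hh
  refine ⟨fun x => x i * pderiv1 i q x + (m + 1) * q x, ?_, funext fun x => ?_⟩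
  · have := contDiff_pderiv1 i hq
    fun_prop
  · rw [pderiv1_pow_mul i i (m + 1) hq, if_pos rfl]
    push_cast
    ring

theorem DivPow.lderiv {i : Fin n} {N : ℕ} {α : Fin n → ℕ} (hα : α i ≤ N)
    {h : (Fin n → ℝ) → ℝ} (hh : DivPow i N h) {L : List (Fin n)} (hL : L.Nodup) :
    DivPow i (if i ∈ L then N - α i else N) (lderiv α L h) := by
  have it1 : ∀ (j : Fin n) (m k : ℕ) (h : (Fin n → ℝ) → ℝ), i ≠ j → DivPow i k h →
      DivPow i k ((pderiv1 j)^[m] h) := by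
    intro j m k
    induction m with
    | zero => intro h _ hh; simpa using hh
    | succ m ih => intro h hij hh; exact ih _ hij (hh.pderiv1_ne hij)
  have it2 : ∀ (m k : ℕ) (h : (Fin n → ℝ) → ℝ), DivPow i (k + m) h →
      DivPow i k ((pderiv1 i)^[m] h) := by
    intro m k
    induction m with
    | zero => intro h hh; simpa using hh
    | succ m ih => intro h hh; exact ih _ (DivPow.pderiv1_self hh)
  induction L with
  | nil => simpa [KN.lderiv] using hh
  | cons j L ih =>
    rw [List.nodup_cons] at hL
    specialize ih hL.2
    change DivPow i _ ((pderiv1 j)^[α j] (KN.lderiv α L h))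
    by_cases hij : i = j
    · subst hij
      simp only [hL.1, if_false] at ih
      simp only [List.mem_cons, true_or, if_true]
      refine it2 _ _ _ ?_
      rwa [Nat.sub_add_cancel hα]
    · simpa [hij] using it1 j (α j) _ _ hij ih

theorem pderiv1_mono (c : ℝ) (p : Fin n → ℕ) (i : Fin n) :
    pderiv1 i (fun x => c * mono p x) = fun x => (c * p i) * mono (p - Pi.single i 1) x := by
  classical
  funext x
  have e : (fun x => c * mono p x) =
      fun x : Fin n → ℝ => x i ^ p i * (c * mono (p - Pi.single i (p i)) x) := by
    funext y
    have : p = Pi.single i (p i) + (p - Pi.single i (p i)) := by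
      funext j
      by_cases hj : j = i
      · subst hj; simp
      · simp [hj]
    conv_lhs => rw [this, mono_add, mono_single]
    ring
  have hz : pderiv1 i (fun x => c * mono (p - Pi.single i (p i)) x) x = 0 := by
    have hd : DependsOn (fun x => c * mono (p - Pi.single i (p i)) x) {j | j ≠ i} := by
      intro y z hyz
      simp only [mono]
      congr 1
      refine Finset.prod_congr rfl fun j _ => ?_
      by_cases hj : j = i
      · subst hj; simp
      · rw [hyz j hj]
    have hs : ContDiff ℝ (⊤ : ℕ∞) (fun x => c * mono (p - Pi.single i (p i)) x) :=
      contDiff_const.mul (contDiff_mono _)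
    have h1 := ((hs.differentiable (by simp)).differentiableAt (x := x)).hasFDerivAt
    have h2 : HasDerivAt (fun t : ℝ => x + t • (Pi.single i 1 : Fin n → ℝ))
        (Pi.single i 1) 0 := by
      simpa using ((hasDerivAt_id (0:ℝ)).smul_const (Pi.single i 1 : Fin n → ℝ)).const_add x
    have h3 := HasFDerivAt.comp_hasDerivAt (0:ℝ) (by simpa using h1) h2
    have h4 : (fun x => c * mono (p - Pi.single i (p i)) x) ∘
        (fun t : ℝ => x + t • (Pi.single i 1 : Fin n → ℝ)) =
        fun _ => c * mono (p - Pi.single i (p i)) x := by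
      funext t
      refine hd fun j hj => ?_
      simp [Pi.single_eq_of_ne (show j ≠ i from hj)]
    rw [h4] at h3
    exact (h3.unique (hasDerivAt_const (0:ℝ) _))
  rw [e, pderiv1_pow_mul i i (p i) (contDiff_const.mul (contDiff_mono _)), hz, if_pos rfl]
  have : p - Pi.single i 1 = Pi.single i (p i - 1) + (p - Pi.single i (p i)) := by
    funext j
    by_cases hj : j = i
    · subst hj; simp
    · simp [hj]
  rw [this, mono_add, mono_single]
  ring

theorem lderiv_mono (c : ℝ) (p α : Fin n → ℕ) {L : List (Fin n)} (hL : L.Nodup) :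
    lderiv α L (fun x => c * mono p x) = fun x =>
      (c * (L.map fun i => ((p i).descFactorial (α i) : ℝ)).prod) *
        mono (fun i => if i ∈ L then p i - α i else p i) x := by
  have it : ∀ (i : Fin n) (m : ℕ) (c : ℝ) (p : Fin n → ℕ),
      (pderiv1 i)^[m] (fun x => c * mono p x) =
        fun x => (c * ((p i).descFactorial m : ℝ)) * mono (p - Pi.single i m) x := by
    intro i m
    induction m with
    | zero => intro c p; simp
    | succ m ih =>
      intro c p
      rw [Function.iterate_succ_apply', ih, pderiv1_mono]
      funext x
      have e1 : p - Pi.single i m - Pi.single i 1 = p - Pi.single i (m + 1) := by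
        rw [Pi.single_add, tsub_tsub]
      rw [e1, Nat.descFactorial_succ]
      simp
      left
      ring
  induction L with
  | nil => simp [lderiv]
  | cons i L ih =>
    rw [List.nodup_cons] at hL
    change (pderiv1 i)^[α i] (lderiv α L _) = _
    rw [ih hL.2, it]
    funext x
    simp only [hL.1, if_false, List.map_cons, List.prod_cons]
    have e : ((fun j => if j ∈ L then p j - α j else p j) - Pi.single i (α i) : Fin n → ℕ) =
        fun j => if j ∈ i :: L then p j - α j else p j := by
      funext j
      by_cases hj : j = i
      · subst hj; simp [hL.1]
      · simp [hj]
    rw [e]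
    ring

theorem taylorCoeff_congr {f F : (Fin n → ℝ) → ℝ} (e : f =ᶠ[𝓝 0] F) (α : Fin n → ℕ) :
    taylorCoeff f α = taylorCoeff F α := by
  simp only [taylorCoeff]
  rw [show mderiv α f 0 = mderiv α F 0 from (lderiv_congr α (List.finRange n) e).eq_of_nhds]

/-- Taylor coefficients of an expansion as in `taylor_box`. -/
theorem taylorCoeff_eq_sum {κ : Type} [Fintype κ] {N : ℕ} {p : κ → Fin n → ℕ}
    {g : κ → (Fin n → ℝ) → ℝ} (hg : ∀ k, ContDiff ℝ (⊤ : ℕ∞) (g k))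
    (hd : ∀ k, DependsOn (g k) {i | N ≤ p k i}) {F : (Fin n → ℝ) → ℝ}
    (hF : ∀ x, F x = ∑ k, mono (p k) x * g k x) {α : Fin n → ℕ} (hα : ∀ i, α i < N) :
    taylorCoeff F α = ∑ k with p k = α, g k 0 := by
  classical
  have hnd := List.nodup_finRange n
  have hF' : F = fun x => ∑ k, mono (p k) x * g k x := funext hF
  have hs : ∀ k, ContDiff ℝ (⊤ : ℕ∞) (fun x => mono (p k) x * g k x) :=
    fun k => (contDiff_mono _).mul (hg k)
  have h1 : mderiv α F 0 = ∑ k, lderiv α (List.finRange n) (fun x => mono (p k) x * g k x) 0 := by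
    rw [hF']
    exact congrFun (lderiv_sum Finset.univ α (List.finRange n) hs) 0
  have hfac : (((∏ i, Nat.factorial (α i) : ℕ) : ℝ)) ≠ 0 := by
    exact_mod_cast Finset.prod_ne_zero_iff.2 fun i _ => Nat.factorial_ne_zero _
  rw [taylorCoeff, h1, div_eq_iff hfac, Finset.sum_mul, Finset.sum_filter]
  refine Finset.sum_congr rfl fun k _ => ?_
  by_cases hk : ∀ i, p k i < N
  · have hc : (fun x => mono (p k) x * g k x) = fun x => g k 0 * mono (p k) x := by
      funext x
      rw [mul_comm, hd k (x := x) (y := 0) fun i hi => absurd (hk i) (not_lt.2 hi)]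
    rw [hc, lderiv_mono _ _ _ hnd]
    simp only [List.mem_finRange, if_true]
    rw [← List.ofFn_eq_map, List.prod_ofFn]
    split_ifs with hpa
    · subst hpa
      simp [Nat.descFactorial_self, mono]
    · obtain ⟨i, hi⟩ := Function.ne_iff.1 hpa
      rcases lt_or_gt_of_ne hi with hi | hi
      · rw [Finset.prod_eq_zero (Finset.mem_univ i)]
        · simp
        · exact_mod_cast Nat.descFactorial_eq_zero_iff_lt.2 hi
      · have : mono (fun i => p k i - α i) (0 : Fin n → ℝ) = 0 := by
          rw [mono]
          refine Finset.prod_eq_zero (Finset.mem_univ i) ?_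
          simp
          omega
        rw [this, mul_zero]
  · push Not at hk
    obtain ⟨i, hi⟩ := hk
    have hpa : p k ≠ α := fun h => absurd (hα i) (not_lt.2 (h ▸ hi))
    rw [if_neg hpa]
    have hdiv : DivPow i N (fun x => mono (p k) x * g k x) := by
      refine ⟨fun x => mono (p k - Pi.single i N) x * g k x,
        (contDiff_mono _).mul (hg k), funext fun x => ?_⟩
      have : p k = Pi.single i N + (p k - Pi.single i N) := by
        funext j
        by_cases hj : j = i
        · subst hj; simp [hi]
        · simp [hj]
      conv_lhs => rw [this, mono_add, mono_single]
      ring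
    obtain ⟨q, -, hq⟩ := hdiv.lderiv (hα i).le hnd
    rw [hq]
    simp only [List.mem_finRange, if_true, Pi.zero_apply]
    rw [zero_pow (Nat.sub_ne_zero_of_lt (hα i)), zero_mul]

end Taylor

section Limit

/-- The pairing of vectors of naturals. -/
def dotN (a p : Fin n → ℕ) : ℕ := ∑ i, a i * p i

theorem mono_scaleAction (a p : Fin n → ℕ) (t : ℝ) (x : Fin n → ℝ) :
    mono p (scaleAction a t x) = t ^ dotN a p * mono p x := by
  simp only [mono, scaleAction, mul_pow, Finset.prod_mul_distrib, dotN, ← pow_mul,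
    Finset.prod_pow_eq_pow_sum]

theorem polynomial_eq_zero_of_isBigO (l : ℕ) :
    ∀ Q : Polynomial ℝ, Q.degree < l →
      (fun t => Q.eval t) =O[𝓝[>] (0:ℝ)] (fun t => t ^ l) → Q = 0 := by
  induction l with
  | zero => intro Q hQ _; simpa using hQ
  | succ l ih =>
    intro Q hQ hO
    have h0 : Q.coeff 0 = 0 := by
      have h1 : Tendsto (fun t => Q.eval t) (𝓝[>] (0:ℝ)) (𝓝 0) := by
        refine hO.trans_tendsto ?_
        have : Tendsto (fun t : ℝ => t ^ (l + 1)) (𝓝 0) (𝓝 (0 ^ (l + 1))) :=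
          (continuous_pow (l + 1)).tendsto 0
        simp only [ne_eq, Nat.add_eq_zero_iff, one_ne_zero, and_false, not_false_eq_true,
          zero_pow] at this
        exact this.mono_left nhdsWithin_le_nhds
      have h2 : Tendsto (fun t => Q.eval t) (𝓝[>] (0:ℝ)) (𝓝 (Q.eval 0)) :=
        (Q.continuous.tendsto 0).mono_left nhdsWithin_le_nhds
      rw [Polynomial.coeff_zero_eq_eval_zero]
      exact tendsto_nhds_unique h2 h1
    have hX : Q = Q.divX * Polynomial.X := by
      conv_lhs => rw [← Polynomial.divX_mul_X_add Q, h0]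
      simp
    have hdeg : Q.divX.degree < l := by
      by_cases hz : Q = 0
      · simp [hz]
      · have hd : Q.divX ≠ 0 := by
          intro h
          rw [h, zero_mul] at hX
          exact hz hX
        rw [hX, Polynomial.degree_mul, Polynomial.degree_X,
          Polynomial.degree_eq_natDegree hd] at hQ
        rw [Polynomial.degree_eq_natDegree hd]
        norm_cast at hQ ⊢
        omega
    have hO' : (fun t => Q.divX.eval t) =O[𝓝[>] (0:ℝ)] (fun t => t ^ l) := by
      obtain ⟨C, hC⟩ := hO.bound
      refine Asymptotics.IsBigO.of_bound C ?_
      filter_upwards [hC, self_mem_nhdsWithin] with t ht htpos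
      have htpos : 0 < t := htpos
      rw [hX, Polynomial.eval_mul, Polynomial.eval_X, norm_mul, pow_succ, norm_mul,
        ← mul_assoc] at ht
      exact le_of_mul_le_mul_right ht (norm_pos_iff.2 htpos.ne')
    rw [hX, ih _ hdeg hO', zero_mul]

theorem scaleAction_mem_box {δ : ℝ} {a : Fin n → ℕ} {t : ℝ} (h0 : 0 ≤ t) (h1 : t ≤ 1)
    {x : Fin n → ℝ} (hx : ∀ i, |x i| < δ) (i : Fin n) : |scaleAction a t x i| < δ := by
  simp only [scaleAction, abs_mul]
  refine lt_of_le_of_lt ?_ (hx i)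
  have : |t ^ a i| ≤ 1 := by
    rw [abs_pow, abs_of_nonneg h0]
    exact pow_le_one₀ h0 h1
  nlinarith [abs_nonneg (x i)]

/-- If `F(t^a x)/t^l` converges as `t → 0⁺`, the terms of weight `< l` can be dropped from an
expansion as in `taylor_box`. -/
theorem sum_drop_of_limit {κ : Type} (P : Finset κ) {N l : ℕ} (hl : l ≤ N)
    {p : κ → Fin n → ℕ} {g : κ → (Fin n → ℝ) → ℝ} (hg : ∀ k, Continuous (g k))
    (hd : ∀ k, DependsOn (g k) {i | N ≤ p k i}) {F : (Fin n → ℝ) → ℝ} {δ : ℝ} {a : Fin n → ℕ}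
    (hF : ∀ x : Fin n → ℝ, (∀ i, |x i| < δ) → F x = ∑ k ∈ P, mono (p k) x * g k x)
    (hlim : ∀ x : Fin n → ℝ, (∀ i, |x i| < δ) →
      ∃ c : ℝ, Tendsto (fun t : ℝ => F (scaleAction a t x) / t ^ l) (𝓝[>] (0:ℝ)) (𝓝 c))
    (x : Fin n → ℝ) (hx : ∀ i, |x i| < δ) :
    F x = ∑ k ∈ P with l ≤ dotN a (p k), mono (p k) x * g k x := by
  classical
  set Q : Polynomial ℝ := ∑ k ∈ P with ¬ l ≤ dotN a (p k),
    Polynomial.C (mono (p k) x * g k x) * Polynomial.X ^ dotN a (p k) with hQ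
  have hQdeg : Q.degree < l := by
    refine (Polynomial.degree_sum_le _ _).trans_lt ?_
    rw [Finset.sup_lt_iff (by exact WithBot.bot_lt_coe l)]
    intro k hk
    refine (Polynomial.degree_C_mul_X_pow_le _ _).trans_lt ?_
    have := (Finset.mem_filter.1 hk).2
    exact_mod_cast not_le.1 this
  have hsc : Continuous fun t : ℝ => scaleAction a t x := by
    refine continuous_pi fun i => ?_
    simp only [scaleAction]
    fun_prop
  have hev : ∀ᶠ t in 𝓝[>] (0:ℝ), Q.eval t = F (scaleAction a t x) -
      ∑ k ∈ P with l ≤ dotN a (p k),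
        t ^ dotN a (p k) * (mono (p k) x * g k (scaleAction a t x)) := by
    have hlt : ∀ᶠ t in 𝓝[>] (0:ℝ), t < 1 :=
      nhdsWithin_le_nhds (gt_mem_nhds one_pos)
    filter_upwards [self_mem_nhdsWithin, hlt] with t ht ht1
    have ht : 0 < t := ht
    rw [hF _ (scaleAction_mem_box ht.le ht1.le hx), eq_sub_iff_add_eq,
      ← Finset.sum_filter_add_sum_filter_not P (fun k => l ≤ dotN a (p k)), add_comm]
    congr 1
    · refine Finset.sum_congr rfl fun k _ => ?_
      rw [mono_scaleAction, mul_assoc]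
    · rw [hQ, Polynomial.eval_finsetSum]
      refine Finset.sum_congr rfl fun k hk => ?_
      have hk' := not_le.1 (Finset.mem_filter.1 hk).2
      have hgk : g k (scaleAction a t x) = g k x := by
        refine hd k fun i hi => ?_
        have hai : a i = 0 := by
          by_contra hne
          have h1 : a i * p k i ≤ dotN a (p k) :=
            Finset.single_le_sum (f := fun i => a i * p k i) (fun _ _ => Nat.zero_le _)
              (Finset.mem_univ i)
          have h2 : p k i ≤ a i * p k i := Nat.le_mul_of_pos_left _ (Nat.pos_of_ne_zero hne)
          have h3 : N ≤ p k i := hi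
          omega
        simp [scaleAction, hai]
      rw [mono_scaleAction, hgk]
      simp
      ring
  have hO : (fun t => Q.eval t) =O[𝓝[>] (0:ℝ)] (fun t => t ^ l) := by
    refine Asymptotics.IsBigO.congr' (Asymptotics.IsBigO.sub ?_ ?_)
      (EventuallyEq.symm hev) EventuallyEq.rfl
    · obtain ⟨c, hc⟩ := hlim x hx
      have h1 := (hc.isBigO_one ℝ).mul (Asymptotics.isBigO_refl (fun t : ℝ => t ^ l) (𝓝[>] 0))
      refine h1.congr' ?_ (by simp)
      filter_upwards [self_mem_nhdsWithin] with t ht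
      have ht : 0 < t := ht
      field_simp
    · refine Asymptotics.IsBigO.fun_sum fun k hk => ?_
      have hk' := (Finset.mem_filter.1 hk).2
      have h1 : (fun t : ℝ => t ^ dotN a (p k)) =O[𝓝[>] (0:ℝ)] (fun t => t ^ l) := by
        refine Asymptotics.IsBigO.of_bound 1 ?_
        have hlt : ∀ᶠ t in 𝓝[>] (0:ℝ), t < 1 :=
          nhdsWithin_le_nhds (gt_mem_nhds one_pos)
        filter_upwards [self_mem_nhdsWithin, hlt] with t ht ht1
        have ht : 0 < t := ht
        rw [one_mul, norm_pow, norm_pow, Real.norm_of_nonneg ht.le]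
        exact pow_le_pow_of_le_one ht.le ht1.le hk'
      have h2 : (fun t : ℝ => mono (p k) x * g k (scaleAction a t x)) =O[𝓝[>] (0:ℝ)]
          (fun _ => (1:ℝ)) :=
        Tendsto.isBigO_one ℝ (((continuous_const.mul ((hg k).comp hsc)).tendsto 0).mono_left
          nhdsWithin_le_nhds)
      simpa using h1.mul h2
  have hQ0 := polynomial_eq_zero_of_isBigO l Q hQdeg hO
  have h1 : Q.eval 1 = ∑ k ∈ P with ¬ l ≤ dotN a (p k), mono (p k) x * g k x := by
    rw [hQ, Polynomial.eval_finsetSum]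
    simp
  rw [hQ0, Polynomial.eval_zero] at h1
  rw [hF x hx, ← Finset.sum_filter_add_sum_filter_not P (fun k => l ≤ dotN a (p k)), ← h1,
    add_zero]

end Limit

section Newton

variable {f : (Fin n → ℝ) → ℝ}

theorem dot_natPt (a p : Fin n → ℕ) : dot (natPt a) (natPt p) = dotN a p := by
  simp [dot, natPt, dotN]

theorem dot_add_right (a x y : Fin n → ℝ) : dot a (x + y) = dot a x + dot a y := by
  simp [dot, mul_add, Finset.sum_add_distrib]

theorem dot_smul_right (a x : Fin n → ℝ) (c : ℝ) : dot a (c • x) = c * dot a x := by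
  simp only [dot, Pi.smul_apply, smul_eq_mul, Finset.mul_sum]
  exact Finset.sum_congr rfl fun i _ => by ring

theorem convex_hhalf (a : Fin n → ℝ) (l : ℝ) : Convex ℝ (Hhalf a l) := by
  intro x hx y hy s t hs ht hst
  simp only [Hhalf, mem_ofPred_eq, dot_add_right, dot_smul_right] at *
  have h1 := mul_le_mul_of_nonneg_left hx hs
  have h2 := mul_le_mul_of_nonneg_left hy ht
  calc l = s * l + t * l := by rw [← add_mul, hst, one_mul]
    _ ≤ _ := add_le_add h1 h2

theorem newton_subset_hhalf {a : Fin n → ℕ} {l : ℕ}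
    (h : ∀ α, taylorCoeff f α ≠ 0 → l ≤ dotN a α) :
    NewtonPolyhedron f ⊆ Hhalf (natPt a) l := by
  refine convexHull_min ?_ (convex_hhalf _ _)
  rintro x ⟨α, hα, hx⟩
  have h1 : (l : ℝ) ≤ dotN a α := by exact_mod_cast h α hα
  have h2 : (dotN a α : ℝ) ≤ dot (natPt a) x := by
    rw [← dot_natPt]
    exact Finset.sum_le_sum fun i _ => mul_le_mul_of_nonneg_left (hx i) (Nat.cast_nonneg _)
  exact h1.trans h2

theorem natPt_mem_newton {α : Fin n → ℕ} (hα : taylorCoeff f α ≠ 0) :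
    natPt α ∈ NewtonPolyhedron f :=
  subset_convexHull _ _ ⟨α, hα, fun _ => le_rfl⟩

theorem exists_taylorCoeff_ne_zero (hΓ : (NewtonPolyhedron f).Nonempty) :
    ∃ α, taylorCoeff f α ≠ 0 := by
  obtain ⟨x, α, hα, -⟩ := convexHull_nonempty_iff.1 hΓ
  exact ⟨α, hα⟩

/-- The natural-number version of `l(a)`. -/
noncomputable def lnat (f : (Fin n → ℝ) → ℝ) (a : Fin n → ℕ) : ℕ :=
  sInf (dotN a '' {α | taylorCoeff f α ≠ 0})

theorem lnat_le {a α : Fin n → ℕ} (hα : taylorCoeff f α ≠ 0) : lnat f a ≤ dotN a α :=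
  Nat.sInf_le ⟨α, hα, rfl⟩

theorem exists_dotN_eq_lnat (hΓ : (NewtonPolyhedron f).Nonempty) (a : Fin n → ℕ) :
    ∃ α, taylorCoeff f α ≠ 0 ∧ dotN a α = lnat f a := by
  obtain ⟨α, hα⟩ := exists_taylorCoeff_ne_zero hΓ
  exact Nat.sInf_mem (s := dotN a '' {α | taylorCoeff f α ≠ 0}) ⟨_, α, hα, rfl⟩

theorem lval_newton (hΓ : (NewtonPolyhedron f).Nonempty) (a : Fin n → ℕ) :
    lval (NewtonPolyhedron f) (natPt a) = lnat f a := by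
  have hlow : ∀ y ∈ NewtonPolyhedron f, (lnat f a : ℝ) ≤ dot (natPt a) y := fun y hy =>
    newton_subset_hhalf (a := a) (fun α hα => lnat_le hα) hy
  obtain ⟨α, hα, he⟩ := exists_dotN_eq_lnat hΓ a
  refine IsLeast.csInf_eq ⟨⟨natPt α, natPt_mem_newton hα, ?_⟩, ?_⟩
  · rw [dot_natPt, he]
  · rintro _ ⟨y, hy, rfl⟩
    exact hlow y hy

theorem isFaceOf_newton {b : Fin n → ℕ} {L : ℕ} (h : ∀ α, taylorCoeff f α ≠ 0 → L ≤ dotN b α) :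
    IsFaceOf (NewtonPolyhedron f) (NewtonPolyhedron f ∩ Hplane (natPt b) L) := by
  have e : intPt (fun i => (b i : ℤ)) = natPt b := by funext i; simp [intPt, natPt]
  refine ⟨fun i => (b i : ℤ), (L : ℤ), ?_, ?_⟩
  · rw [ValidPair, e]
    exact newton_subset_hhalf h
  · rw [e]; rfl

theorem exists_limit_of_memEhatP {U : Set (Fin n → ℝ)}
    (hE : MemEhatP (NewtonPolyhedron f) U f) (a : Fin n → ℕ) {x : Fin n → ℝ} (hx : x ∈ U) :
    ∃ c : ℝ, Tendsto (fun t : ℝ => f (scaleAction a t x) / t ^ lnat f a) (𝓝[>] (0:ℝ)) (𝓝 c) :=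
  hE.2.2 _ (isFaceOf_newton (b := a) fun _ hα => lnat_le hα) x hx a (lnat f a)
    ⟨newton_subset_hhalf fun _ hα => lnat_le hα, rfl⟩

theorem dotN_sum_left {κ : Type*} (s : Finset κ) (a : κ → Fin n → ℕ) (p : Fin n → ℕ) :
    dotN (∑ j ∈ s, a j) p = ∑ j ∈ s, dotN (a j) p := by
  simp only [dotN, Finset.sum_apply, Finset.sum_mul]
  exact Finset.sum_comm

theorem exists_dotN_gen_eq_lnat (S : SimplicialSubdivision n (NewtonPolyhedron f)) (σ : S.ι) :
    ∃ q, taylorCoeff f q ≠ 0 ∧ ∀ j, dotN (S.gen σ j) q = lnat f (S.gen σ j) := by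
  obtain ⟨γ, ⟨a, l, -, hγ⟩, ⟨y, hy⟩, hsub⟩ := S.subordinate σ
  have hyΓ : y ∈ NewtonPolyhedron f := by rw [hγ] at hy; exact hy.1
  have hΓ : (NewtonPolyhedron f).Nonempty := ⟨y, hyΓ⟩
  by_contra! hcon
  have hge : ∀ α, taylorCoeff f α ≠ 0 →
      (∑ j, lnat f (S.gen σ j)) + 1 ≤ dotN (∑ j, S.gen σ j) α := by
    intro α hα
    obtain ⟨j, hj⟩ := hcon α hα
    rw [dotN_sum_left]
    refine Finset.sum_lt_sum (fun j _ => lnat_le hα) ⟨j, Finset.mem_univ j, ?_⟩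
    exact lt_of_le_of_ne (lnat_le hα) (Ne.symm hj)
  have h1 := newton_subset_hhalf hge hyΓ
  have h2 : dot (natPt (∑ j, S.gen σ j)) y = ∑ j, dot (natPt (S.gen σ j)) y := by
    simp only [dot, natPt, Finset.sum_apply, Nat.cast_sum, Finset.sum_mul]
    exact Finset.sum_comm
  simp only [Hhalf, mem_ofPred_eq] at h1
  rw [h2, Finset.sum_congr rfl fun j _ => (hsub j y hy).trans (lval_newton hΓ _)] at h1
  push_cast at h1
  linarith

/-- Taylor expansion of `F` in the box, in which only monomials in the local Newton polyhedron
seen by the finitely many weights in `A` occur. -/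
theorem good_expansion {F : (Fin n → ℝ) → ℝ} (hF : ContDiff ℝ (⊤ : ℕ∞) F) {δ : ℝ}
    (hlim : ∀ x : Fin n → ℝ, (∀ i, |x i| < δ) → ∀ a : Fin n → ℕ,
      ∃ c : ℝ, Tendsto (fun t : ℝ => F (scaleAction a t x) / t ^ lnat F a) (𝓝[>] (0:ℝ)) (𝓝 c))
    (A : Finset (Fin n → ℕ)) (M : ℕ) :
    ∃ (N : ℕ) (κ : Type) (_ : Fintype κ) (p : κ → Fin n → ℕ) (g : κ → (Fin n → ℝ) → ℝ)
      (P : Finset κ), M ≤ N ∧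
      (∀ k, ContDiff ℝ (⊤ : ℕ∞) (g k)) ∧ (∀ k, DependsOn (g k) {i | N ≤ p k i}) ∧
      (∀ k, k ∈ P ↔ ∀ a ∈ A, lnat F a ≤ dotN a (p k)) ∧
      (∀ x, F x = ∑ k, mono (p k) x * g k x) ∧
      ∀ x : Fin n → ℝ, (∀ i, |x i| < δ) → F x = ∑ k ∈ P, mono (p k) x * g k x := by
  classical
  set N := M + ∑ a ∈ A, lnat F a with hN
  obtain ⟨κ, _, p, g, hg, hd, hsum⟩ := taylor_box N hF
  refine ⟨N, κ, inferInstance, p, g,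
    Finset.univ.filter fun k => ∀ a ∈ A, lnat F a ≤ dotN a (p k), by omega, hg, hd,
    by simp, hsum, ?_⟩
  have key : ∀ B ⊆ A, ∀ x : Fin n → ℝ, (∀ i, |x i| < δ) →
      F x = ∑ k with ∀ a ∈ B, lnat F a ≤ dotN a (p k), mono (p k) x * g k x := by
    intro B
    induction B using Finset.induction_on with
    | empty => intro _ x _; simpa using hsum x
    | insert b B hb ih =>
      intro hBA x hx
      have hbN : lnat F b ≤ N := by
        have := Finset.single_le_sum (f := fun a => lnat F a) (fun _ _ => Nat.zero_le _)
          (hBA (Finset.mem_insert_self b B))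
        omega
      rw [sum_drop_of_limit _ hbN (fun k => (hg k).continuous) hd
        (ih fun a ha => hBA (Finset.mem_insert_of_mem ha)) (fun x hx => hlim x hx b) x hx,
        Finset.filter_filter]
      refine Finset.sum_congr ?_ fun _ _ => rfl
      ext k
      simp [and_comm]
  exact key A subset_rfl

end Newton

section CompactFace

variable {f : (Fin n → ℝ) → ℝ}

theorem finite_dotN_eq {b : Fin n → ℕ} (hb : ∀ i, 0 < b i) (L : ℕ) :
    {α : Fin n → ℕ | dotN b α = L}.Finite := by
  refine (Set.finite_Iic (fun _ : Fin n => L)).subset fun α hα i => ?_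
  have h1 : b i * α i ≤ dotN b α := Finset.single_le_sum (f := fun i => b i * α i)
    (fun _ _ => Nat.zero_le _) (Finset.mem_univ i)
  have h2 : α i ≤ b i * α i := Nat.le_mul_of_pos_left _ (hb i)
  exact h2.trans (h1.trans (le_of_eq hα))

theorem compactFace_subset {b : Fin n → ℕ} (hb : ∀ i, 0 < b i) {L : ℕ}
    (h : ∀ α, taylorCoeff f α ≠ 0 → L ≤ dotN b α) :
    NewtonPolyhedron f ∩ Hplane (natPt b) L =
      convexHull ℝ (natPt '' {α | taylorCoeff f α ≠ 0 ∧ dotN b α = L}) := by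
  set T := natPt '' {α | taylorCoeff f α ≠ 0 ∧ dotN b α = L} with hT
  have hTL : convexHull ℝ T ⊆ Hplane (natPt b) L := by
    refine convexHull_min ?_ ?_
    · rintro _ ⟨α, ⟨-, hα⟩, rfl⟩
      simp [Hplane, dot_natPt, hα]
    · intro x hx y hy s t hs ht hst
      simp only [Hplane, mem_ofPred_eq, dot_add_right, dot_smul_right] at *
      rw [hx, hy, ← add_mul, hst, one_mul]
  refine Subset.antisymm ?_ (subset_inter ?_ hTL)
  · rintro x ⟨hx, hxL⟩
    have key : NewtonPolyhedron f ⊆ {x | (L : ℝ) < dot (natPt b) x ∨ x ∈ convexHull ℝ T} := by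
      refine convexHull_min ?_ ?_
      · rintro z ⟨α, hα, hz⟩
        have h1 : (L : ℝ) ≤ dot (natPt b) (natPt α) := by
          rw [dot_natPt]; exact_mod_cast h α hα
        by_cases hzα : z = natPt α
        · rcases h1.lt_or_eq with h2 | h2
          · left; rw [hzα]; exact h2
          · right
            refine subset_convexHull _ _ ⟨α, ⟨hα, ?_⟩, hzα.symm⟩
            rw [dot_natPt] at h2
            exact_mod_cast h2.symm
        · left
          refine h1.trans_lt ?_
          obtain ⟨i, hi⟩ := Function.ne_iff.1 hzα
          refine Finset.sum_lt_sum (fun i _ => mul_le_mul_of_nonneg_left (hz i)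
            (Nat.cast_nonneg _)) ⟨i, Finset.mem_univ i, ?_⟩
          refine mul_lt_mul_of_pos_left (lt_of_le_of_ne (hz i) (Ne.symm hi)) ?_
          exact Nat.cast_pos.2 (hb i)
      · have hge : ∀ u, ((L : ℝ) < dot (natPt b) u ∨ u ∈ convexHull ℝ T) →
            (L : ℝ) ≤ dot (natPt b) u := by
          rintro u (hu | hu)
          · exact hu.le
          · exact (hTL hu).symm.le
        intro u hu v hv s t hs ht hst
        simp only [mem_ofPred_eq, dot_add_right, dot_smul_right] at *
        have hu' := hge u hu
        have hv' := hge v hv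
        rcases hs.eq_or_lt with rfl | hs
        · have : t = 1 := by linarith
          subst this
          simpa using hv
        rcases ht.eq_or_lt with rfl | ht
        · have : s = 1 := by linarith
          subst this
          simpa using hu
        have e : (L : ℝ) = s * L + t * L := by rw [← add_mul, hst, one_mul]
        rcases hu with hu | hu
        · left; rw [e]; nlinarith
        rcases hv with hv | hv
        · left; rw [e]; nlinarith
        · right
          exact convex_convexHull ℝ T hu hv hs.le ht.le hst
    rcases key hx with h1 | h1
    · exact absurd h1 (not_lt.2 (le_of_eq hxL))
    · exact h1
  · refine convexHull_min ?_ (convex_convexHull _ _)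
    rintro _ ⟨α, ⟨hα, -⟩, rfl⟩
    exact natPt_mem_newton hα

theorem isCompact_compactFace {b : Fin n → ℕ} (hb : ∀ i, 0 < b i) {L : ℕ}
    (h : ∀ α, taylorCoeff f α ≠ 0 → L ≤ dotN b α) :
    IsCompact (NewtonPolyhedron f ∩ Hplane (natPt b) L) := by
  rw [compactFace_subset hb h]
  refine Set.Finite.isCompact_convexHull ℝ (Set.Finite.image _ ?_)
  exact (finite_dotN_eq hb L).subset fun α hα => hα.2

end CompactFace

section Nondeg

theorem pderiv1_mono_mul (p : Fin n → ℕ) {g : (Fin n → ℝ) → ℝ} (hg : ContDiff ℝ (⊤ : ℕ∞) g)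
    (i : Fin n) (x : Fin n → ℝ) :
    x i * pderiv1 i (fun x => mono p x * g x) x =
      mono p x * (p i * g x + x i * pderiv1 i g x) := by
  have h1 := ((contDiff_mono p).differentiable (by simp)).differentiableAt (x := x) |>.hasFDerivAt
  have h2 := (hg.differentiable (by simp)).differentiableAt (x := x) |>.hasFDerivAt
  have e : (fun x => mono p x * g x) = mono p * g := rfl
  have h3 := congrFun (pderiv1_mono 1 p i) x
  simp only [one_mul] at h3
  simp only [pderiv1] at h3 ⊢
  rw [e, (h1.mul h2).fderiv]
  simp only [add_apply, smul_apply, smul_eq_mul]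
  have h4 : (fun x => mono p x) = mono p := rfl
  rw [h4] at h3
  rw [h3]
  have h5 : x i * ((p i : ℝ) * mono (p - Pi.single i 1) x) = p i * mono p x := by
    rcases Nat.eq_zero_or_pos (p i) with h0 | h0
    · simp [h0]
    · have : p = Pi.single i 1 + (p - Pi.single i 1) := by
        funext j
        by_cases hj : j = i
        · subst hj; simp; omega
        · simp [hj]
      conv_rhs => rw [this, mono_add, mono_single]
      have e1 : ((p i - 1 : ℕ) : ℝ) = p i - 1 := by
        rw [Nat.cast_sub (by omega : 1 ≤ p i)]; simp
      simp only [Pi.add_apply, Pi.single_eq_same, Pi.sub_apply, pow_one]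
      push_cast
      rw [e1]
      ring
  linear_combination (g x) * h5

theorem euler_sum {κ : Type} (P : Finset κ) (p : κ → Fin n → ℕ) {g : κ → (Fin n → ℝ) → ℝ}
    (hg : ∀ k, ContDiff ℝ (⊤ : ℕ∞) (g k)) (i : Fin n) (x : Fin n → ℝ) :
    x i * pderiv1 i (fun x => ∑ k ∈ P, mono (p k) x * g k x) x =
      ∑ k ∈ P, mono (p k) x * (p k i * g k x + x i * pderiv1 i (g k) x) := by
  rw [pderiv1_sum P i fun k => (contDiff_mono _).mul (hg k), Finset.mul_sum]
  exact Finset.sum_congr rfl fun k _ => pderiv1_mono_mul (p k) (hg k) i x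

/-- The toric parametrization `x_i = ε_i ∏ y_j^{a_j(i)}`. -/
def cellPt (a : Fin n → Fin n → ℕ) (ε y : Fin n → ℝ) : Fin n → ℝ :=
  fun i => ε i * ∏ j, y j ^ a j i

theorem mono_cellPt (a : Fin n → Fin n → ℕ) (ε y : Fin n → ℝ) (p : Fin n → ℕ) :
    mono p (cellPt a ε y) = mono p ε * mono (fun j => dotN (a j) p) y := by
  simp only [mono, cellPt, mul_pow, Finset.prod_mul_distrib, ← Finset.prod_pow, dotN,
    ← Finset.prod_pow_eq_pow_sum, ← pow_mul]
  congr 1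
  exact Finset.prod_comm

theorem isOpen_box (δ : ℝ) : IsOpen {x : Fin n → ℝ | ∀ i, |x i| < δ} := by
  simp only [Set.ofPred_forall]
  exact isOpen_iInter_of_finite fun i => isOpen_lt (by fun_prop) continuous_const

theorem gammaPartPoly_eq {F : (Fin n → ℝ) → ℝ} {N : ℕ} {κ : Type} [Fintype κ]
    {p : κ → Fin n → ℕ} {g : κ → (Fin n → ℝ) → ℝ} {P : Finset κ}
    (hg : ∀ k, ContDiff ℝ (⊤ : ℕ∞) (g k)) (hd : ∀ k, DependsOn (g k) {i | N ≤ p k i})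
    {A : Finset (Fin n → ℕ)} (hP : ∀ k, k ∈ P ↔ ∀ a ∈ A, lnat F a ≤ dotN a (p k))
    (hF : ∀ x, F x = ∑ k, mono (p k) x * g k x) {b : Fin n → ℕ} (hb : ∀ i, 0 < b i) {L : ℕ}
    (hL : L < N) (x : Fin n → ℝ) :
    gammaPartPoly F (NewtonPolyhedron F ∩ Hplane (natPt b) L) x =
      ∑ k ∈ P with dotN b (p k) = L, mono (p k) x * g k 0 := by
  classical
  set γ := NewtonPolyhedron F ∩ Hplane (natPt b) L with hγ
  have hlt : ∀ α : Fin n → ℕ, dotN b α = L → ∀ i, α i < N := by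
    intro α hα i
    have h1 : b i * α i ≤ dotN b α := Finset.single_le_sum (f := fun i => b i * α i)
      (fun _ _ => Nat.zero_le _) (Finset.mem_univ i)
    have h2 : α i ≤ b i * α i := Nat.le_mul_of_pos_left _ (hb i)
    omega
  have hcoef : ∀ α, dotN b α = L → taylorCoeff F α = ∑ k with p k = α, g k 0 :=
    fun α hα => taylorCoeff_eq_sum hg hd hF (hlt α hα)
  have hmem : ∀ α, natPt α ∈ γ → dotN b α = L := by
    rintro α ⟨-, hα⟩
    simp only [Hplane, mem_ofPred_eq, dot_natPt] at hα
    exact_mod_cast hα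
  have hmem' : ∀ α, dotN b α = L → taylorCoeff F α ≠ 0 → natPt α ∈ γ := by
    intro α hα hc
    refine ⟨natPt_mem_newton hc, ?_⟩
    simp [Hplane, dot_natPt, hα]
  set P' := P.filter fun k => dotN b (p k) = L with hP'
  have h1 : gammaPartPoly F γ x = ∑' α : Fin n → ℕ,
      ({α | natPt α ∈ γ} : Set (Fin n → ℕ)).indicator (fun α => taylorCoeff F α * mono α x) α :=
    tsum_subtype ({α | natPt α ∈ γ} : Set (Fin n → ℕ)) (fun α => taylorCoeff F α * mono α x)
  rw [h1, tsum_eq_sum (s := P'.image p)]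
  · have h2 : ∀ α ∈ P'.image p, ({α | natPt α ∈ γ} : Set (Fin n → ℕ)).indicator
        (fun α => taylorCoeff F α * mono α x) α =
        ∑ k ∈ P' with p k = α, mono (p k) x * g k 0 := by
      intro α hα
      obtain ⟨k', hk', rfl⟩ := Finset.mem_image.1 hα
      rw [hP', Finset.mem_filter] at hk'
      have e1 : ({α | natPt α ∈ γ} : Set (Fin n → ℕ)).indicator
        (fun α => taylorCoeff F α * mono α x) (p k') = taylorCoeff F (p k') * mono (p k') x := by
        by_cases hc : taylorCoeff F (p k') = 0
        · rw [Set.indicator_apply]; simp [hc]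
        · rw [Set.indicator_of_mem]
          exact hmem' _ hk'.2 hc
      rw [e1, hcoef _ hk'.2, Finset.sum_mul]
      have e2 : (Finset.univ.filter fun k => p k = p k') = P'.filter fun k => p k = p k' := by
        ext k
        simp only [Finset.mem_filter, Finset.mem_univ, true_and, hP', hP]
        constructor
        · intro h
          rw [h]
          exact ⟨⟨(hP k').1 hk'.1, hk'.2⟩, rfl⟩
        · exact fun h => h.2
      rw [e2]
      refine Finset.sum_congr rfl fun k hk => ?_
      rw [(Finset.mem_filter.1 hk).2, mul_comm]
    rw [Finset.sum_congr rfl h2]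
    exact Finset.sum_fiberwise_of_maps_to (fun k hk => Finset.mem_image_of_mem p hk) _
  · intro α hα
    rw [Set.indicator_apply]
    split_ifs with hαγ
    · rw [mul_eq_zero]
      left
      by_contra hc
      have hαL := hmem α hαγ
      have h3 := hcoef α hαL
      rw [h3] at hc
      obtain ⟨k, hk, -⟩ := Finset.exists_ne_zero_of_sum_ne_zero hc
      rw [← h3] at hc
      rw [Finset.mem_filter] at hk
      refine hα (Finset.mem_image.2 ⟨k, ?_, hk.2⟩)
      rw [hP', Finset.mem_filter, hP, hk.2]
      exact ⟨fun a _ => lnat_le hc, hαL⟩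
    · rfl

theorem exists_nondeg_inequality_cell {F : (Fin n → ℝ) → ℝ} (hF : ContDiff ℝ (⊤ : ℕ∞) F) {δ : ℝ}
    (hδ : 0 < δ)
    (hlim : ∀ x : Fin n → ℝ, (∀ i, |x i| < δ) → ∀ a : Fin n → ℕ,
      ∃ c : ℝ, Tendsto (fun t : ℝ => F (scaleAction a t x) / t ^ lnat F a) (𝓝[>] (0:ℝ)) (𝓝 c))
    (hnd : Nondegenerate F {x | ∀ i, |x i| < δ}) (a : Fin n → Fin n → ℕ)
    (hq : ∃ q, taylorCoeff F q ≠ 0 ∧ ∀ j, dotN (a j) q = lnat F (a j)) :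
    ∃ δ' > 0, ∃ c > 0, ∀ ε y : Fin n → ℝ, (∀ i, ε i = 1 ∨ ε i = -1) →
      (∀ j, 0 < y j ∧ y j ≤ 1) → (∀ i, |cellPt a ε y i| < δ') →
      c * mono (fun j => lnat F (a j)) y ^ 2 ≤
        ∑ i, (cellPt a ε y i * pderiv1 i F (cellPt a ε y)) ^ 2 := by
  classical
  obtain ⟨N, κ, _, p, g, P, hN, hg, hd, hP, hsum, hbox⟩ :=
    good_expansion hF hlim (Finset.univ.image a) (1 + ∑ j, lnat F (a j))
  set l : Fin n → ℕ := fun j => lnat F (a j) with hl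
  have hPl : ∀ k ∈ P, ∀ j, l j ≤ dotN (a j) (p k) := fun k hk j =>
    (hP k).1 hk (a j) (Finset.mem_image_of_mem a (Finset.mem_univ j))
  -- the quotient `θ_i F / y^l` in the chart
  set Φ : Fin n → (Fin n → ℝ) → (Fin n → ℝ) → (Fin n → ℝ) → ℝ := fun i ε y x =>
    ∑ k ∈ P, mono (p k) ε * mono (fun j => dotN (a j) (p k) - l j) y *
      (p k i * g k x + x i * pderiv1 i (g k) x) with hΦ
  have hmonoc : ∀ q : Fin n → ℕ, Continuous (mono q) := fun q => (contDiff_mono q).continuous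
  have hΦc : ∀ i, Continuous fun z : (Fin n → ℝ) × (Fin n → ℝ) × (Fin n → ℝ) =>
      Φ i z.1 z.2.1 z.2.2 := by
    intro i
    refine continuous_finsetSum _ fun k _ => ?_
    have h1 := (hmonoc (p k)).comp (continuous_fst (X := Fin n → ℝ)
      (Y := (Fin n → ℝ) × (Fin n → ℝ)))
    have h2 := (hmonoc (fun j => dotN (a j) (p k) - l j)).comp ((continuous_fst (X := Fin n → ℝ)
      (Y := Fin n → ℝ)).comp (continuous_snd (X := Fin n → ℝ) (Y := (Fin n → ℝ) × (Fin n → ℝ))))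
    have h3 := (hg k).continuous
    have h4 := (contDiff_pderiv1 i (hg k)).continuous
    have h5 : Continuous fun z : (Fin n → ℝ) × (Fin n → ℝ) × (Fin n → ℝ) =>
      ((p k i : ℝ) * g k z.2.2 + z.2.2 i * pderiv1 i (g k) z.2.2) := by fun_prop
    exact (h1.mul h2).mul h5
  have hθ : ∀ i ε y, (∀ i, |cellPt a ε y i| < δ) →
      cellPt a ε y i * pderiv1 i F (cellPt a ε y) = mono l y * Φ i ε y (cellPt a ε y) := by
    intro i ε y hx
    have hev : F =ᶠ[𝓝 (cellPt a ε y)] fun x => ∑ k ∈ P, mono (p k) x * g k x := by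
      filter_upwards [(isOpen_box δ).mem_nhds hx] with x hx using hbox x hx
    have h1 : pderiv1 i F (cellPt a ε y) =
        pderiv1 i (fun x => ∑ k ∈ P, mono (p k) x * g k x) (cellPt a ε y) := by
      simp only [pderiv1, hev.fderiv_eq]
    rw [h1, euler_sum P p hg]
    simp only [hΦ, Finset.mul_sum]
    refine Finset.sum_congr rfl fun k hk => ?_
    have h2 : (fun j => dotN (a j) (p k)) = l + fun j => dotN (a j) (p k) - l j := by
      funext j
      have := hPl k hk j
      simp only [Pi.add_apply]
      omega
    rw [mono_cellPt, h2, mono_add]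
    ring
  clear_value Φ
  by_contra! hcon
  have hcon' : ∀ m : ℕ, ∃ z : (Fin n → ℝ) × (Fin n → ℝ), (∀ i, z.1 i = 1 ∨ z.1 i = -1) ∧
      (∀ j, 0 < z.2 j ∧ z.2 j ≤ 1) ∧ (∀ i, |cellPt a z.1 z.2 i| < min δ (1 / ((m : ℝ) + 1))) ∧
      ∑ i, (cellPt a z.1 z.2 i * pderiv1 i F (cellPt a z.1 z.2)) ^ 2 <
        1 / ((m : ℝ) + 1) * mono l z.2 ^ 2 := by
    intro m
    obtain ⟨ε, y, h1, h2, h3, h4⟩ := hcon (min δ (1 / ((m : ℝ) + 1)))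
      (lt_min hδ (by positivity)) (1 / ((m : ℝ) + 1)) (by positivity)
    exact ⟨(ε, y), h1, h2, h3, h4⟩
  choose z hz1 hz2 hz3 hz4 using hcon'
  have hK : IsCompact ((Set.univ.pi fun _ : Fin n => ({1, -1} : Set ℝ)) ×ˢ
      (Set.univ.pi fun _ : Fin n => Set.Icc (0:ℝ) 1)) :=
    (isCompact_univ_pi fun _ => (Set.toFinite _).isCompact).prod
      (isCompact_univ_pi fun _ => isCompact_Icc)
  obtain ⟨⟨ε, y⟩, hzK, u, hu, hlimz⟩ := hK.tendsto_subseq (x := z) fun m =>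
    ⟨fun i _ => by simpa using hz1 m i, fun j _ => ⟨(hz2 m j).1.le, (hz2 m j).2⟩⟩
  have hε : ∀ i, ε i = 1 ∨ ε i = -1 := fun i => by simpa using hzK.1 i trivial
  have hy : ∀ j, 0 ≤ y j ∧ y j ≤ 1 := fun j => hzK.2 j trivial
  have hinv : Tendsto (fun m : ℕ => 1 / ((u m : ℝ) + 1)) atTop (𝓝 0) :=
    tendsto_one_div_add_atTop_nhds_zero_nat.comp hu.tendsto_atTop
  have hx0 : Tendsto (fun m => cellPt a (z (u m)).1 (z (u m)).2) atTop (𝓝 0) := by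
    rw [tendsto_pi_nhds]
    intro i
    refine squeeze_zero_norm (fun m => ?_) hinv
    exact ((hz3 (u m) i).trans_le (min_le_right _ _)).le
  have hcell : cellPt a ε y = 0 := by
    refine tendsto_nhds_unique ?_ hx0
    have hc : Continuous fun z : (Fin n → ℝ) × (Fin n → ℝ) => cellPt a z.1 z.2 := by
      refine continuous_pi fun i => ?_
      simp only [cellPt]
      fun_prop
    exact (hc.tendsto (ε, y)).comp hlimz
  have hΦ0 : ∀ i, Φ i ε y 0 = 0 := by
    intro i
    have h1 : Tendsto (fun m => Φ i (z (u m)).1 (z (u m)).2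
        (cellPt a (z (u m)).1 (z (u m)).2)) atTop (𝓝 (Φ i ε y 0)) := by
      have h2 : Tendsto (fun m => ((z (u m)).1, (z (u m)).2,
          cellPt a (z (u m)).1 (z (u m)).2)) atTop (𝓝 (ε, y, 0)) :=
        ((continuous_fst.tendsto (ε, y)).comp hlimz).prodMk_nhds
          (((continuous_snd.tendsto (ε, y)).comp hlimz).prodMk_nhds hx0)
      exact ((hΦc i).tendsto (ε, y, 0)).comp h2
    have h3 : Tendsto (fun m => (Φ i (z (u m)).1 (z (u m)).2
        (cellPt a (z (u m)).1 (z (u m)).2)) ^ 2) atTop (𝓝 0) := by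
      refine squeeze_zero (fun m => sq_nonneg _) (fun m => ?_) hinv
      have hpos : 0 < mono l (z (u m)).2 :=
        Finset.prod_pos fun j _ => pow_pos (hz2 (u m) j).1 _
      have h4 : (cellPt a (z (u m)).1 (z (u m)).2 i *
          pderiv1 i F (cellPt a (z (u m)).1 (z (u m)).2)) ^ 2 ≤
          1 / ((u m : ℝ) + 1) * mono l (z (u m)).2 ^ 2 :=
        (Finset.single_le_sum (f := fun i => (cellPt a (z (u m)).1 (z (u m)).2 i *
          pderiv1 i F (cellPt a (z (u m)).1 (z (u m)).2)) ^ 2) (fun _ _ => sq_nonneg _)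
          (Finset.mem_univ i)).trans (hz4 (u m)).le
      rw [hθ i _ _ fun i => (hz3 (u m) i).trans_le (min_le_left _ _), mul_pow,
        mul_comm] at h4
      exact le_of_mul_le_mul_right h4 (by positivity)
    exact pow_eq_zero_iff two_ne_zero |>.1 (tendsto_nhds_unique (h1.pow 2) h3)
  -- the face cut out by the coordinates tending to zero
  set I : Finset (Fin n) := Finset.univ.filter fun j => y j = 0 with hI
  set b : Fin n → ℕ := ∑ j ∈ I, a j with hb
  set L : ℕ := ∑ j ∈ I, l j with hL
  have hbpos : ∀ i, 0 < b i := by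
    intro i
    have h1 := congrFun hcell i
    have hεi : ε i ≠ 0 := by rcases hε i with h | h <;> rw [h] <;> norm_num
    simp only [cellPt, Pi.zero_apply, mul_eq_zero, hεi, false_or, Finset.prod_eq_zero_iff,
      pow_eq_zero_iff', Finset.mem_univ, true_and] at h1
    obtain ⟨j, hj0, hja⟩ := h1
    have h2 : a j i ≤ b i := by
      rw [hb, Finset.sum_apply]
      exact Finset.single_le_sum (f := fun j => a j i) (fun _ _ => Nat.zero_le _)
        (by simp [hI, hj0])
    omega
  have hLN : L < N := by
    have : L ≤ ∑ j, l j := Finset.sum_le_sum_of_subset (Finset.subset_univ I)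
    have hN' : 1 + ∑ j, l j ≤ N := hN
    omega
  have hbge : ∀ q, (∀ j, l j ≤ dotN (a j) q) → L ≤ dotN b q := by
    intro q hq
    rw [hb, dotN_sum_left]
    exact Finset.sum_le_sum fun j _ => hq j
  have hsupp : ∀ α, taylorCoeff F α ≠ 0 → L ≤ dotN b α := fun α hα =>
    hbge α fun j => lnat_le hα
  have hγne : (NewtonPolyhedron F ∩ Hplane (natPt b) L).Nonempty := by
    obtain ⟨q, hqc, hqe⟩ := hq
    refine ⟨natPt q, natPt_mem_newton hqc, ?_⟩
    simp only [Hplane, mem_ofPred_eq, dot_natPt]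
    rw [hb, dotN_sum_left, hL]
    exact congrArg _ (Finset.sum_congr rfl fun j _ => hqe j)
  set y' : Fin n → ℝ := fun j => if y j = 0 then 1 else y j with hy'
  have hscal : ∃ t : ℝ, 0 < t ∧ t < 1 ∧ ∀ i, t * |cellPt a ε y' i| < δ := by
    have h1 : ∀ᶠ t in 𝓝[>] (0:ℝ), ∀ i, t * |cellPt a ε y' i| < δ := by
      rw [eventually_all]
      intro i
      have : Tendsto (fun t : ℝ => t * |cellPt a ε y' i|) (𝓝 0) (𝓝 (0 * |cellPt a ε y' i|)) :=
        (continuous_id.mul continuous_const).tendsto 0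
      rw [zero_mul] at this
      exact nhdsWithin_le_nhds (this.eventually (gt_mem_nhds hδ))
    have h2 : ∀ᶠ t in 𝓝[>] (0:ℝ), t < 1 := nhdsWithin_le_nhds (gt_mem_nhds one_pos)
    obtain ⟨t, ⟨h1, h2⟩, h3⟩ := ((h1.and h2).and self_mem_nhdsWithin).exists
    exact ⟨t, h3, h2, h1⟩
  obtain ⟨t, ht0, ht1, htδ⟩ := hscal
  set x := scaleAction b t (cellPt a ε y') with hx
  have hy'0 : ∀ j, y' j ≠ 0 := by
    intro j
    simp only [hy']
    split_ifs with h
    · exact one_ne_zero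
    · exact h
  have hxne : ∀ i, x i ≠ 0 := by
    intro i
    simp only [hx, scaleAction, cellPt]
    refine mul_ne_zero (pow_ne_zero _ ht0.ne') (mul_ne_zero ?_ ?_)
    · rcases hε i with h | h <;> rw [h] <;> norm_num
    · exact Finset.prod_ne_zero_iff.2 fun j _ => pow_ne_zero _ (hy'0 j)
  have hxU : x ∈ {x : Fin n → ℝ | ∀ i, |x i| < δ} := by
    intro i
    refine lt_of_le_of_lt ?_ (htδ i)
    simp only [hx, scaleAction, abs_mul, abs_pow, abs_of_pos ht0]
    refine mul_le_mul_of_nonneg_right ?_ (abs_nonneg _)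
    exact pow_le_of_le_one ht0.le ht1.le (hbpos i).ne'
  refine hnd _ (isFaceOf_newton hsupp) hγne (isCompact_compactFace hbpos hsupp) x hxU hxne ?_
  have hpoly : gammaPartPoly F (NewtonPolyhedron F ∩ Hplane (natPt b) L) =
      fun x => ∑ k ∈ P with dotN b (p k) = L, mono (p k) x * g k 0 :=
    funext fun x => gammaPartPoly_eq hg hd hP hsum hbpos hLN x
  have hpd : ∀ i, pderiv1 i (gammaPartPoly F (NewtonPolyhedron F ∩ Hplane (natPt b) L)) x = 0 := by
    intro i
    refine (mul_eq_zero.1 ?_).resolve_left (hxne i)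
    rw [hpoly, euler_sum _ p (g := fun k _ => g k 0) (fun k => contDiff_const)]
    have h1 : ∑ k ∈ P with dotN b (p k) = L,
        mono (p k) x * (p k i * g k 0 + x i * pderiv1 i (fun _ => g k 0) x) =
        t ^ L * mono l y' * Φ i ε y 0 := by
      simp only [hΦ, Finset.mul_sum]
      rw [Finset.sum_filter]
      refine Finset.sum_congr rfl fun k hk => ?_
      have hle : ∀ j ∈ I, l j ≤ dotN (a j) (p k) := fun j _ => hPl k hk j
      have hLk : dotN b (p k) = L ↔ ∀ j ∈ I, l j = dotN (a j) (p k) := by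
        rw [hb, dotN_sum_left, hL, eq_comm]
        exact Finset.sum_eq_sum_iff_of_le hle
      split_ifs with hc
      · have h2 : (fun j => dotN (a j) (p k)) = l + fun j => dotN (a j) (p k) - l j := by
          funext j
          exact (Nat.add_sub_cancel' (hPl k hk j)).symm
        have h3 : mono (fun j => dotN (a j) (p k) - l j) y' =
            mono (fun j => dotN (a j) (p k) - l j) y := by
          refine Finset.prod_congr rfl fun j _ => ?_
          simp only [hy']
          split_ifs with h
          · rw [← hLk.1 hc j (by simp [hI, h])]
            simp
          · rfl
        have h4 : pderiv1 i (fun _ => g k 0) x = 0 := by simp [pderiv1]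
        rw [hx, mono_scaleAction, mono_cellPt, hc, h2, mono_add, h3, ← hx, h4]
        simp only [Pi.zero_apply]
        ring
      · rw [hLk] at hc
        push Not at hc
        obtain ⟨j, hj, hne⟩ := hc
        have h3 : mono (fun j => dotN (a j) (p k) - l j) y = 0 := by
          refine Finset.prod_eq_zero (Finset.mem_univ j) ?_
          rw [(Finset.mem_filter.1 hj).2]
          refine zero_pow ?_
          exact Nat.sub_ne_zero_of_lt (lt_of_le_of_ne (hle j hj) hne)
        rw [h3]
        ring
    rw [h1, hΦ0 i, mul_zero]
  ext v
  have hv : v = ∑ i, v i • (Pi.single i 1 : Fin n → ℝ) := by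
    simpa using (pi_eq_sum_univ' v)
  rw [hv, map_sum]
  simp only [map_smul, zero_apply]
  refine Finset.sum_eq_zero fun i _ => ?_
  have := hpd i
  simp only [pderiv1] at this
  rw [this, smul_zero]

end Nondeg

section Cells

variable {Γ : Set (Fin n → ℝ)}

/-- `x` lies in the toric cell of the cone `σ`, with logarithmic coordinates `c`. -/
def OnCell (S : SimplicialSubdivision n Γ) (σ : S.ι) (c x : Fin n → ℝ) : Prop :=
  (∀ j, 0 ≤ c j) ∧ ∀ i, |x i| = Real.exp (-∑ j, c j * S.gen σ j i)

/-- The part of the torus in the box of size `δ`. -/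
def torusBox (n : ℕ) (δ : ℝ) : Set (Fin n → ℝ) := {x | ∀ i, x i ≠ 0 ∧ |x i| < δ}

theorem isOpen_torusBox (δ : ℝ) : IsOpen (torusBox n δ) := by
  simp only [torusBox, Set.ofPred_forall]
  refine isOpen_iInter_of_finite fun i => IsOpen.and ?_ (isOpen_lt (by fun_prop) continuous_const)
  exact isOpen_ne_fun (by fun_prop) continuous_const

theorem exists_onCell (S : SimplicialSubdivision n Γ) {x : Fin n → ℝ} (h0 : ∀ i, x i ≠ 0)
    (h1 : ∀ i, |x i| ≤ 1) : ∃ σ c, OnCell S σ c x := by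
  have hoct : (fun i => -Real.log |x i|) ∈ octant n := fun i =>
    neg_nonneg.2 (Real.log_nonpos (abs_nonneg _) (h1 i))
  obtain ⟨σ, c, hc, -, he⟩ := S.covers _ hoct
  refine ⟨σ, c, hc, fun i => ?_⟩
  have h2 := congrFun he i
  simp only [Finset.sum_apply, Pi.smul_apply, genR, natPt, smul_eq_mul] at h2
  rw [← h2, neg_neg, Real.exp_log (abs_pos.2 (h0 i))]

theorem abs_mono_of_onCell {S : SimplicialSubdivision n Γ} {σ : S.ι} {c x : Fin n → ℝ}
    (h : OnCell S σ c x) (p : Fin n → ℕ) :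
    |mono p x| = Real.exp (-∑ j, c j * dotN (S.gen σ j) p) := by
  simp only [mono, Finset.abs_prod, abs_pow, h.2, ← Real.exp_nat_mul, ← Real.exp_sum]
  congr 1
  simp only [dotN, Nat.cast_sum, Nat.cast_mul, mul_neg, Finset.sum_neg_distrib, Finset.mul_sum]
  rw [Finset.sum_comm]
  congr 1
  exact Finset.sum_congr rfl fun j _ => Finset.sum_congr rfl fun i _ => by ring

theorem exists_cellPt_of_onCell {S : SimplicialSubdivision n Γ} {σ : S.ι} {c x : Fin n → ℝ}
    (h : OnCell S σ c x) : ∃ ε : Fin n → ℝ, (∀ i, ε i = 1 ∨ ε i = -1) ∧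
      x = cellPt (S.gen σ) ε fun j => Real.exp (-c j) := by
  refine ⟨fun i => if 0 ≤ x i then 1 else -1, fun i => ?_, funext fun i => ?_⟩
  · simp only; split_ifs <;> simp
  · have h1 : ∏ j, Real.exp (-c j) ^ S.gen σ j i = |x i| := by
      simp only [h.2, ← Real.exp_nat_mul, ← Real.exp_sum]
      congr 1
      rw [← Finset.sum_neg_distrib]
      exact Finset.sum_congr rfl fun j _ => by ring
    simp only [cellPt, h1]
    split_ifs with h2
    · rw [abs_of_nonneg h2, one_mul]
    · rw [abs_of_neg (not_le.1 h2)]; ring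

/-- A lower bound for the logarithmic gradient, uniform near the origin. -/
theorem exists_nondeg_inequality {F : (Fin n → ℝ) → ℝ} (hF : ContDiff ℝ (⊤ : ℕ∞) F) {δ : ℝ}
    (hδ : 0 < δ)
    (hlim : ∀ x : Fin n → ℝ, (∀ i, |x i| < δ) → ∀ a : Fin n → ℕ,
      ∃ c : ℝ, Tendsto (fun t : ℝ => F (scaleAction a t x) / t ^ lnat F a) (𝓝[>] (0:ℝ)) (𝓝 c))
    (hnd : Nondegenerate F {x | ∀ i, |x i| < δ})
    (S : SimplicialSubdivision n (NewtonPolyhedron F)) :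
    ∃ δ' > 0, ∃ c > 0, ∀ x ∈ torusBox n δ', ∀ q, taylorCoeff F q ≠ 0 →
      c * mono q x ^ 2 ≤ ∑ i, (x i * pderiv1 i F x) ^ 2 := by
  have := S.fin
  have hcell := fun σ => exists_nondeg_inequality_cell hF hδ hlim hnd (S.gen σ)
    (exists_dotN_gen_eq_lnat S σ)
  choose d hd c hc h using hcell
  rcases isEmpty_or_nonempty S.ι with hι | hι
  · refine ⟨1, one_pos, 1, one_pos, fun x hx => ?_⟩
    obtain ⟨σ, -⟩ := exists_onCell S (fun i => (hx i).1) fun i => (hx i).2.le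
    exact (hι.false σ).elim
  obtain ⟨σ₁, h₁⟩ := Finite.exists_min d
  obtain ⟨σ₂, h₂⟩ := Finite.exists_min c
  refine ⟨min 1 (d σ₁), lt_min one_pos (hd σ₁), c σ₂, hc σ₂, fun x hx q hq => ?_⟩
  obtain ⟨σ, e, he⟩ := exists_onCell S (fun i => (hx i).1)
    fun i => ((hx i).2.trans_le (min_le_left _ _)).le
  obtain ⟨ε, hε, hxε⟩ := exists_cellPt_of_onCell he
  have h3 := h σ ε (fun j => Real.exp (-e j)) hε
    (fun j => ⟨Real.exp_pos _, Real.exp_le_one_iff.2 (neg_nonpos.2 (he.1 j))⟩)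
  rw [← hxε] at h3
  refine le_trans ?_ (h3 fun i => (hx i).2.trans_le ((min_le_right _ _).trans (h₁ σ)))
  have h4 : |mono q x| ≤ mono (fun j => lnat F (S.gen σ j)) fun j => Real.exp (-e j) := by
    rw [abs_mono_of_onCell he]
    simp only [mono, ← Real.exp_nat_mul, ← Real.exp_sum]
    rw [Real.exp_le_exp, ← Finset.sum_neg_distrib]
    refine Finset.sum_le_sum fun j _ => ?_
    have h5 : (lnat F (S.gen σ j) : ℝ) ≤ dotN (S.gen σ j) q := by exact_mod_cast lnat_le hq
    nlinarith [he.1 j]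
  rw [← sq_abs (mono q x)]
  gcongr
  · exact (hc σ).le
  · exact h₂ σ

end Cells

section Symbols

variable {Γ : Set (Fin n → ℝ)}

/-- The logarithmic derivative `x_i ∂_i`. -/
noncomputable def lgd (i : Fin n) (ψ : (Fin n → ℝ) → ℂ) : (Fin n → ℝ) → ℂ :=
  fun x => (x i : ℂ) * fderiv ℝ ψ x (Pi.single i 1)

theorem lgd_congr {D : Set (Fin n → ℝ)} (hD : IsOpen D) {ψ χ : (Fin n → ℝ) → ℂ}
    (h : EqOn ψ χ D) (i : Fin n) : EqOn (lgd i ψ) (lgd i χ) D := by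
  intro x hx
  have : ψ =ᶠ[𝓝 x] χ := by filter_upwards [hD.mem_nhds hx] with y hy using h hy
  simp only [lgd, this.fderiv_eq]

theorem lgd_zero (i : Fin n) : lgd i (fun _ => 0) = fun _ => 0 := by
  funext x; simp [lgd]

theorem lgd_add {ψ χ : (Fin n → ℝ) → ℂ} {x : Fin n → ℝ} (h : DifferentiableAt ℝ ψ x)
    (h' : DifferentiableAt ℝ χ x) (i : Fin n) :
    lgd i (fun x => ψ x + χ x) x = lgd i ψ x + lgd i χ x := by
  simp only [lgd, fderiv_fun_add h h', add_apply]
  ring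

theorem lgd_const_mul {ψ : (Fin n → ℝ) → ℂ} {x : Fin n → ℝ} (h : DifferentiableAt ℝ ψ x)
    (c : ℂ) (i : Fin n) : lgd i (fun x => c * ψ x) x = c * lgd i ψ x := by
  simp only [lgd, fderiv_const_mul h, smul_apply, smul_eq_mul]
  ring

theorem lgd_mul {ψ χ : (Fin n → ℝ) → ℂ} {x : Fin n → ℝ} (h : DifferentiableAt ℝ ψ x)
    (h' : DifferentiableAt ℝ χ x) (i : Fin n) :
    lgd i (fun x => ψ x * χ x) x = lgd i ψ x * χ x + ψ x * lgd i χ x := by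
  simp only [lgd, fderiv_fun_mul h h', add_apply, smul_apply, smul_eq_mul]
  ring

/-- Integer weights on the lattice vectors. -/
abbrev Weight (n : ℕ) := (Fin n → ℕ) → ℤ

/-- `ψ` is bounded by the monomial of weight `N` in every toric cell. -/
def WBound (S : SimplicialSubdivision n Γ) (δ : ℝ) (N : Weight n) (ψ : (Fin n → ℝ) → ℂ) : Prop :=
  ∀ σ, ∃ C, 0 ≤ C ∧ ∀ x ∈ torusBox n δ, ∀ c, OnCell S σ c x →
    ‖ψ x‖ ≤ C * Real.exp (-∑ j, c j * N (S.gen σ j))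

/-- The directional logarithmic derivative along `a` with the weight `N a` removed. -/
noncomputable def peelOp (N : Weight n) (a : Fin n → ℕ) (ψ : (Fin n → ℝ) → ℂ) :
    (Fin n → ℝ) → ℂ := fun x => ∑ i, (a i : ℂ) * lgd i ψ x - N a * ψ x

/-- A weighted family of functions on the torus stable under logarithmic derivatives, and such
that `peelOp` improves the weight. -/
structure IsSymbolFamily (S : SimplicialSubdivision n Γ) (δ : ℝ)
    (𝓕 : Weight n → ((Fin n → ℝ) → ℂ) → Prop) : Prop where
  bound : ∀ N ψ, 𝓕 N ψ → WBound S δ N ψ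
  smooth : ∀ N ψ, 𝓕 N ψ → ContDiffOn ℝ (⊤ : ℕ∞) ψ (torusBox n δ)
  lgd : ∀ N ψ, 𝓕 N ψ → ∀ i, ∃ χ, 𝓕 N χ ∧ EqOn χ (lgd i ψ) (torusBox n δ)
  peel : ∀ N ψ, 𝓕 N ψ → ∀ a ∈ sigma1 S, ∃ χ, 𝓕 (N + Pi.single a 1) χ ∧
    EqOn χ (peelOp N a ψ) (torusBox n δ)

/-- Symbols of weight `N`. -/
def Symb (S : SimplicialSubdivision n Γ) (δ : ℝ) (N : Weight n) (ψ : (Fin n → ℝ) → ℂ) : Prop :=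
  ∃ 𝓕, IsSymbolFamily S δ 𝓕 ∧ 𝓕 N ψ

/-- The span of a weighted family. -/
inductive SymbSpan (δ : ℝ) (𝓕 : Weight n → ((Fin n → ℝ) → ℂ) → Prop) :
    Weight n → ((Fin n → ℝ) → ℂ) → Prop
  | base {N ψ} : 𝓕 N ψ → SymbSpan δ 𝓕 N ψ
  | zero {N} : SymbSpan δ 𝓕 N fun _ => 0
  | add {N ψ χ} : SymbSpan δ 𝓕 N ψ → SymbSpan δ 𝓕 N χ → SymbSpan δ 𝓕 N fun x => ψ x + χ x
  | smul {N ψ} (c : ℂ) : SymbSpan δ 𝓕 N ψ → SymbSpan δ 𝓕 N fun x => c * ψ x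
  | congr {N ψ χ} : SymbSpan δ 𝓕 N ψ → EqOn χ ψ (torusBox n δ) → SymbSpan δ 𝓕 N χ

variable {S : SimplicialSubdivision n Γ} {δ : ℝ}

theorem SymbSpan.sum {κ : Type*} {𝓕 : Weight n → ((Fin n → ℝ) → ℂ) → Prop} {N : Weight n}
    (P : Finset κ) {ψ : κ → (Fin n → ℝ) → ℂ} (h : ∀ k ∈ P, SymbSpan δ 𝓕 N (ψ k)) :
    SymbSpan δ 𝓕 N fun x => ∑ k ∈ P, ψ k x := by
  classical
  induction P using Finset.induction_on with
  | empty => simpa using SymbSpan.zero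
  | insert k P hk ih =>
    simp only [Finset.sum_insert hk]
    exact (h k (Finset.mem_insert_self k P)).add
      (ih fun k' hk' => h k' (Finset.mem_insert_of_mem hk'))

theorem WBound.add {N : Weight n} {ψ χ : (Fin n → ℝ) → ℂ} (h : WBound S δ N ψ)
    (h' : WBound S δ N χ) : WBound S δ N fun x => ψ x + χ x := by
  intro σ
  obtain ⟨C, hC, h⟩ := h σ
  obtain ⟨C', hC', h'⟩ := h' σ
  refine ⟨C + C', by positivity, fun x hx c hc => ?_⟩
  rw [add_mul]
  exact (norm_add_le _ _).trans (add_le_add (h x hx c hc) (h' x hx c hc))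

theorem WBound.mul {N N' : Weight n} {ψ χ : (Fin n → ℝ) → ℂ} (h : WBound S δ N ψ)
    (h' : WBound S δ N' χ) : WBound S δ (N + N') fun x => ψ x * χ x := by
  intro σ
  obtain ⟨C, hC, h⟩ := h σ
  obtain ⟨C', hC', h'⟩ := h' σ
  refine ⟨C * C', by positivity, fun x hx c hc => ?_⟩
  have e : Real.exp (-∑ j, c j * ((N + N') (S.gen σ j) : ℤ)) =
      Real.exp (-∑ j, c j * N (S.gen σ j)) * Real.exp (-∑ j, c j * N' (S.gen σ j)) := by
    rw [← Real.exp_add]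
    congr 1
    simp only [Pi.add_apply, Int.cast_add, mul_add, Finset.sum_add_distrib]
    ring
  rw [e, norm_mul, mul_mul_mul_comm]
  exact mul_le_mul (h x hx c hc) (h' x hx c hc) (norm_nonneg _) (by positivity)

theorem WBound.anti {N N' : Weight n} {ψ : (Fin n → ℝ) → ℂ} (h : WBound S δ N' ψ)
    (hN : ∀ a ∈ sigma1 S, N a ≤ N' a) : WBound S δ N ψ := by
  intro σ
  obtain ⟨C, hC, h⟩ := h σ
  refine ⟨C, hC, fun x hx c hc => (h x hx c hc).trans ?_⟩
  gcongr with j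
  · exact hc.1 j
  · exact_mod_cast hN _ ⟨σ, j, rfl⟩

/-- To check the conditions on a family it suffices to check them up to linear combinations. -/
theorem isSymbolFamily_span {𝓕 : Weight n → ((Fin n → ℝ) → ℂ) → Prop}
    (hb : ∀ N ψ, 𝓕 N ψ → WBound S δ N ψ)
    (hs : ∀ N ψ, 𝓕 N ψ → ContDiffOn ℝ (⊤ : ℕ∞) ψ (torusBox n δ))
    (hl : ∀ N ψ, 𝓕 N ψ → ∀ i, SymbSpan δ 𝓕 N (lgd i ψ))
    (hp : ∀ N ψ, 𝓕 N ψ → ∀ a ∈ sigma1 S, SymbSpan δ 𝓕 (N + Pi.single a 1) (peelOp N a ψ)) :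
    IsSymbolFamily S δ (SymbSpan δ 𝓕) := by
  have hD := isOpen_torusBox (n := n) δ
  have hs' : ∀ N ψ, SymbSpan δ 𝓕 N ψ → ContDiffOn ℝ (⊤ : ℕ∞) ψ (torusBox n δ) := by
    intro N ψ h
    induction h with
    | base h => exact hs _ _ h
    | zero => exact contDiffOn_const
    | add _ _ ih ih' => exact ih.add ih'
    | smul c _ ih => exact contDiffOn_const.mul ih
    | congr _ e ih => exact ih.congr e
  have hdiff : ∀ {N ψ}, SymbSpan δ 𝓕 N ψ → ∀ x ∈ torusBox n δ, DifferentiableAt ℝ ψ x :=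
    fun h x hx => ((hs' _ _ h).differentiableOn (by simp)).differentiableAt (hD.mem_nhds hx)
  refine ⟨?_, hs', ?_, ?_⟩
  · intro N ψ h
    induction h with
    | base h => exact hb _ _ h
    | zero => exact fun σ => ⟨0, le_rfl, by simp⟩
    | add _ _ ih ih' => exact ih.add ih'
    | smul c _ ih =>
      intro σ
      obtain ⟨C, hC, ih⟩ := ih σ
      refine ⟨‖c‖ * C, by positivity, fun x hx e he => ?_⟩
      rw [norm_mul, mul_assoc]
      exact mul_le_mul_of_nonneg_left (ih x hx e he) (norm_nonneg _)
    | congr _ e ih =>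
      intro σ
      obtain ⟨C, hC, ih⟩ := ih σ
      refine ⟨C, hC, fun x hx c hc => ?_⟩
      rw [e hx]
      exact ih x hx c hc
  · intro N ψ h i
    refine ⟨lgd i ψ, ?_, fun _ _ => rfl⟩
    induction h with
    | base h => exact hl _ _ h i
    | zero => rw [lgd_zero]; exact .zero
    | add h h' ih ih' =>
      exact (ih.add ih').congr fun x hx => lgd_add (hdiff h x hx) (hdiff h' x hx) i
    | smul c h ih => exact (ih.smul c).congr fun x hx => lgd_const_mul (hdiff h x hx) c i
    | congr _ e ih => exact ih.congr (lgd_congr hD e i)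
  · intro N ψ h a ha
    refine ⟨peelOp N a ψ, ?_, fun _ _ => rfl⟩
    induction h with
    | base h => exact hp _ _ h a ha
    | zero => exact SymbSpan.zero.congr fun x _ => by simp [peelOp, lgd_zero]
    | add h h' ih ih' =>
      refine (ih.add ih').congr fun x hx => ?_
      simp only [peelOp, lgd_add (hdiff h x hx) (hdiff h' x hx), mul_add, Finset.sum_add_distrib]
      ring
    | smul c h ih =>
      refine (ih.smul c).congr fun x hx => ?_
      simp only [peelOp, lgd_const_mul (hdiff h x hx), mul_sub, Finset.mul_sum]
      congr 1
      · exact Finset.sum_congr rfl fun i _ => by ring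
      · ring
    | congr _ e ih =>
      refine ih.congr fun x hx => ?_
      simp only [peelOp, e hx]
      congr 1
      exact Finset.sum_congr rfl fun i _ => by rw [lgd_congr hD e i hx]

namespace Symb

variable {N N' : Weight n} {ψ χ : (Fin n → ℝ) → ℂ}

theorem of_span {𝓕 : Weight n → ((Fin n → ℝ) → ℂ) → Prop}
    (hb : ∀ N ψ, 𝓕 N ψ → WBound S δ N ψ)
    (hs : ∀ N ψ, 𝓕 N ψ → ContDiffOn ℝ (⊤ : ℕ∞) ψ (torusBox n δ))
    (hl : ∀ N ψ, 𝓕 N ψ → ∀ i, SymbSpan δ 𝓕 N (KN.lgd i ψ))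
    (hp : ∀ N ψ, 𝓕 N ψ → ∀ a ∈ sigma1 S, SymbSpan δ 𝓕 (N + Pi.single a 1) (peelOp N a ψ))
    (h : 𝓕 N ψ) : Symb S δ N ψ :=
  ⟨_, isSymbolFamily_span hb hs hl hp, .base h⟩

theorem wbound (h : Symb S δ N ψ) : WBound S δ N ψ := by
  obtain ⟨𝓕, h𝓕, h⟩ := h
  exact h𝓕.bound _ _ h

theorem smooth (h : Symb S δ N ψ) : ContDiffOn ℝ (⊤ : ℕ∞) ψ (torusBox n δ) := by
  obtain ⟨𝓕, h𝓕, h⟩ := h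
  exact h𝓕.smooth _ _ h

theorem differentiableAt (h : Symb S δ N ψ) {x : Fin n → ℝ} (hx : x ∈ torusBox n δ) :
    DifferentiableAt ℝ ψ x :=
  (h.smooth.differentiableOn (by simp)).differentiableAt ((isOpen_torusBox δ).mem_nhds hx)

theorem isSymbolFamily_symbSpan : IsSymbolFamily S δ (SymbSpan δ (Symb S δ)) := by
  refine isSymbolFamily_span (fun _ _ h => h.wbound) (fun _ _ h => h.smooth) ?_ ?_
  · rintro N ψ ⟨𝓕, h𝓕, h⟩ i
    obtain ⟨χ, h1, h2⟩ := h𝓕.lgd _ _ h i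
    exact (SymbSpan.base (𝓕 := Symb S δ) ⟨𝓕, h𝓕, h1⟩).congr h2.symm
  · rintro N ψ ⟨𝓕, h𝓕, h⟩ a ha
    obtain ⟨χ, h1, h2⟩ := h𝓕.peel _ _ h a ha
    exact (SymbSpan.base (𝓕 := Symb S δ) ⟨𝓕, h𝓕, h1⟩).congr h2.symm

theorem of_symbSpan (h : SymbSpan δ (Symb S δ) N ψ) : Symb S δ N ψ :=
  ⟨_, isSymbolFamily_symbSpan, h⟩

theorem zero : Symb S δ N fun _ => 0 := of_symbSpan .zero

theorem add (h : Symb S δ N ψ) (h' : Symb S δ N χ) : Symb S δ N fun x => ψ x + χ x :=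
  of_symbSpan (.add (.base h) (.base h'))

theorem const_mul (h : Symb S δ N ψ) (c : ℂ) : Symb S δ N fun x => c * ψ x :=
  of_symbSpan (.smul c (.base h))

theorem congr (h : Symb S δ N ψ) (e : EqOn χ ψ (torusBox n δ)) : Symb S δ N χ :=
  of_symbSpan (.congr (.base h) e)

theorem sum {κ : Type*} (P : Finset κ) {ψ : κ → (Fin n → ℝ) → ℂ}
    (h : ∀ k ∈ P, Symb S δ N (ψ k)) : Symb S δ N fun x => ∑ k ∈ P, ψ k x := by
  classical
  induction P using Finset.induction_on with
  | empty => simpa using zero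
  | insert k P hk ih =>
    simp only [Finset.sum_insert hk]
    exact (h k (Finset.mem_insert_self k P)).add
      (ih fun k' hk' => h k' (Finset.mem_insert_of_mem hk'))

theorem lgd (h : Symb S δ N ψ) (i : Fin n) : Symb S δ N (KN.lgd i ψ) := by
  obtain ⟨𝓕, h𝓕, h⟩ := h
  obtain ⟨χ, h1, h2⟩ := h𝓕.lgd _ _ h i
  exact congr ⟨𝓕, h𝓕, h1⟩ h2.symm

theorem peel (h : Symb S δ N ψ) {a : Fin n → ℕ} (ha : a ∈ sigma1 S) :
    Symb S δ (N + Pi.single a 1) (peelOp N a ψ) := by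
  obtain ⟨𝓕, h𝓕, h⟩ := h
  obtain ⟨χ, h1, h2⟩ := h𝓕.peel _ _ h a ha
  exact congr ⟨𝓕, h𝓕, h1⟩ h2.symm

theorem mul (h : Symb S δ N ψ) (h' : Symb S δ N' χ) :
    Symb S δ (N + N') fun x => ψ x * χ x := by
  refine of_span (𝓕 := fun M ω => ∃ N N' ψ χ, Symb S δ N ψ ∧ Symb S δ N' χ ∧ M = N + N' ∧
    ω = fun x => ψ x * χ x) ?_ ?_ ?_ ?_ ⟨N, N', ψ, χ, h, h', rfl, rfl⟩
  · rintro M _ ⟨N, N', ψ, χ, h, h', rfl, rfl⟩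
    exact h.wbound.mul h'.wbound
  · rintro M _ ⟨N, N', ψ, χ, h, h', rfl, rfl⟩
    exact h.smooth.mul h'.smooth
  · rintro M _ ⟨N, N', ψ, χ, h, h', rfl, rfl⟩ i
    refine .congr (.add (.base ⟨N, N', _, _, h.lgd i, h', rfl, rfl⟩)
      (.base ⟨N, N', _, _, h, h'.lgd i, rfl, rfl⟩)) fun x hx => ?_
    exact lgd_mul (h.differentiableAt hx) (h'.differentiableAt hx) i
  · rintro M _ ⟨N, N', ψ, χ, h, h', rfl, rfl⟩ a ha
    refine .congr (.add (.base ⟨_, N', _, _, h.peel ha, h', by abel, rfl⟩)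
      (.base ⟨N, _, _, _, h, h'.peel ha, by abel, rfl⟩)) fun x hx => ?_
    simp only [peelOp, lgd_mul (h.differentiableAt hx) (h'.differentiableAt hx), mul_add,
      Finset.sum_add_distrib, Pi.add_apply, Int.cast_add, sub_mul, mul_sub, Finset.sum_mul,
      Finset.mul_sum]
    have e1 : ∀ i, (a i : ℂ) * (KN.lgd i ψ x * χ x) = a i * KN.lgd i ψ x * χ x :=
      fun i => by ring
    have e2 : ∀ i, (a i : ℂ) * (ψ x * KN.lgd i χ x) = ψ x * (a i * KN.lgd i χ x) :=
      fun i => by ring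
    simp only [e1, e2]
    ring

theorem anti (h : Symb S δ N' ψ) (hN : ∀ a ∈ sigma1 S, N a ≤ N' a) : Symb S δ N ψ := by
  refine of_span (𝓕 := fun M ω => ∃ N', Symb S δ N' ω ∧ ∀ a ∈ sigma1 S, M a ≤ N' a)
    ?_ ?_ ?_ ?_ ⟨N', h, hN⟩
  · rintro M ω ⟨N', h, hN⟩
    exact h.wbound.anti hN
  · rintro M ω ⟨N', h, hN⟩
    exact h.smooth
  · rintro M ω ⟨N', h, hN⟩ i
    exact .base ⟨N', h.lgd i, hN⟩
  · rintro M ω ⟨N', h, hN⟩ a ha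
    have h1 : SymbSpan δ (fun M ω => ∃ N', Symb S δ N' ω ∧ ∀ a ∈ sigma1 S, M a ≤ N' a)
        (M + Pi.single a 1) (peelOp N' a ω) :=
      .base ⟨_, h.peel ha, fun b hb => add_le_add_left (hN b hb) _⟩
    rcases (hN a ha).eq_or_lt with e | e
    · refine h1.congr fun x _ => ?_
      simp only [peelOp, e]
    · refine .congr (.add h1 (.smul (((N' a - M a : ℤ) : ℂ)) (.base ⟨N', h, ?_⟩))) fun x _ => ?_
      · intro b hb
        by_cases hba : b = a
        · subst hba; simp; omega
        · simpa [hba] using hN b hb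
      · simp only [peelOp, Int.cast_sub]
        ring

end Symb

end Symbols

section SymbolAlgebra

variable {Γ : Set (Fin n → ℝ)} {S : SimplicialSubdivision n Γ} {δ : ℝ}

theorem exp_weight_add_nsmul (S : SimplicialSubdivision n Γ) (σ : S.ι) (c : Fin n → ℝ)
    (M N : Weight n) (k : ℕ) :
    Real.exp (-∑ j, c j * ((M + k • N) (S.gen σ j) : ℤ)) =
      Real.exp (-∑ j, c j * M (S.gen σ j)) * Real.exp (-∑ j, c j * N (S.gen σ j)) ^ k := by
  rw [← Real.exp_nat_mul, ← Real.exp_add]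
  congr 1
  have e : ∀ a, (M + k • N) a = M a + k * N a := fun a => by simp
  simp only [e, Int.cast_add, Int.cast_mul,
    Int.cast_natCast, mul_add, Finset.sum_add_distrib, mul_neg, Finset.mul_sum, neg_add]
  congr 2
  exact Finset.sum_congr rfl fun j _ => by ring

theorem lgd_div_pow {h g : (Fin n → ℝ) → ℂ} {x : Fin n → ℝ} (hh : DifferentiableAt ℝ h x)
    (hg : DifferentiableAt ℝ g x) (h0 : g x ≠ 0) (k : ℕ) (i : Fin n) :
    lgd i (fun x => h x / g x ^ k) x =
      lgd i h x / g x ^ k + -(k : ℂ) * (h x * lgd i g x / g x ^ (k + 1)) := by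
  have h1 : HasFDerivAt (fun x => g x ^ k) ((k * g x ^ (k - 1)) • fderiv ℝ g x) x := by
    simpa [smul_smul] using hg.hasFDerivAt.pow k
  have h2 := hh.hasFDerivAt.mul ((hasFDerivAt_inv' (𝕜 := ℝ) (pow_ne_zero k h0)).comp x h1)
  have h3 : (fun x => h x / g x ^ k) = h * (Inv.inv ∘ fun x => g x ^ k) := by
    funext y; simp [div_eq_mul_inv]
  simp only [lgd]
  rw [h3, HasFDerivAt.fderiv h2]
  simp only [add_apply, smul_apply, smul_eq_mul, ContinuousLinearMap.comp_apply, neg_apply,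
    ContinuousLinearMap.mulLeftRight_apply, Function.comp_apply]
  rcases Nat.eq_zero_or_pos k with rfl | hk
  · simp
  · have e : g x ^ k = g x ^ (k - 1) * g x := by rw [← pow_succ, Nat.sub_add_cancel hk]
    have e1 : g x ^ (k - 1) ≠ 0 := pow_ne_zero _ h0
    rw [pow_succ, e]
    field_simp
    ring

namespace Symb

variable {N N' : Weight n} {ψ χ g h : (Fin n → ℝ) → ℂ}

/-- A lower bound by the monomial of weight `N` in every toric cell. -/
def _root_.KN.WElliptic (S : SimplicialSubdivision n Γ) (δ : ℝ) (N : Weight n)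
    (g : (Fin n → ℝ) → ℂ) : Prop :=
  ∀ σ, ∃ C, 0 < C ∧ ∀ x ∈ torusBox n δ, ∀ c, OnCell S σ c x →
    C * Real.exp (-∑ j, c j * N (S.gen σ j)) ≤ ‖g x‖

theorem _root_.KN.WElliptic.ne_zero (hδ : δ ≤ 1) (hg : WElliptic S δ N g) {x : Fin n → ℝ}
    (hx : x ∈ torusBox n δ) : g x ≠ 0 := by
  obtain ⟨σ, c, hc⟩ := exists_onCell S (fun i => (hx i).1) fun i => ((hx i).2.le.trans hδ)
  obtain ⟨C, hC, h⟩ := hg σ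
  rw [← norm_pos_iff]
  exact lt_of_lt_of_le (mul_pos hC (Real.exp_pos _)) (h x hx c hc)

theorem div (hδ : δ ≤ 1) (hh : Symb S δ N' h) (hg : Symb S δ N g) (he : WElliptic S δ N g) :
    Symb S δ (N' - N) fun x => h x / g x := by
  have hne : ∀ x ∈ torusBox n δ, g x ≠ 0 := fun x hx => he.ne_zero hδ hx
  refine of_span (𝓕 := fun M ω => ∃ (k : ℕ) (h : (Fin n → ℝ) → ℂ), Symb S δ (M + k • N) h ∧
    ω = fun x => h x / g x ^ k) ?_ ?_ ?_ ?_ ⟨1, h, by simpa using hh, by simp⟩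
  · rintro M _ ⟨k, h, hh, rfl⟩ σ
    obtain ⟨C, hC, h1⟩ := hh.wbound σ
    obtain ⟨c₀, hc₀, h2⟩ := he σ
    refine ⟨C / c₀ ^ k, by positivity, fun x hx c hc => ?_⟩
    have h3 := h1 x hx c hc
    have h4 := pow_le_pow_left₀ (by positivity) (h2 x hx c hc) k
    rw [exp_weight_add_nsmul] at h3
    rw [norm_div, norm_pow, div_le_iff₀ (pow_pos (norm_pos_iff.2 (hne x hx)) k)]
    refine h3.trans ?_
    rw [mul_pow] at h4
    have h5 : 0 ≤ C / c₀ ^ k * Real.exp (-∑ j, c j * M (S.gen σ j)) := by positivity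
    refine le_trans (le_of_eq ?_) (mul_le_mul_of_nonneg_left h4 h5)
    have : c₀ ^ k ≠ 0 := (pow_pos hc₀ k).ne'
    field_simp
  · rintro M _ ⟨k, h, hh, rfl⟩
    simp only [div_eq_mul_inv]
    exact hh.smooth.mul ((hg.smooth.pow k).fun_inv fun x hx => pow_ne_zero _ (hne x hx))
  · rintro M _ ⟨k, h, hh, rfl⟩ i
    refine .congr (.add (.base ⟨k, _, hh.lgd i, rfl⟩) (.smul (-(k : ℂ)) (.base
      ⟨k + 1, _, (hh.mul (hg.lgd i)).anti fun a _ => ?_, rfl⟩))) fun x hx => ?_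
    · rw [succ_nsmul, ← add_assoc]
    · exact lgd_div_pow (hh.differentiableAt hx) (hg.differentiableAt hx) (hne x hx) k i
  · rintro M _ ⟨k, h, hh, rfl⟩ a ha
    refine .congr (.add (.base ⟨k, _, (hh.peel ha).anti fun b _ => ?_, rfl⟩)
      (.smul (-(k : ℂ)) (.base ⟨k + 1, _, (hh.mul (hg.peel ha)).anti fun b _ => ?_, rfl⟩)))
      fun x hx => ?_
    · rw [add_right_comm]
    · rw [succ_nsmul]
      apply le_of_eq
      simp only [Pi.add_apply]
      ring
    · have h0 := hne x hx
      simp only [peelOp, lgd_div_pow (hh.differentiableAt hx) (hg.differentiableAt hx) h0]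
      have e1 : ∀ i, (a i : ℂ) * (KN.lgd i h x / g x ^ k +
          -(k : ℂ) * (h x * KN.lgd i g x / g x ^ (k + 1))) =
          (a i * KN.lgd i h x) / g x ^ k +
            (-(k : ℂ) * h x / g x ^ (k + 1)) * (a i * KN.lgd i g x) := fun i => by ring
      simp only [e1, Finset.sum_add_distrib, ← Finset.mul_sum, ← Finset.sum_div]
      have e2 : (M + k • N) a = M a + k * N a := by simp
      simp only [e2, Int.cast_add, Int.cast_mul, Int.cast_natCast]
      have : g x ^ k ≠ 0 := pow_ne_zero _ h0
      rw [pow_succ]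
      field_simp
      ring

end Symb

theorem lgd_mono_mul (p : Fin n → ℕ) {h : (Fin n → ℝ) → ℂ} (hh : ContDiff ℝ (⊤ : ℕ∞) h)
    (i : Fin n) (x : Fin n → ℝ) :
    lgd i (fun x => (mono p x : ℂ) * h x) x =
      (mono p x : ℂ) * (p i * h x) +
        (mono (p + Pi.single i 1) x : ℂ) * fderiv ℝ h x (Pi.single i 1) := by
  have h1 := ((contDiff_mono p).differentiable (by simp)).differentiableAt (x := x)
  have h2 : HasFDerivAt (fun x => (mono p x : ℂ))
      (Complex.ofRealCLM.comp (fderiv ℝ (mono p) x)) x :=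
    (Complex.ofRealCLM.hasFDerivAt (x := mono p x)).comp x h1.hasFDerivAt
  have h3 := pderiv1_mono_mul p (g := fun _ => 1) contDiff_const i x
  have h4 : x i * fderiv ℝ (mono p) x (Pi.single i 1) = mono p x * p i := by
    simpa [pderiv1] using h3
  rw [lgd_mul h2.differentiableAt (hh.differentiable (by simp)).differentiableAt]
  simp only [lgd, h2.fderiv, ContinuousLinearMap.comp_apply, Complex.ofRealCLM_apply]
  rw [← Complex.ofReal_mul, h4, mono_add, mono_single]
  push_cast
  ring

theorem finite_sigma1 (S : SimplicialSubdivision n Γ) : (sigma1 S).Finite := by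
  have := S.fin
  refine (Set.finite_range fun z : S.ι × Fin n => S.gen z.1 z.2).subset ?_
  rintro a ⟨σ, j, rfl⟩
  exact ⟨(σ, j), rfl⟩

theorem symb_mono_mul (p : Fin n → ℕ) {h : (Fin n → ℝ) → ℂ}
    (hh : ContDiff ℝ (⊤ : ℕ∞) h) {N : Weight n} (hN : ∀ a ∈ sigma1 S, N a ≤ dotN a p) :
    Symb S δ N fun x => (mono p x : ℂ) * h x := by
  have hbound : ∀ h : (Fin n → ℝ) → ℂ, Continuous h → ∃ C, 0 ≤ C ∧ ∀ x ∈ torusBox n δ,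
      ‖h x‖ ≤ C := by
    intro h hh
    have hK : IsCompact (Set.univ.pi fun _ : Fin n => Set.Icc (-δ) δ) :=
      isCompact_univ_pi fun _ => isCompact_Icc
    obtain ⟨C, hC⟩ := hK.exists_bound_of_continuousOn hh.continuousOn
    refine ⟨max C 0, le_max_right _ _, fun x hx => (hC x fun i _ => ?_).trans (le_max_left _ _)⟩
    exact abs_le.1 (hx i).2.le
  refine Symb.of_span (𝓕 := fun M ω => ∃ (p : Fin n → ℕ) (h : (Fin n → ℝ) → ℂ),
    ContDiff ℝ (⊤ : ℕ∞) h ∧ (∀ a ∈ sigma1 S, M a ≤ dotN a p) ∧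
    ω = fun x => (mono p x : ℂ) * h x) ?_ ?_ ?_ ?_ ⟨p, h, hh, hN, rfl⟩
  · rintro M _ ⟨p, h, hh, hM, rfl⟩ σ
    obtain ⟨C, hC0, hC⟩ := hbound h hh.continuous
    refine ⟨C, hC0, fun x hx c hc => ?_⟩
    rw [norm_mul, Complex.norm_real, Real.norm_eq_abs, abs_mono_of_onCell hc, mul_comm]
    refine mul_le_mul (hC x hx) ?_ (by positivity) hC0
    rw [Real.exp_le_exp]
    refine neg_le_neg (Finset.sum_le_sum fun j _ => mul_le_mul_of_nonneg_left ?_ (hc.1 j))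
    exact_mod_cast hM _ ⟨σ, j, rfl⟩
  · rintro M _ ⟨p, h, hh, hM, rfl⟩
    exact ((Complex.ofRealCLM.contDiff.comp (contDiff_mono p)).mul hh).contDiffOn
  · rintro M _ ⟨p, h, hh, hM, rfl⟩ i
    refine .congr (.add (.base ⟨p, fun x => p i * h x, contDiff_const.mul hh, hM, rfl⟩)
      (.base ⟨p + Pi.single i 1, fun x => fderiv ℝ h x (Pi.single i 1),
        (hh.fderiv_right (m := (⊤ : ℕ∞)) (by simp)).clm_apply contDiff_const,
        fun a ha => (hM a ha).trans ?_, rfl⟩)) fun x _ => lgd_mono_mul p hh i x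
    simp only [dotN, Pi.add_apply, mul_add, Finset.sum_add_distrib]
    push_cast
    exact le_add_of_nonneg_right (by positivity)
  · rintro M _ ⟨p, h, hh, hM, rfl⟩ a ha
    set 𝓕 : Weight n → ((Fin n → ℝ) → ℂ) → Prop :=
      fun M ω => ∃ (p : Fin n → ℕ) (h : (Fin n → ℝ) → ℂ),
        ContDiff ℝ (⊤ : ℕ∞) h ∧ (∀ a ∈ sigma1 S, M a ≤ dotN a p) ∧
        ω = fun x => (mono p x : ℂ) * h x with h𝓕
    have h1 : SymbSpan δ 𝓕 (M + Pi.single a 1)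
        fun x => ((dotN a p : ℂ) - M a) * ((mono p x : ℂ) * h x) := by
      rcases (hM a ha).eq_or_lt with e | e
      · refine SymbSpan.zero.congr fun x _ => ?_
        have e1 : (M a : ℂ) = dotN a p := by exact_mod_cast congrArg (Int.cast (R := ℂ)) e
        simp [e1]
      · refine .smul _ (.base ⟨p, h, hh, fun b hb => ?_, rfl⟩)
        by_cases hba : b = a
        · subst hba; simp; omega
        · simpa [hba] using hM b hb
    have h2 : ∀ i, SymbSpan δ 𝓕 (M + Pi.single a 1) fun x => (a i : ℂ) *
        ((mono (p + Pi.single i 1) x : ℂ) * fderiv ℝ h x (Pi.single i 1)) := by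
      intro i
      rcases Nat.eq_zero_or_pos (a i) with e | e
      · exact SymbSpan.zero.congr fun x _ => by simp [e]
      · refine .smul _ (.base ⟨p + Pi.single i 1, fun x => fderiv ℝ h x (Pi.single i 1),
          (hh.fderiv_right (m := (⊤ : ℕ∞)) (by simp)).clm_apply contDiff_const,
          fun b hb => ?_, rfl⟩)
        have e1 : dotN b (p + Pi.single i 1) = dotN b p + b i := by
          simp [dotN, mul_add, Finset.sum_add_distrib, Pi.single_apply]
        have := hM b hb
        rw [e1]
        by_cases hba : b = a
        · subst hba; simp; omega
        · simp [hba]; omega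
    refine (h1.add (SymbSpan.sum Finset.univ fun i _ => h2 i)).congr fun x _ => ?_
    simp only [peelOp, lgd_mono_mul p hh, mul_add, Finset.sum_add_distrib]
    have e2 : ∑ i, (a i : ℂ) * ((mono p x : ℂ) * (p i * h x)) =
        (dotN a p : ℂ) * ((mono p x : ℂ) * h x) := by
      simp only [dotN, Nat.cast_sum, Nat.cast_mul, Finset.sum_mul]
      exact Finset.sum_congr rfl fun i _ => by ring
    rw [e2]
    ring

theorem symb_of_contDiff {h : (Fin n → ℝ) → ℂ} (hh : ContDiff ℝ (⊤ : ℕ∞) h) : Symb S δ 0 h := by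
  have h1 := symb_mono_mul (S := S) (δ := δ) (0 : Fin n → ℕ) hh (N := 0) (by simp)
  exact h1.congr fun x _ => by simp [mono]

end SymbolAlgebra

/-- Unbounded families of almost nonnegative solutions of a linear system produce nonnegative
solutions. -/
theorem exists_recession {κ E : Type*} [Fintype κ] [AddCommGroup E] [Module ℝ E]
    (L : (κ → ℝ) →ₗ[ℝ] E) (B : Set κ) (k : κ)
    (h : ∀ C : ℝ, ∃ z, L z = 0 ∧ (∀ i, -1 ≤ z i) ∧ (∀ i ∈ B, z i ≤ 1) ∧ C < z k) :
    ∃ z, L z = 0 ∧ (∀ i, 0 ≤ z i) ∧ (∀ i ∈ B, z i = 0) ∧ 0 < z k := by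
  classical
  choose z hz using fun m : ℕ => h m
  set 𝒰 := Filter.hyperfilter ℕ
  set I : Set κ := {i | ∃ C : ℝ, ∀ᶠ m in 𝒰, z m i ≤ C} with hI
  have hnI : ∀ i, i ∉ I → ∀ C : ℝ, ∀ᶠ m in 𝒰, C < z m i := by
    intro i hi C
    by_contra hcon
    refine hi ⟨C, ?_⟩
    simpa using Ultrafilter.eventually_not.2 hcon
  have hkI : k ∉ I := by
    rintro ⟨C, hC⟩
    have h1 : ∀ᶠ m in (𝒰 : Filter ℕ), C < z m k := by
      have : ∀ᶠ m : ℕ in atTop, C < z m k := by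
        filter_upwards [(tendsto_natCast_atTop_atTop (R := ℝ)).eventually_gt_atTop C] with m hm
        exact hm.trans (hz m).2.2.2
      rw [← Nat.cofinite_eq_atTop] at this
      exact Filter.hyperfilter_le_cofinite this
    obtain ⟨m, h2, h3⟩ := (hC.and h1).exists
    exact absurd h2 (not_le.2 h3)
  have hBI : B ⊆ I := fun i hi => ⟨1, .of_forall fun m => (hz m).2.2.1 i hi⟩
  let R : LinearMap.ker L →ₗ[ℝ] (κ → ℝ) :=
    (LinearMap.pi fun i => if i ∈ I then LinearMap.proj i else 0).comp (LinearMap.ker L).subtype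
  have hR : ∀ y i, R y i = if i ∈ I then (y : κ → ℝ) i else 0 := by
    intro y i
    by_cases hi : i ∈ I <;> simp [R, hi]
  obtain ⟨s, hs⟩ := R.rangeRestrict.exists_rightInverse_of_surjective R.range_rangeRestrict
  let w : ℕ → LinearMap.ker L := fun m => ⟨z m, (hz m).1⟩
  let s' := s.toContinuousLinearMap
  have hbd : ∃ C : ℝ, 0 ≤ C ∧ ∀ᶠ m in 𝒰, ‖R.rangeRestrict (w m)‖ ≤ C := by
    choose! C hC using fun i (hi : i ∈ I) => hi
    refine ⟨∑ i, (|C i| + 1), by positivity, ?_⟩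
    have : ∀ᶠ m in 𝒰, ∀ i, i ∈ I → z m i ≤ C i :=
      Filter.eventually_all.2 fun i => by
        by_cases hi : i ∈ I
        · filter_upwards [hC i hi] with m hm _ using hm
        · exact .of_forall fun m h => absurd h hi
    filter_upwards [this] with m hm
    change ‖R (w m)‖ ≤ _
    rw [pi_norm_le_iff_of_nonneg (by positivity)]
    intro i
    have h1 : |C i| + 1 ≤ ∑ i, (|C i| + 1) :=
      Finset.single_le_sum (f := fun i => |C i| + 1) (fun i _ => by positivity) (Finset.mem_univ i)
    refine le_trans ?_ h1
    rw [hR]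
    split_ifs with hi
    · rw [Real.norm_eq_abs, abs_le]
      have h2 := (hz m).2.1 i
      have h3 := hm i hi
      change -_ ≤ z m i ∧ z m i ≤ _
      constructor
      · linarith [abs_nonneg (C i)]
      · linarith [le_abs_self (C i)]
    · simp; positivity
  obtain ⟨C, hC0, hC⟩ := hbd
  have h1 : ∀ᶠ m in 𝒰, ∀ i, i ∉ I → ‖s'‖ * C < z m i :=
    Filter.eventually_all.2 fun i => by
      by_cases hi : i ∈ I
      · exact .of_forall fun m h => absurd hi h
      · filter_upwards [hnI i hi (‖s'‖ * C)] with m hm _ using hm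
  obtain ⟨m, hm1, hm2⟩ := (hC.and h1).exists
  set v := s' (R.rangeRestrict (w m)) with hv
  have hvn : ∀ i, |(v : κ → ℝ) i| ≤ ‖s'‖ * C := fun i =>
    (norm_le_pi_norm (v : κ → ℝ) i).trans
      ((s'.le_opNorm _).trans (mul_le_mul_of_nonneg_left hm1 (norm_nonneg _)))
  have hvI : ∀ i ∈ I, (v : κ → ℝ) i = z m i := by
    intro i hi
    have h2 : R.rangeRestrict v = R.rangeRestrict (w m) := by
      exact LinearMap.congr_fun hs (R.rangeRestrict (w m))
    have h3 : R v i = R (w m) i := congrFun (congrArg Subtype.val h2) i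
    simpa [hR, hi, w] using h3
  refine ⟨z m - v, ?_, ?_, ?_, ?_⟩
  · rw [map_sub, (hz m).1, v.2, sub_zero]
  · intro i
    by_cases hi : i ∈ I
    · simp [hvI i hi]
    · have := hm2 i hi
      have := (abs_le.1 (hvn i)).2
      simp only [Pi.sub_apply]
      linarith
  · intro i hi
    simp [hvI i (hBI hi)]
  · have := hm2 k hkI
    have := (abs_le.1 (hvn k)).2
    simp only [Pi.sub_apply]
    linarith

section Cutoff

variable {Γ : Set (Fin n → ℝ)} (S : SimplicialSubdivision n Γ) (σ : S.ι)

/-- The real matrix of generators of a maximal cone. -/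
def genMat : Matrix (Fin n) (Fin n) ℝ := Matrix.of fun j k => (S.gen σ j k : ℝ)

theorem isUnit_det_genMat : IsUnit (genMat S σ).det := by
  have h := S.unimodular σ
  have e : (genMat S σ).det = ((Matrix.of fun j k => (S.gen σ j k : ℤ)).det : ℝ) := by
    have := (Int.castRingHom ℝ).map_det (Matrix.of fun j k => (S.gen σ j k : ℤ))
    rw [eq_intCast] at this
    rw [this]
    congr 1
  rw [e, isUnit_iff_ne_zero]
  intro h0
  rw [Int.cast_eq_zero] at h0
  rw [h0] at h
  simp at h

/-- The `j`-th coordinate with respect to the generators of a maximal cone. -/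
noncomputable def coneCoord (j : Fin n) (v : Fin n → ℝ) : ℝ := ∑ i, v i * (genMat S σ)⁻¹ i j

theorem coneCoord_sum (c : Fin n → ℝ) (j : Fin n) :
    coneCoord S σ j (fun i => ∑ k, c k * S.gen σ k i) = c j := by
  have h := congrFun (Matrix.vecMul_vecMul c (genMat S σ) (genMat S σ)⁻¹) j
  rw [Matrix.mul_nonsing_inv _ (isUnit_det_genMat S σ), Matrix.vecMul_one] at h
  exact h

theorem sum_coneCoord (v : Fin n → ℝ) (i : Fin n) :
    ∑ j, coneCoord S σ j v * S.gen σ j i = v i := by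
  have h := congrFun (Matrix.vecMul_vecMul v (genMat S σ)⁻¹ (genMat S σ)) i
  rw [Matrix.nonsing_inv_mul _ (isUnit_det_genMat S σ), Matrix.vecMul_one] at h
  exact h

theorem coneCoord_gen (j k : Fin n) :
    coneCoord S σ j (natPt (S.gen σ k)) = if j = k then 1 else 0 := by
  have h := coneCoord_sum S σ (Pi.single k 1) j
  simp only [Pi.single_apply, ite_mul, one_mul, zero_mul, Finset.sum_ite_eq',
    Finset.mem_univ, if_true] at h
  exact h

theorem coneCoord_sum_smul (c : Fin n → ℝ) (g : Fin n → Fin n → ℝ) (j : Fin n) :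
    coneCoord S σ j (fun i => ∑ k, c k * g k i) = ∑ k, c k * coneCoord S σ j (g k) := by
  simp only [coneCoord, Finset.sum_mul, Finset.mul_sum]
  rw [Finset.sum_comm]
  exact Finset.sum_congr rfl fun k _ => Finset.sum_congr rfl fun i _ => by ring

/-- Near a maximal cone `σ`, the coordinates in another cone along generators which do not
belong to `σ`, or along which the `σ`-coordinate is nonpositive, are bounded. -/
theorem exists_coord_bound (σ τ : S.ι) : ∃ C : ℝ, 0 ≤ C ∧ ∀ c d : Fin n → ℝ, (∀ k, 0 ≤ c k) →
    (∀ j, -1 ≤ d j) → (∀ i, ∑ k, c k * S.gen τ k i = ∑ j, d j * S.gen σ j i) →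
    ∀ k, (∀ j, S.gen σ j = S.gen τ k → d j ≤ 0) → c k ≤ C := by
  have key : ∀ k, ∃ C : ℝ, ∀ c d : Fin n → ℝ, (∀ k, 0 ≤ c k) →
      (∀ j, -1 ≤ d j) → (∀ i, ∑ k, c k * S.gen τ k i = ∑ j, d j * S.gen σ j i) →
      (∀ j, S.gen σ j = S.gen τ k → d j ≤ 0) → c k ≤ C := by
    intro k
    by_contra! hcon
    let L : (Fin n ⊕ Fin n → ℝ) →ₗ[ℝ] (Fin n → ℝ) := LinearMap.pi fun i =>
      (∑ k, (S.gen τ k i : ℝ) • LinearMap.proj (Sum.inl k)) -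
        ∑ j, (S.gen σ j i : ℝ) • LinearMap.proj (Sum.inr j)
    have hL : ∀ z i, L z i = (∑ k, z (Sum.inl k) * S.gen τ k i) -
        ∑ j, z (Sum.inr j) * S.gen σ j i := by
      intro z i
      simp [L, mul_comm]
    obtain ⟨z, hz0, hz1, hz2, hz3⟩ := exists_recession L
      (Sum.inr '' {j | S.gen σ j = S.gen τ k}) (Sum.inl k) (by
        intro C
        obtain ⟨c, d, hc, hd, h1, h2, h3⟩ := hcon C
        refine ⟨Sum.elim c d, ?_, ?_, ?_, h3⟩
        · funext i
          rw [hL]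
          simpa [sub_eq_zero] using h1 i
        · rintro (i | i)
          · exact (by norm_num : (-1 : ℝ) ≤ 0).trans (hc i)
          · exact hd i
        · rintro _ ⟨j, hj, rfl⟩
          exact (h2 j hj).trans zero_le_one)
    have hz0' : ∀ i, ∑ k, z (Sum.inl k) * S.gen τ k i = ∑ j, z (Sum.inr j) * S.gen σ j i := by
      intro i
      have := congrFun hz0 i
      rw [hL] at this
      simpa [sub_eq_zero] using this
    obtain ⟨s, hs1, hs2⟩ := S.compatible τ σ
    have hmem : (fun i => ∑ k, z (Sum.inl k) * S.gen τ k i) ∈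
        coneSpan (genR (S.gen τ)) ∩ coneSpan (genR (S.gen σ)) := by
      constructor
      · refine ⟨fun k => z (Sum.inl k), fun k => hz1 _, by simp, ?_⟩
        funext i
        simp [genR, natPt]
      · refine ⟨fun k => z (Sum.inr k), fun k => hz1 _, by simp, ?_⟩
        funext i
        simp [genR, natPt, hz0']
    rw [hs2] at hmem
    obtain ⟨c, hc0, hcs, hc⟩ := hmem
    have hcz : ∀ k, c k = z (Sum.inl k) := by
      intro k
      rw [← coneCoord_sum S τ c k, ← coneCoord_sum S τ (fun k => z (Sum.inl k)) k, hc]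
      congr 1
      funext i
      simp [genR, natPt]
    have hks : k ∈ s := by
      by_contra hk
      have := hcs k hk
      rw [hcz] at this
      linarith
    obtain ⟨j, hj⟩ := hs1 k hks
    have h0 : z (Sum.inr j) = 0 := hz2 _ ⟨j, hj, rfl⟩
    have h1 : ∑ k, z (Sum.inl k) * coneCoord S σ j (natPt (S.gen τ k)) = 0 := by
      rw [← coneCoord_sum_smul, ← h0, ← coneCoord_sum S σ (fun j => z (Sum.inr j)) j]
      congr 1
      funext i
      exact hz0' i
    have h2 : ∀ k' ∈ Finset.univ,
        0 ≤ z (Sum.inl k') * coneCoord S σ j (natPt (S.gen τ k')) := by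
      intro k' _
      by_cases hk' : k' ∈ s
      · obtain ⟨j', hj'⟩ := hs1 k' hk'
        rw [← hj', coneCoord_gen]
        refine mul_nonneg (hz1 _) ?_
        split_ifs <;> norm_num
      · rw [← hcz, hcs k' hk', zero_mul]
    have h3 := (Finset.sum_eq_zero_iff_of_nonneg h2).1 h1 k (Finset.mem_univ k)
    rw [← hj, coneCoord_gen] at h3
    simp at h3
    linarith
  choose C hC using key
  refine ⟨∑ k, |C k|, by positivity, fun c d hc hd h k hk => ?_⟩
  exact (hC k c d hc hd h hk).trans ((le_abs_self _).trans
    (Finset.single_le_sum (f := fun k => |C k|) (fun i _ => abs_nonneg _) (Finset.mem_univ k)))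

/-- Logarithmic coordinates on the torus adapted to a maximal cone. -/
noncomputable def logCoord (j : Fin n) (x : Fin n → ℝ) : ℝ :=
  coneCoord S σ j fun i => -Real.log (x i)

theorem logCoord_of_onCell {c x : Fin n → ℝ} (h : OnCell S σ c x) (j : Fin n) :
    logCoord S σ j x = c j := by
  rw [logCoord, ← coneCoord_sum S σ c j]
  congr 1
  funext i
  rw [← Real.log_abs, h.2 i, Real.log_exp, neg_neg]

theorem sum_logCoord (x : Fin n → ℝ) (i : Fin n) :
    ∑ j, logCoord S σ j x * S.gen σ j i = -Real.log (x i) :=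
  sum_coneCoord S σ _ i

theorem hasFDerivAt_logCoord {x : Fin n → ℝ} (hx : ∀ i, x i ≠ 0) (j : Fin n) :
    HasFDerivAt (logCoord S σ j) (∑ i, (-((x i)⁻¹ * (genMat S σ)⁻¹ i j)) •
      ContinuousLinearMap.proj (R := ℝ) (φ := fun _ : Fin n => ℝ) i) x := by
  unfold logCoord coneCoord
  refine HasFDerivAt.fun_sum fun i _ => ?_
  have h := ((ContinuousLinearMap.proj (R := ℝ) (φ := fun _ : Fin n => ℝ) i).hasFDerivAt
    (x := x)).log (hx i)
  refine (h.neg.mul_const ((genMat S σ)⁻¹ i j)).congr_fderiv ?_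
  ext v
  simp
  ring

theorem contDiffOn_logCoord (δ : ℝ) (j : Fin n) :
    ContDiffOn ℝ (⊤ : ℕ∞) (logCoord S σ j) (torusBox n δ) := by
  unfold logCoord coneCoord
  refine ContDiffOn.sum fun i _ => ?_
  refine ContDiffOn.mul (ContDiffOn.neg (ContDiffOn.log ?_ fun x hx => (hx i).1)) contDiffOn_const
  exact (contDiff_apply ℝ ℝ i).contDiffOn

variable {S σ}

theorem lgd_prod_cutoff {η : Fin n → ℝ → ℝ} (hη : ∀ j, ContDiff ℝ (⊤ : ℕ∞) (η j))
    {x : Fin n → ℝ} (hx : ∀ i, x i ≠ 0) (i : Fin n) :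
    lgd i (fun x => ∏ j, (η j (logCoord S σ j x) : ℂ)) x =
      ∑ j, (-(genMat S σ)⁻¹ i j : ℂ) *
        ∏ k, (Function.update η j (deriv (η j)) k (logCoord S σ k x) : ℂ) := by
  have h1 : ∀ j, HasFDerivAt (fun x => (η j (logCoord S σ j x) : ℂ))
      (Complex.ofRealCLM.comp (deriv (η j) (logCoord S σ j x) •
        ∑ i, (-((x i)⁻¹ * (genMat S σ)⁻¹ i j)) •
          ContinuousLinearMap.proj (R := ℝ) (φ := fun _ : Fin n => ℝ) i)) x := by
    intro j
    have h2 := (((hη j).differentiable (by simp)).differentiableAt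
      (x := logCoord S σ j x)).hasDerivAt.comp_hasFDerivAt x (hasFDerivAt_logCoord S σ hx j)
    exact (Complex.ofRealCLM.hasFDerivAt).comp x h2
  have h3 := HasFDerivAt.finsetProd (u := Finset.univ) fun j _ => h1 j
  rw [lgd, h3.fderiv, sum_apply, Finset.mul_sum]
  refine Finset.sum_congr rfl fun j _ => ?_
  have e : ∏ k, (Function.update η j (deriv (η j)) k (logCoord S σ k x) : ℂ) =
      deriv (η j) (logCoord S σ j x) * ∏ k ∈ Finset.univ.erase j, (η k (logCoord S σ k x) : ℂ) := by
    rw [← Finset.mul_prod_erase _ _ (Finset.mem_univ j)]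
    congr 1
    · simp
    · refine Finset.prod_congr rfl fun k hk => ?_
      rw [Function.update_of_ne (Finset.ne_of_mem_erase hk)]
  rw [e]
  have hxi := hx i
  have hxi' : (x i : ℂ) ≠ 0 := by exact_mod_cast hxi
  simp [Pi.single_apply]
  field_simp

theorem symb_cutoff {δ : ℝ} {η : Fin n → ℝ → ℝ} (hη : ∀ j, ContDiff ℝ (⊤ : ℕ∞) (η j))
    (h0 : ∀ j, ∀ s < -1, η j s = 0) (h1 : ∀ j, ∀ s, 0 < s → η j s = η j 1) {N : Weight n}
    (hN : ∀ j, 0 < N (S.gen σ j) → η j 1 = 0) :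
    Symb S δ N fun x => ∏ j, (η j (logCoord S σ j x) : ℂ) := by
  set 𝓕 : Weight n → ((Fin n → ℝ) → ℂ) → Prop := fun M ω => ∃ η : Fin n → ℝ → ℝ,
    (∀ j, ContDiff ℝ (⊤ : ℕ∞) (η j)) ∧ (∀ j, ∀ s < -1, η j s = 0) ∧
    (∀ j, ∀ s, 0 < s → η j s = η j 1) ∧ (∀ j, 0 < M (S.gen σ j) → η j 1 = 0) ∧
    ω = fun x => ∏ j, (η j (logCoord S σ j x) : ℂ) with h𝓕
  have hder : ∀ η : Fin n → ℝ → ℝ, (∀ j, ContDiff ℝ (⊤ : ℕ∞) (η j)) →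
      (∀ j, ∀ s < -1, η j s = 0) → (∀ j, ∀ s, 0 < s → η j s = η j 1) → ∀ j,
      (∀ k, ContDiff ℝ (⊤ : ℕ∞) (Function.update η j (deriv (η j)) k)) ∧
      (∀ k, ∀ s < -1, Function.update η j (deriv (η j)) k s = 0) ∧
      (∀ k, ∀ s, 0 < s → Function.update η j (deriv (η j)) k s =
        Function.update η j (deriv (η j)) k 1) ∧ deriv (η j) 1 = 0 := by
    intro η hη h0 h1 j
    have hd1 : ∀ s, 0 < s → deriv (η j) s = 0 := by
      intro s hs
      have : η j =ᶠ[𝓝 s] fun _ => η j 1 := by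
        filter_upwards [lt_mem_nhds hs] with r hr using h1 j r hr
      rw [this.deriv_eq, deriv_const]
    have hd0 : ∀ s < -1, deriv (η j) s = 0 := by
      intro s hs
      have : η j =ᶠ[𝓝 s] fun _ => 0 := by
        filter_upwards [gt_mem_nhds hs] with r hr using h0 j r hr
      rw [this.deriv_eq, deriv_const]
    refine ⟨fun k => ?_, fun k s hs => ?_, fun k s hs => ?_, hd1 1 one_pos⟩ <;>
    rcases eq_or_ne k j with rfl | hk
    · rw [Function.update_self]
      exact (contDiff_infty_iff_deriv.1 (hη k)).2
    · rw [Function.update_of_ne hk]; exact hη k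
    · rw [Function.update_self]; exact hd0 s hs
    · rw [Function.update_of_ne hk]; exact h0 k s hs
    · rw [Function.update_self, hd1 s hs, hd1 1 one_pos]
    · rw [Function.update_of_ne hk]; exact h1 k s hs
  refine Symb.of_span (𝓕 := 𝓕) ?_ ?_ ?_ ?_ ⟨η, hη, h0, h1, hN, rfl⟩
  · rintro M _ ⟨η, hη, h0, h1, hM, rfl⟩ τ
    obtain ⟨C, hC0, hC⟩ := exists_coord_bound S σ τ
    have hb : ∀ j, ∃ K, ∀ s, |η j s| ≤ K := by
      intro j
      obtain ⟨K, hK⟩ := (isCompact_Icc (a := (-1 : ℝ)) (b := 1)).exists_bound_of_continuousOn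
        (hη j).continuous.continuousOn
      refine ⟨K, fun s => ?_⟩
      have hK0 := (abs_nonneg _).trans (hK 1 (by simp))
      rcases lt_or_ge s (-1) with hs | hs
      · simpa [h0 j s hs] using hK0
      · rcases le_or_gt s 1 with hs' | hs'
        · exact hK s ⟨hs, hs'⟩
        · rw [h1 j s (by linarith)]
          exact hK 1 (by simp)
    choose K hK using hb
    have hK0 : ∀ j, 0 ≤ K j := fun j => (abs_nonneg _).trans (hK j 0)
    refine ⟨(∏ j, K j) * Real.exp (∑ k, C * |(M (S.gen τ k) : ℝ)|),
      mul_nonneg (Finset.prod_nonneg fun j _ => hK0 j) (Real.exp_pos _).le,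
      fun x hx c hc => ?_⟩
    by_cases hne : ∀ j, η j (logCoord S σ j x) ≠ 0
    · have hd : ∀ j, -1 ≤ logCoord S σ j x := fun j => by
        by_contra hcon
        exact hne j (h0 j _ (not_le.1 hcon))
      have hcb := hC c (fun j => logCoord S σ j x) hc.1 hd (by
        intro i
        rw [sum_logCoord, ← Real.log_abs, hc.2 i, Real.log_exp, neg_neg])
      have hle : ∑ k, c k * (M (S.gen τ k) : ℝ) ≤ ∑ k, C * |(M (S.gen τ k) : ℝ)| := by
        refine Finset.sum_le_sum fun k _ => ?_
        rcases le_or_gt (M (S.gen τ k)) 0 with hk | hk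
        · have h2 : (M (S.gen τ k) : ℝ) ≤ 0 := by exact_mod_cast hk
          exact (mul_nonpos_of_nonneg_of_nonpos (hc.1 k) h2).trans (by positivity)
        · have h2 : c k ≤ C := hcb k fun j hj => by
            by_contra hcon
            refine hne j ?_
            rw [h1 j _ (not_le.1 hcon)]
            exact hM j (by rw [hj]; exact hk)
          have h3 : (0 : ℝ) < M (S.gen τ k) := by exact_mod_cast hk
          rw [abs_of_pos h3]
          exact mul_le_mul_of_nonneg_right h2 h3.le
      rw [norm_prod, mul_assoc, ← Real.exp_add]
      have h2 : ∏ j, ‖(η j (logCoord S σ j x) : ℂ)‖ ≤ ∏ j, K j :=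
        Finset.prod_le_prod (fun _ _ => norm_nonneg _) fun j _ => by
          rw [Complex.norm_real]; exact hK j _
      refine h2.trans (le_mul_of_one_le_right (Finset.prod_nonneg fun j _ => hK0 j) ?_)
      exact Real.one_le_exp (by linarith)
    · push Not at hne
      obtain ⟨j, hj⟩ := hne
      beta_reduce
      rw [Finset.prod_eq_zero (Finset.mem_univ j) (by rw [hj, Complex.ofReal_zero]), norm_zero]
      exact mul_nonneg (mul_nonneg (Finset.prod_nonneg fun j _ => hK0 j) (Real.exp_pos _).le)
        (Real.exp_pos _).le
  · rintro M _ ⟨η, hη, h0, h1, hM, rfl⟩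
    refine contDiffOn_prod fun j _ => ?_
    exact (Complex.ofRealCLM.contDiff.comp (hη j)).comp_contDiffOn (contDiffOn_logCoord S σ δ j)
  · rintro M _ ⟨η, hη, h0, h1, hM, rfl⟩ i
    refine SymbSpan.congr ?_ fun x hx => lgd_prod_cutoff hη (fun i => (hx i).1) i
    refine SymbSpan.sum _ fun j _ => .smul _ (.base ⟨_, (hder η hη h0 h1 j).1,
      (hder η hη h0 h1 j).2.1, (hder η hη h0 h1 j).2.2.1, fun k hk => ?_, rfl⟩)
    rcases eq_or_ne k j with rfl | hkj
    · rw [Function.update_self]; exact (hder η hη h0 h1 k).2.2.2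
    · rw [Function.update_of_ne hkj]; exact hM k hk
  · rintro M _ ⟨η, hη, h0, h1, hM, rfl⟩ a ha
    have hpeel : ∀ x ∈ torusBox n δ, peelOp M a (fun x => ∏ j, (η j (logCoord S σ j x) : ℂ)) x =
        (∑ j, (-coneCoord S σ j (natPt a) : ℂ) *
          ∏ k, (Function.update η j (deriv (η j)) k (logCoord S σ k x) : ℂ)) +
        (-(M a : ℂ)) * ∏ j, (η j (logCoord S σ j x) : ℂ) := by
      intro x hx
      simp only [peelOp, lgd_prod_cutoff hη (fun i => (hx i).1), Finset.mul_sum]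
      rw [Finset.sum_comm, neg_mul, ← sub_eq_add_neg]
      congr 1
      refine Finset.sum_congr rfl fun j _ => ?_
      simp only [← mul_assoc, ← Finset.sum_mul]
      congr 1
      simp [coneCoord, natPt]
    refine SymbSpan.congr (.add (SymbSpan.sum _ fun j _ => ?_) ?_) hpeel
    · by_cases hj : ∃ k, S.gen σ k = a ∧ k ≠ j
      · obtain ⟨k, rfl, hk⟩ := hj
        refine SymbSpan.zero.congr fun x _ => ?_
        rw [coneCoord_gen]
        simp [hk.symm]
      · push Not at hj
        refine .smul _ (.base ⟨_, (hder η hη h0 h1 j).1,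
          (hder η hη h0 h1 j).2.1, (hder η hη h0 h1 j).2.2.1, fun k hk => ?_, rfl⟩)
        rcases eq_or_ne k j with rfl | hkj
        · rw [Function.update_self]; exact (hder η hη h0 h1 k).2.2.2
        · rw [Function.update_of_ne hkj]
          have : S.gen σ k ≠ a := fun h => hkj (hj k h)
          exact hM k (by simpa [this] using hk)
    · by_cases h2 : M a = 0
      · exact SymbSpan.zero.congr fun x _ => by simp [h2]
      · refine .smul _ (.base ⟨η, hη, h0, h1, fun k hk => hM k ?_, rfl⟩)
        by_cases hka : S.gen σ k = a
        · rw [hka] at hk ⊢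
          simp at hk
          omega
        · simpa [hka] using hk

end Cutoff

/-- A partition of unity on the torus adapted to the maximal cones of a subdivision. -/
theorem exists_partition {Γ : Set (Fin n → ℝ)} (S : SimplicialSubdivision n Γ) {δ : ℝ}
    (hδ : δ ≤ 1) :
    ∃ χ : S.ι → (Fin n → ℝ) → ℂ,
      (∀ σ, ∀ N : Weight n, (∀ j, N (S.gen σ j) ≤ 0) → Symb S δ N (χ σ)) ∧
      ∀ x ∈ torusBox n δ, ∑ σ ∈ @Finset.univ S.ι S.fin, χ σ x = 1 := by
  let := S.fin
  set η : ℝ → ℝ := fun s => Real.smoothTransition (s + 1) with hη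
  have hη1 : ContDiff ℝ (⊤ : ℕ∞) η :=
    Real.smoothTransition.contDiff.comp (contDiff_id.add contDiff_const)
  have hη2 : ∀ s, 0 ≤ s → η s = 1 := fun s hs =>
    Real.smoothTransition.one_of_one_le (by linarith)
  have hη3 : ∀ s < -1, η s = 0 := fun s hs =>
    Real.smoothTransition.zero_of_nonpos (by linarith)
  set β : S.ι → (Fin n → ℝ) → ℝ := fun σ x => ∏ j, η (logCoord S σ j x) with hβ
  have hβ0 : ∀ σ x, 0 ≤ β σ x := fun σ x =>
    Finset.prod_nonneg fun j _ => Real.smoothTransition.nonneg _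
  have hβs : ∀ σ, ∀ N : Weight n, (∀ j, N (S.gen σ j) ≤ 0) →
      Symb S δ N fun x => (β σ x : ℂ) := by
    intro σ N hN
    have h := symb_cutoff (S := S) (σ := σ) (δ := δ) (η := fun _ => η) (fun _ => hη1)
      (fun _ => hη3) (fun _ s hs => by rw [hη2 s hs.le, hη2 1 zero_le_one]) (N := N)
      fun j hj => absurd hj (not_lt.2 (hN j))
    simpa [hβ] using h
  have hsum : ∀ x ∈ torusBox n δ, 1 ≤ ∑ σ, β σ x := by
    intro x hx
    obtain ⟨σ, c, hc⟩ := exists_onCell S (fun i => (hx i).1) fun i => ((hx i).2.le.trans hδ)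
    have h1 : β σ x = 1 := Finset.prod_eq_one fun j _ => by
      rw [logCoord_of_onCell S σ hc]
      exact hη2 _ (hc.1 j)
    rw [← h1]
    exact Finset.single_le_sum (f := fun σ => β σ x) (fun σ _ => hβ0 σ x) (Finset.mem_univ σ)
  have hG : Symb S δ 0 fun x => ((∑ σ, β σ x : ℝ) : ℂ) := by
    simp only [Complex.ofReal_sum]
    exact Symb.sum _ fun σ _ => hβs σ 0 (by simp)
  have hGe : WElliptic S δ 0 fun x => ((∑ σ, β σ x : ℝ) : ℂ) := by
    intro σ
    refine ⟨1, one_pos, fun x hx c _ => ?_⟩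
    rw [Complex.norm_real, Real.norm_eq_abs]
    simpa using (hsum x hx).trans (le_abs_self _)
  refine ⟨fun σ x => (β σ x : ℂ) / ((∑ σ, β σ x : ℝ) : ℂ), fun σ N hN => ?_, fun x hx => ?_⟩
  · have := Symb.div hδ (hβs σ N hN) hG hGe
    rwa [sub_zero] at this
  · rw [← Finset.sum_div, ← Complex.ofReal_sum]
    refine div_self ?_
    have := hsum x hx
    exact_mod_cast (show (∑ σ, β σ x) ≠ 0 by linarith)

section Torus

/-- The torus `(ℝ \ {0})ⁿ`. -/
def torus (n : ℕ) : Set (Fin n → ℝ) := {x | ∀ i, x i ≠ 0}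

theorem isOpen_torus : IsOpen (torus n) := by
  have : torus n = ⋂ i, {x | x i ≠ 0} := by
    ext x; simp [torus]
  rw [this]
  exact isOpen_iInter_of_finite fun i => isOpen_ne_fun (continuous_apply i) continuous_const

theorem ae_mem_torus : ∀ᵐ x : Fin n → ℝ, x ∈ torus n := by
  refine ae_all_iff.2 fun i => ?_
  rw [volume_pi]
  exact Measure.ae_eval_ne (fun _ => volume) i 0

theorem aestronglyMeasurable_of_torus {ψ : (Fin n → ℝ) → ℂ} (h : ContinuousOn ψ (torus n)) :
    AEStronglyMeasurable ψ volume := by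
  have h1 := h.aestronglyMeasurable (μ := volume) isOpen_torus.measurableSet
  rwa [Measure.restrict_eq_self_of_ae_mem ae_mem_torus] at h1

theorem integrable_of_bound {ψ : (Fin n → ℝ) → ℂ} (h : ContinuousOn ψ (torus n)) {C R : ℝ}
    (hC : ∀ x ∈ torus n, ‖ψ x‖ ≤ C) (hR : ∀ x ∈ torus n, R < ‖x‖ → ψ x = 0) :
    Integrable ψ := by
  have h1 : IntegrableOn (fun _ : Fin n → ℝ => C) (Metric.closedBall 0 R) :=
    integrableOn_const (isCompact_closedBall 0 R).measure_lt_top.ne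
  refine ((integrable_indicator_iff Metric.isClosed_closedBall.measurableSet).2 h1).mono'
    (aestronglyMeasurable_of_torus h) ?_
  filter_upwards [ae_mem_torus] with x hx
  by_cases hxR : x ∈ Metric.closedBall (0 : Fin n → ℝ) R
  · rw [Set.indicator_of_mem hxR]; exact hC x hx
  · rw [Set.indicator_of_notMem hxR, hR x hx (by simpa using hxR), norm_zero]

/-- Scaling of one coordinate. -/
def scaleCoord (i : Fin n) (s : ℝ) (x : Fin n → ℝ) : Fin n → ℝ :=
  fun j => Function.update (1 : Fin n → ℝ) i s j * x j

theorem integral_scaleCoord {ψ : (Fin n → ℝ) → ℂ} (h : AEStronglyMeasurable ψ volume)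
    (i : Fin n) {s : ℝ} (hs : 0 < s) :
    ∫ x, ψ (scaleCoord i s x) = (s⁻¹ : ℝ) • ∫ x, ψ x := by
  set L := Matrix.toLin' (Matrix.diagonal (Function.update (1 : Fin n → ℝ) i s)) with hL
  have hdet : LinearMap.det L = s := by
    rw [hL, LinearMap.det_toLin', Matrix.det_diagonal,
      Finset.prod_update_of_mem (Finset.mem_univ i)]
    simp
  have hmap := Real.map_linearMap_volume_pi_eq_smul_volume_pi (f := L)
    (by rw [hdet]; exact hs.ne')
  have e : ∀ x, scaleCoord i s x = L x := by
    intro x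
    funext j
    simp [hL, scaleCoord, Matrix.toLin'_apply, Matrix.mulVec_diagonal]
  simp only [e]
  rw [← integral_map (f := ψ) (L.continuous_of_finiteDimensional.measurable.aemeasurable)
    (by rw [hmap]; exact h.smul_measure _), hmap, integral_smul_measure, hdet,
    abs_of_pos (inv_pos.2 hs), ENNReal.toReal_ofReal (inv_pos.2 hs).le]

/-- Integration by parts for the logarithmic derivative. -/
theorem integral_add_lgd_eq_zero {ψ : (Fin n → ℝ) → ℂ} (i : Fin n)
    (h : ContDiffOn ℝ 1 ψ (torus n)) {C R : ℝ}
    (hC : ∀ x ∈ torus n, ‖ψ x‖ ≤ C) (hC' : ∀ x ∈ torus n, ‖lgd i ψ x‖ ≤ C)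
    (hR : ∀ x ∈ torus n, R < ‖x‖ → ψ x = 0) (hR' : ∀ x ∈ torus n, R < ‖x‖ → lgd i ψ x = 0) :
    ∫ x, (ψ x + lgd i ψ x) = 0 := by
  have hT := isOpen_torus (n := n)
  have hlc : ContinuousOn (lgd i ψ) (torus n) := by
    refine ContinuousOn.mul (by fun_prop) ?_
    exact (h.continuousOn_fderiv_of_isOpen hT le_rfl).clm_apply continuousOn_const
  have h_intl := integrable_of_bound h.continuousOn hC hR
  have h_intr := integrable_of_bound hlc hC' hR'
  have hsT : ∀ s : ℝ, 0 < s → ∀ x ∈ torus n, scaleCoord i s x ∈ torus n := by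
    intro s hs x hx j
    refine mul_ne_zero ?_ (hx j)
    rcases eq_or_ne j i with rfl | hj
    · rw [Function.update_self]; exact hs.ne'
    · rw [Function.update_of_ne hj]; exact one_ne_zero
  have hderiv : ∀ s : ℝ, 0 < s → ∀ x ∈ torus n,
      HasDerivAt (fun s => ψ (scaleCoord i s x)) ((s⁻¹ : ℝ) • lgd i ψ (scaleCoord i s x)) s := by
    intro s hs x hx
    have h1 : HasDerivAt (fun s => scaleCoord i s x) (Pi.single i (x i)) s := by
      rw [hasDerivAt_pi]
      intro j
      rcases eq_or_ne j i with rfl | hj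
      · simpa [scaleCoord] using (hasDerivAt_id s).mul_const (x j)
      · simpa [scaleCoord, Function.update_of_ne hj, hj] using hasDerivAt_const s (x j)
    have h2 : DifferentiableAt ℝ ψ (scaleCoord i s x) :=
      (h.differentiableOn (by simp)).differentiableAt (hT.mem_nhds (hsT s hs x hx))
    refine (h2.hasFDerivAt.comp_hasDerivAt s h1).congr_deriv ?_
    have e : (Pi.single i (x i) : Fin n → ℝ) = x i • Pi.single i 1 := by
      rw [← Pi.single_smul]; simp
    have e2 : scaleCoord i s x i = s * x i := by simp [scaleCoord]
    rw [e, map_smul, lgd, e2]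
    simp only [Complex.real_smul]
    have : (s : ℂ) ≠ 0 := by exact_mod_cast hs.ne'
    push_cast
    field_simp
  have hC0 : 0 ≤ C := by
    have h1 : (1 : Fin n → ℝ) ∈ torus n := fun i => one_ne_zero
    exact (norm_nonneg _).trans (hC 1 h1)
  have key := hasDerivAt_integral_of_dominated_loc_of_deriv_le (μ := volume) (𝕜 := ℝ)
    (F := fun s x => ψ (scaleCoord i s x))
    (F' := fun s x => (s⁻¹ : ℝ) • lgd i ψ (scaleCoord i s x)) (x₀ := 1)
    (s := Set.Ioo (1 / 2) 2) (bound := (Metric.closedBall (0 : Fin n → ℝ) (2 * |R|)).indicator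
      fun _ => 2 * C)
    (Ioo_mem_nhds (by norm_num) (by norm_num)) ?_ ?_ ?_ ?_ ?_ ?_
  · have h1 := key.2
    have h2 : (fun s : ℝ => ∫ x, ψ (scaleCoord i s x)) =ᶠ[𝓝 1]
        fun s => (s⁻¹ : ℝ) • ∫ x, ψ x := by
      filter_upwards [lt_mem_nhds (zero_lt_one (α := ℝ))] with s hs
      exact integral_scaleCoord h_intl.aestronglyMeasurable i hs
    have h3 := h1.congr_of_eventuallyEq h2.symm
    have h4 := ((hasDerivAt_inv (one_ne_zero (α := ℝ))).smul_const (∫ x, ψ x)).unique h3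
    have e : ∀ x : Fin n → ℝ, scaleCoord i 1 x = x := by
      intro x; funext j
      rcases eq_or_ne j i with rfl | hj <;> simp [scaleCoord, Function.update_apply]
    simp only [e, inv_one, one_smul] at h4
    rw [integral_add h_intl h_intr, ← h4]
    simp
  · filter_upwards [lt_mem_nhds (zero_lt_one (α := ℝ))] with s hs
    refine aestronglyMeasurable_of_torus (h.continuousOn.comp ?_ (hsT s hs))
    unfold scaleCoord
    fun_prop
  · have e : ∀ x : Fin n → ℝ, scaleCoord i 1 x = x := by
      intro x; funext j
      rcases eq_or_ne j i with rfl | hj <;> simp [scaleCoord, Function.update_apply]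
    simpa only [e] using h_intl
  · have e : ∀ x : Fin n → ℝ, scaleCoord i 1 x = x := by
      intro x; funext j
      rcases eq_or_ne j i with rfl | hj <;> simp [scaleCoord, Function.update_apply]
    simpa only [e, inv_one, one_smul] using h_intr.aestronglyMeasurable
  · filter_upwards [ae_mem_torus] with x hx s hs
    have hs0 : 0 < s := lt_trans (by norm_num) hs.1
    by_cases hxR : x ∈ Metric.closedBall (0 : Fin n → ℝ) (2 * |R|)
    · rw [Set.indicator_of_mem hxR, norm_smul]
      refine mul_le_mul ?_ (hC' _ (hsT s hs0 x hx)) (norm_nonneg _) (by norm_num)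
      rw [Real.norm_eq_abs, abs_of_pos (inv_pos.2 hs0), inv_le_comm₀ hs0 (by norm_num)]
      exact le_trans (by norm_num) hs.1.le
    · rw [Set.indicator_of_notMem hxR, hR' _ (hsT s hs0 x hx), smul_zero, norm_zero]
      have h1 : 2 * |R| < ‖x‖ := by simpa using hxR
      by_contra hcon
      refine absurd h1 (not_lt.2 ((pi_norm_le_iff_of_nonneg (by positivity)).2 fun j => ?_))
      have h2 := (norm_le_pi_norm (scaleCoord i s x) j).trans
        ((not_lt.1 hcon).trans (le_abs_self R))
      rcases eq_or_ne j i with rfl | hj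
      · have e2 : scaleCoord j s x j = s * x j := by simp [scaleCoord]
        rw [e2, norm_mul, Real.norm_eq_abs, abs_of_pos hs0] at h2
        nlinarith [norm_nonneg (x j), hs.1]
      · have e2 : scaleCoord i s x j = x j := by simp [scaleCoord, Function.update_of_ne hj]
        rw [e2] at h2
        linarith [abs_nonneg R]
  · exact (integrable_indicator_iff Metric.isClosed_closedBall.measurableSet).2
      (integrableOn_const (isCompact_closedBall 0 _).measure_lt_top.ne)
  · filter_upwards [ae_mem_torus] with x hx s hs
    exact hderiv s (lt_trans (by norm_num) hs.1) x hx

end Torus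

section Oscillatory

variable {Γ : Set (Fin n → ℝ)} {S : SimplicialSubdivision n Γ} {δ R : ℝ} {N l : Weight n}
  {ψ χ : (Fin n → ℝ) → ℂ} {F : (Fin n → ℝ) → ℝ}

/-- Symbols vanishing outside a box. -/
def SuppSymb (S : SimplicialSubdivision n Γ) (δ R : ℝ) (N : Weight n)
    (ψ : (Fin n → ℝ) → ℂ) : Prop :=
  Symb S δ N ψ ∧ ∀ x, R < ‖x‖ → ψ x = 0

/-- Weights which are nonnegative on the rays of the subdivision. -/
def WNonneg (S : SimplicialSubdivision n Γ) (N : Weight n) : Prop := ∀ a ∈ sigma1 S, 0 ≤ N a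

theorem lgd_eq_zero_of_norm (h : ∀ x, R < ‖x‖ → ψ x = 0) (i : Fin n) (x : Fin n → ℝ)
    (hx : R < ‖x‖) : lgd i ψ x = 0 := by
  have h1 : ψ =ᶠ[𝓝 x] fun _ => 0 := by
    filter_upwards [(isOpen_lt continuous_const continuous_norm).mem_nhds hx] with y hy
    exact h y hy
  rw [lgd, h1.fderiv_eq]
  simp

theorem mem_torusBox (hδ : 0 < δ) {x : Fin n → ℝ} (hx : x ∈ torus n) (h : ‖x‖ < δ) :
    x ∈ torusBox n δ :=
  fun i => ⟨hx i, (pi_norm_lt_iff hδ).1 h i⟩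

theorem contDiffOn_torus (hδ : 0 < δ) (hR : R < δ) {m : WithTop ℕ∞}
    (h : ContDiffOn ℝ m ψ (torusBox n δ))
    (h0 : ∀ x, R < ‖x‖ → ψ x = 0) : ContDiffOn ℝ m ψ (torus n) := by
  intro x hx
  rcases lt_or_ge ‖x‖ δ with hxδ | hxδ
  · exact (h.contDiffAt ((isOpen_torusBox δ).mem_nhds
      (mem_torusBox hδ hx hxδ))).contDiffWithinAt
  · have h1 : ψ =ᶠ[𝓝 x] fun _ => 0 := by
      filter_upwards [(isOpen_lt continuous_const continuous_norm).mem_nhds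
        (hR.trans_le hxδ)] with y hy
      exact h0 y hy
    exact (contDiffAt_const.congr_of_eventuallyEq h1).contDiffWithinAt

theorem WBound.exists_bound (hδ : δ ≤ 1) (h : WBound S δ N ψ) (hN : WNonneg S N) :
    ∃ C, 0 ≤ C ∧ ∀ x ∈ torusBox n δ, ‖ψ x‖ ≤ C := by
  have := S.fin
  choose C hC0 hC using h
  refine ⟨∑ σ, C σ, Finset.sum_nonneg fun σ _ => hC0 σ, fun x hx => ?_⟩
  obtain ⟨σ, c, hc⟩ := exists_onCell S (fun i => (hx i).1) fun i => ((hx i).2.le.trans hδ)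
  refine (hC σ x hx c hc).trans (le_trans (mul_le_of_le_one_right (hC0 σ) ?_)
    (Finset.single_le_sum (f := C) (fun σ _ => hC0 σ) (Finset.mem_univ σ)))
  rw [Real.exp_le_one_iff, neg_nonpos]
  refine Finset.sum_nonneg fun j _ => mul_nonneg (hc.1 j) ?_
  exact_mod_cast hN _ ⟨σ, j, rfl⟩

namespace SuppSymb

theorem lgd (h : SuppSymb S δ R N ψ) (i : Fin n) : SuppSymb S δ R N (KN.lgd i ψ) :=
  ⟨h.1.lgd i, lgd_eq_zero_of_norm h.2 i⟩

theorem peel (h : SuppSymb S δ R N ψ) {a : Fin n → ℕ} (ha : a ∈ sigma1 S) :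
    SuppSymb S δ R (N + Pi.single a 1) (peelOp N a ψ) :=
  ⟨h.1.peel ha, fun x hx => by simp [peelOp, lgd_eq_zero_of_norm h.2 _ x hx, h.2 x hx]⟩

theorem add (h : SuppSymb S δ R N ψ) (h' : SuppSymb S δ R N χ) :
    SuppSymb S δ R N fun x => ψ x + χ x :=
  ⟨h.1.add h'.1, fun x hx => by simp [h.2 x hx, h'.2 x hx]⟩

theorem const_mul (h : SuppSymb S δ R N ψ) (c : ℂ) : SuppSymb S δ R N fun x => c * ψ x :=
  ⟨h.1.const_mul c, fun x hx => by simp [h.2 x hx]⟩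

theorem sum {κ : Type*} (P : Finset κ) {ψ : κ → (Fin n → ℝ) → ℂ}
    (h : ∀ k ∈ P, SuppSymb S δ R N (ψ k)) : SuppSymb S δ R N fun x => ∑ k ∈ P, ψ k x :=
  ⟨Symb.sum P fun k hk => (h k hk).1, fun x hx => Finset.sum_eq_zero fun k hk => (h k hk).2 x hx⟩

theorem mul (h : Symb S δ l χ) (h' : SuppSymb S δ R N ψ) :
    SuppSymb S δ R (l + N) fun x => χ x * ψ x :=
  ⟨h.mul h'.1, fun x hx => by simp [h'.2 x hx]⟩

theorem anti {N' : Weight n} (h : SuppSymb S δ R N' ψ) (hN : ∀ a ∈ sigma1 S, N a ≤ N' a) :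
    SuppSymb S δ R N ψ :=
  ⟨h.1.anti hN, h.2⟩

end SuppSymb

theorem norm_exp_osc (t y : ℝ) : ‖Complex.exp (Complex.I * t * y)‖ = 1 := by
  rw [mul_assoc, ← Complex.ofReal_mul, mul_comm, Complex.norm_exp_ofReal_mul_I]

theorem contDiffOn_exp_osc (hF : Symb S δ l fun x => (F x : ℂ)) (t : ℝ) :
    ContDiffOn ℝ (⊤ : ℕ∞) (fun x => Complex.exp (Complex.I * t * F x)) (torusBox n δ) :=
  (contDiffOn_const.mul hF.smooth).cexp

theorem SuppSymb.exists_bound (hδ0 : 0 < δ) (hδ : δ ≤ 1) (hR : R < δ)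
    (h : SuppSymb S δ R N ψ) (hN : WNonneg S N) :
    ∃ C, 0 ≤ C ∧ ∀ x ∈ torus n, ‖ψ x‖ ≤ C := by
  obtain ⟨C, hC0, hC⟩ := h.1.wbound.exists_bound hδ hN
  refine ⟨C, hC0, fun x hx => ?_⟩
  rcases lt_or_ge ‖x‖ δ with hxδ | hxδ
  · exact hC x (mem_torusBox hδ0 hx hxδ)
  · rw [h.2 x (hR.trans_le hxδ), norm_zero]; exact hC0

theorem SuppSymb.integrable_osc (hδ0 : 0 < δ) (hδ : δ ≤ 1) (hR : R < δ)
    (hF : Symb S δ l fun x => (F x : ℂ)) (h : SuppSymb S δ R N ψ) (hN : WNonneg S N) (t : ℝ) :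
    Integrable fun x => Complex.exp (Complex.I * t * F x) * ψ x := by
  obtain ⟨C, hC0, hC⟩ := h.exists_bound hδ0 hδ hR hN
  refine integrable_of_bound (C := C) (R := R) ?_ ?_ ?_
  · exact (contDiffOn_torus hδ0 hR ((contDiffOn_exp_osc hF t).mul h.1.smooth)
      fun x hx => by simp [h.2 x hx]).continuousOn
  · intro x hx
    rw [norm_mul, norm_exp_osc, one_mul]
    exact hC x hx
  · intro x _ hx
    rw [h.2 x hx, mul_zero]

theorem oscInt_const_mul (c : ℂ) (t : ℝ) :
    oscInt F (fun x => c * ψ x) t = c * oscInt F ψ t := by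
  rw [oscInt, oscInt, ← integral_const_mul]
  congr 1
  funext x
  ring

theorem SuppSymb.oscInt_add (hδ0 : 0 < δ) (hδ : δ ≤ 1) (hR : R < δ)
    (hF : Symb S δ l fun x => (F x : ℂ)) {N' : Weight n} (h : SuppSymb S δ R N ψ)
    (hN : WNonneg S N) (h' : SuppSymb S δ R N' χ) (hN' : WNonneg S N') (t : ℝ) :
    oscInt F (fun x => ψ x + χ x) t = oscInt F ψ t + oscInt F χ t := by
  rw [oscInt, oscInt, oscInt, ← integral_add (h.integrable_osc hδ0 hδ hR hF hN t)
    (h'.integrable_osc hδ0 hδ hR hF hN' t)]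
  simp only [mul_add]

theorem SuppSymb.oscInt_sum (hδ0 : 0 < δ) (hδ : δ ≤ 1) (hR : R < δ)
    (hF : Symb S δ l fun x => (F x : ℂ)) {κ : Type*} (P : Finset κ) {ψ : κ → (Fin n → ℝ) → ℂ}
    (h : ∀ k ∈ P, SuppSymb S δ R N (ψ k)) (hN : WNonneg S N) (t : ℝ) :
    oscInt F (fun x => ∑ k ∈ P, ψ k x) t = ∑ k ∈ P, oscInt F (ψ k) t := by
  simp only [oscInt, Finset.mul_sum]
  exact integral_finsetSum _ fun k hk => (h k hk).integrable_osc hδ0 hδ hR hF hN t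

theorem oscInt_congr (h : ∀ x ∈ torusBox n δ, ψ x = χ x) (hδ0 : 0 < δ) (hR : R < δ)
    (h1 : ∀ x, R < ‖x‖ → ψ x = 0) (h2 : ∀ x, R < ‖x‖ → χ x = 0) (t : ℝ) :
    oscInt F ψ t = oscInt F χ t := by
  refine integral_congr_ae ?_
  filter_upwards [ae_mem_torus] with x hx
  rcases lt_or_ge ‖x‖ δ with hxδ | hxδ
  · rw [h x (mem_torusBox hδ0 hx hxδ)]
  · rw [h1 x (hR.trans_le hxδ), h2 x (hR.trans_le hxδ)]

/-- Integration by parts in oscillatory integrals. -/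
theorem SuppSymb.oscInt_by_parts (hδ0 : 0 < δ) (hδ : δ ≤ 1) (hR : R < δ)
    (hF : Symb S δ l fun x => (F x : ℂ)) (hl : WNonneg S l) (h : SuppSymb S δ R N ψ)
    (hN : WNonneg S N) (i : Fin n) (t : ℝ) :
    oscInt F (fun x => ψ x + KN.lgd i ψ x) t +
      Complex.I * t * oscInt F (fun x => KN.lgd i (fun x => (F x : ℂ)) x * ψ x) t = 0 := by
  have hm : SuppSymb S δ R (l + N) fun x => KN.lgd i (fun x => (F x : ℂ)) x * ψ x :=
    SuppSymb.mul (hF.lgd i) h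
  have hmN : WNonneg S (l + N) := fun a ha => add_nonneg (hl a ha) (hN a ha)
  set Ψ : (Fin n → ℝ) → ℂ := fun x => Complex.exp (Complex.I * t * F x) * ψ x with hΨ
  have hΨ0 : ∀ x, R < ‖x‖ → Ψ x = 0 := fun x hx => by simp [hΨ, h.2 x hx]
  have hlgd : ∀ x ∈ torus n, KN.lgd i Ψ x = Complex.exp (Complex.I * t * F x) *
      (KN.lgd i ψ x + Complex.I * t * (KN.lgd i (fun x => (F x : ℂ)) x * ψ x)) := by
    intro x hx
    rcases lt_or_ge ‖x‖ δ with hxδ | hxδ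
    · have hxb := mem_torusBox hδ0 hx hxδ
      have hFd : DifferentiableAt ℝ (fun x => Complex.I * t * (F x : ℂ)) x :=
        (hF.differentiableAt hxb).const_mul _
      have he : KN.lgd i (fun x => Complex.exp (Complex.I * t * F x)) x =
          Complex.exp (Complex.I * t * F x) *
            (Complex.I * t * KN.lgd i (fun x => (F x : ℂ)) x) := by
        rw [KN.lgd, hFd.hasFDerivAt.cexp.fderiv, ← lgd_const_mul (hF.differentiableAt hxb), KN.lgd]
        simp only [smul_apply, smul_eq_mul]
        ring
      rw [hΨ, lgd_mul hFd.cexp (h.1.differentiableAt hxb), he]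
      ring
    · have hxR := hR.trans_le hxδ
      rw [lgd_eq_zero_of_norm hΨ0 i x hxR, lgd_eq_zero_of_norm h.2 i x hxR, h.2 x hxR]
      simp
  obtain ⟨C₁, hC₁0, hC₁⟩ := h.exists_bound hδ0 hδ hR hN
  obtain ⟨C₂, hC₂0, hC₂⟩ := (h.lgd i).exists_bound hδ0 hδ hR hN
  obtain ⟨C₃, hC₃0, hC₃⟩ := hm.exists_bound hδ0 hδ hR hmN
  have key := integral_add_lgd_eq_zero (ψ := Ψ) i (C := C₁ + (C₂ + |t| * C₃)) (R := R)
    ((contDiffOn_torus hδ0 hR ((contDiffOn_exp_osc hF t).mul h.1.smooth) hΨ0).of_le (by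
      exact_mod_cast le_top))
    (fun x hx => by
      rw [hΨ, norm_mul, norm_exp_osc, one_mul]
      exact (hC₁ x hx).trans (le_add_of_nonneg_right (by positivity)))
    (fun x hx => by
      rw [hlgd x hx, norm_mul, norm_exp_osc, one_mul]
      refine le_trans (norm_add_le _ _) ?_
      have h1 : ‖Complex.I * t * (KN.lgd i (fun x => (F x : ℂ)) x * ψ x)‖ ≤ |t| * C₃ := by
        rw [norm_mul, norm_mul, Complex.norm_I, one_mul, Complex.norm_real, Real.norm_eq_abs]
        exact mul_le_mul_of_nonneg_left (hC₃ x hx) (abs_nonneg t)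
      linarith [hC₂ x hx])
    (fun x _ hx => hΨ0 x hx) (fun x _ hx => lgd_eq_zero_of_norm hΨ0 i x hx)
  rw [← oscInt_const_mul, ← (h.add (h.lgd i)).oscInt_add hδ0 hδ hR hF hN
    (hm.const_mul _) hmN, ← key]
  refine integral_congr_ae ?_
  filter_upwards [ae_mem_torus] with x hx
  rw [hlgd x hx, hΨ]
  ring

theorem SuppSymb.hasDerivAt_oscInt (hδ0 : 0 < δ) (hδ : δ ≤ 1) (hR : R < δ)
    (hF : Symb S δ l fun x => (F x : ℂ)) (hl : WNonneg S l) (h : SuppSymb S δ R N ψ)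
    (hN : WNonneg S N) (t : ℝ) :
    HasDerivAt (oscInt F ψ) (Complex.I * oscInt F (fun x => (F x : ℂ) * ψ x) t) t := by
  have hm : SuppSymb S δ R (l + N) fun x => (F x : ℂ) * ψ x := SuppSymb.mul hF h
  have hmN : WNonneg S (l + N) := fun a ha => add_nonneg (hl a ha) (hN a ha)
  have hm' := hm.const_mul Complex.I
  rw [← oscInt_const_mul]
  refine (hasDerivAt_integral_of_dominated_loc_of_deriv_le (μ := volume) (𝕜 := ℝ)
    (F := fun t x => Complex.exp (Complex.I * (t : ℝ) * F x) * ψ x)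
    (F' := fun t x => Complex.exp (Complex.I * (t : ℝ) * F x) * (Complex.I * ((F x : ℂ) * ψ x)))
    (x₀ := t) (s := Set.univ) (bound := fun x => ‖(F x : ℂ) * ψ x‖) Filter.univ_mem ?_ ?_ ?_ ?_ ?_
    ?_).2
  · exact .of_forall fun t => (h.integrable_osc hδ0 hδ hR hF hN t).aestronglyMeasurable
  · exact h.integrable_osc hδ0 hδ hR hF hN t
  · exact (hm'.integrable_osc hδ0 hδ hR hF hmN t).aestronglyMeasurable
  · refine .of_forall fun x t _ => ?_
    rw [norm_mul, norm_exp_osc, one_mul, norm_mul Complex.I, Complex.norm_I, one_mul]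
  · have := (hm.integrable_osc hδ0 hδ hR hF hmN 0).norm
    simpa using this
  · refine .of_forall fun x t _ => ?_
    have h1 : HasDerivAt (fun t : ℝ => Complex.I * (t : ℂ) * F x) (Complex.I * 1 * F x) t :=
      ((Complex.ofRealCLM.hasDerivAt (x := t)).const_mul Complex.I).mul_const _
    refine (h1.cexp.mul_const (ψ x)).congr_deriv ?_
    ring

/-- The first order differential equation satisfied by oscillatory integrals. -/
theorem SuppSymb.exists_ode (hδ0 : 0 < δ) (hδ : δ ≤ 1) (hR : R < δ)
    (hF : Symb S δ l fun x => (F x : ℂ)) (hl : WNonneg S l)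
    (he : WElliptic S δ (l + l) fun x => ∑ i, KN.lgd i (fun x => (F x : ℂ)) x *
      KN.lgd i (fun x => (F x : ℂ)) x) (h : SuppSymb S δ R N ψ)
    (hN : WNonneg S N) {a : Fin n → ℕ} (ha : a ∈ sigma1 S) (hla : 0 < l a) :
    ∃ ψ', SuppSymb S δ R (N + Pi.single a 1) ψ' ∧ ∀ t : ℝ,
      t * deriv (oscInt F ψ) t + (((∑ i, (a i : ℝ)) + N a) / l a : ℝ) * oscInt F ψ t =
        oscInt F ψ' t := by
  set G : (Fin n → ℝ) → ℂ := fun x => F x with hG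
  set g : (Fin n → ℝ) → ℂ := fun x => ∑ i, KN.lgd i G x * KN.lgd i G x with hg
  have hgs : Symb S δ (l + l) g := Symb.sum _ fun i _ => (hF.lgd i).mul (hF.lgd i)
  have hP : Symb S δ (l + Pi.single a 1) (peelOp l a G) := hF.peel ha
  set r : Fin n → (Fin n → ℝ) → ℂ := fun i x => (peelOp l a G x * KN.lgd i G x) / g x with hr
  have hrs : ∀ i, Symb S δ (Pi.single a 1) (r i) := fun i =>
    ((hP.mul (hF.lgd i)).div hδ hgs he).anti fun b _ => by
      simp only [Pi.add_apply, Pi.sub_apply]; omega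
  set N' : Weight n := N + Pi.single a 1 with hN'
  have hN'0 : WNonneg S N' := fun b hb => add_nonneg (hN b hb) (by
    by_cases hba : b = a <;> simp [hba])
  have hri : ∀ i, SuppSymb S δ R N' fun x => r i x * ψ x := fun i => by
    have := SuppSymb.mul (hrs i) h
    rwa [add_comm] at this
  have hsum : SuppSymb S δ R N' fun x =>
      ∑ i, (r i x * ψ x + KN.lgd i (fun x => r i x * ψ x) x) :=
    SuppSymb.sum _ fun i _ => (hri i).add ((hri i).lgd i)
  have hpe := (h.peel ha).const_mul (-1)
  refine ⟨fun x => (1 / l a : ℂ) * (-1 * peelOp N a ψ x +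
    ∑ i, (r i x * ψ x + KN.lgd i (fun x => r i x * ψ x) x)), (hpe.add hsum).const_mul _,
    fun t => ?_⟩
  have hlgdF : ∀ i, SuppSymb S δ R (l + N) fun x => KN.lgd i G x * ψ x := fun i =>
    SuppSymb.mul (hF.lgd i) h
  have hlN : WNonneg S (l + N) := fun b hb => add_nonneg (hl b hb) (hN b hb)
  have e1 : ∀ i, oscInt F ψ t + oscInt F (KN.lgd i ψ) t +
      Complex.I * t * oscInt F (fun x => KN.lgd i G x * ψ x) t = 0 := fun i => by
    rw [← h.oscInt_add hδ0 hδ hR hF hN (h.lgd i) hN]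
    exact h.oscInt_by_parts hδ0 hδ hR hF hl hN i t
  have e2 : ∀ i, oscInt F (fun x => r i x * ψ x + KN.lgd i (fun x => r i x * ψ x) x) t +
      Complex.I * t * oscInt F (fun x => KN.lgd i G x * (r i x * ψ x)) t = 0 := fun i =>
    (hri i).oscInt_by_parts hδ0 hδ hR hF hl hN'0 i t
  have hFψ : SuppSymb S δ R (l + N) fun x => G x * ψ x := SuppSymb.mul hF h
  have e3 : ∑ i, (a i : ℂ) * oscInt F (fun x => KN.lgd i G x * ψ x) t =
      l a * oscInt F (fun x => G x * ψ x) t +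
        ∑ i, oscInt F (fun x => KN.lgd i G x * (r i x * ψ x)) t := by
    have hlN' : WNonneg S (l + N') := fun b hb => add_nonneg (hl b hb) (hN'0 b hb)
    have hs1 : ∀ i, SuppSymb S δ R (l + N') fun x => KN.lgd i G x * (r i x * ψ x) := fun i =>
      SuppSymb.mul (hF.lgd i) (hri i)
    rw [← SuppSymb.oscInt_sum hδ0 hδ hR hF _ (fun i _ => hs1 i) hlN', ← oscInt_const_mul,
      ← (hFψ.const_mul _).oscInt_add hδ0 hδ hR hF hlN
        (SuppSymb.sum _ fun i _ => hs1 i) hlN']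
    simp only [← oscInt_const_mul]
    rw [← SuppSymb.oscInt_sum hδ0 hδ hR hF _ (fun i _ => (hlgdF i).const_mul _) hlN]
    refine oscInt_congr (fun x hx => ?_) hδ0 hR (fun x hx => by simp [h.2 x hx])
      (fun x hx => by simp [h.2 x hx]) t
    have hgx : g x ≠ 0 := he.ne_zero hδ hx
    have h1 : ∑ i, KN.lgd i G x * (r i x * ψ x) = peelOp l a G x * ψ x := by
      have : ∀ i, KN.lgd i G x * (r i x * ψ x) =
          peelOp l a G x * ψ x / g x * (KN.lgd i G x * KN.lgd i G x) := fun i => by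
        simp only [hr]; ring
      simp only [this, ← Finset.mul_sum]
      exact div_mul_cancel₀ _ hgx
    rw [h1, peelOp, sub_mul, Finset.sum_mul]
    simp only [mul_assoc]
    ring
  have e4 : oscInt F (peelOp N a ψ) t = ∑ i, (a i : ℂ) * oscInt F (KN.lgd i ψ) t -
      N a * oscInt F ψ t := by
    simp only [← oscInt_const_mul]
    rw [← SuppSymb.oscInt_sum hδ0 hδ hR hF _ (fun i _ => (h.lgd i).const_mul _) hN,
      sub_eq_add_neg, ← neg_one_mul, ← oscInt_const_mul,
      ← (SuppSymb.sum _ fun i _ => (h.lgd i).const_mul _).oscInt_add hδ0 hδ hR hF hN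
        ((h.const_mul _).const_mul _) hN]
    congr 1
    funext x
    simp only [peelOp]
    ring
  rw [oscInt_const_mul, hpe.oscInt_add hδ0 hδ hR hF hN'0 hsum hN'0, oscInt_const_mul, e4,
    SuppSymb.oscInt_sum hδ0 hδ hR hF _ (fun i _ => (hri i).add ((hri i).lgd i)) hN'0,
    (h.hasDerivAt_oscInt hδ0 hδ hR hF hl hN t).deriv]
  have e5 : ∑ i, oscInt F (fun x => r i x * ψ x + KN.lgd i (fun x => r i x * ψ x) x) t =
      -(Complex.I * t * ∑ i, oscInt F (fun x => KN.lgd i G x * (r i x * ψ x)) t) := by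
    rw [Finset.mul_sum, ← Finset.sum_neg_distrib]
    exact Finset.sum_congr rfl fun i _ => eq_neg_of_add_eq_zero_left (e2 i)
  have e6 : (∑ i, (a i : ℂ)) * oscInt F ψ t + ∑ i, (a i : ℂ) * oscInt F (KN.lgd i ψ) t +
      Complex.I * t * ∑ i, (a i : ℂ) * oscInt F (fun x => KN.lgd i G x * ψ x) t = 0 := by
    rw [Finset.sum_mul, Finset.mul_sum, ← Finset.sum_add_distrib, ← Finset.sum_add_distrib]
    refine Finset.sum_eq_zero fun i _ => ?_
    linear_combination (a i : ℂ) * e1 i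
  rw [e3] at e6
  rw [e5]
  have hl0 : (l a : ℂ) ≠ 0 := by exact_mod_cast hla.ne'
  push_cast
  generalize ∑ i, oscInt F (fun x => KN.lgd i G x * (r i x * ψ x)) t = Y at e6 ⊢
  generalize oscInt F (fun x => G x * ψ x) t = Z at e6 ⊢
  generalize ∑ i, (a i : ℂ) * oscInt F (KN.lgd i ψ) t = W at e6 ⊢
  generalize oscInt F ψ t = X at e6 ⊢
  field_simp
  linear_combination e6

theorem SuppSymb.exists_mul_oscInt (hδ0 : 0 < δ) (hδ : δ ≤ 1) (hR : R < δ)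
    (hF : Symb S δ l fun x => (F x : ℂ)) (hl : WNonneg S l)
    (he : WElliptic S δ (l + l) fun x => ∑ i, KN.lgd i (fun x => (F x : ℂ)) x *
      KN.lgd i (fun x => (F x : ℂ)) x) (h : SuppSymb S δ R N ψ)
    (hN : WNonneg S (N - l)) :
    ∃ ψ', SuppSymb S δ R (N - l) ψ' ∧ ∀ t : ℝ, t * oscInt F ψ t = oscInt F ψ' t := by
  set G : (Fin n → ℝ) → ℂ := fun x => F x with hG
  set g : (Fin n → ℝ) → ℂ := fun x => ∑ i, KN.lgd i G x * KN.lgd i G x with hg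
  have hgs : Symb S δ (l + l) g := Symb.sum _ fun i _ => (hF.lgd i).mul (hF.lgd i)
  have hri : ∀ i, SuppSymb S δ R (N - l) fun x => KN.lgd i G x / g x * ψ x := fun i =>
    (SuppSymb.mul ((hF.lgd i).div hδ hgs he) h).anti fun b _ => by
      simp only [Pi.add_apply, Pi.sub_apply]; omega
  have hri' := fun i => (hri i).add ((hri i).lgd i)
  refine ⟨fun x => Complex.I * ∑ i, (KN.lgd i G x / g x * ψ x +
    KN.lgd i (fun x => KN.lgd i G x / g x * ψ x) x),
    (SuppSymb.sum _ fun i _ => hri' i).const_mul _, fun t => ?_⟩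
  have e2 : ∀ i, oscInt F (fun x => KN.lgd i G x / g x * ψ x +
      KN.lgd i (fun x => KN.lgd i G x / g x * ψ x) x) t +
      Complex.I * t * oscInt F (fun x => KN.lgd i G x * (KN.lgd i G x / g x * ψ x)) t = 0 :=
    fun i => (hri i).oscInt_by_parts hδ0 hδ hR hF hl hN i t
  have hlN : WNonneg S (l + (N - l)) := fun b hb => add_nonneg (hl b hb) (hN b hb)
  have hs1 : ∀ i, SuppSymb S δ R (l + (N - l)) fun x =>
      KN.lgd i G x * (KN.lgd i G x / g x * ψ x) := fun i => SuppSymb.mul (hF.lgd i) (hri i)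
  have e3 : oscInt F ψ t = ∑ i, oscInt F (fun x => KN.lgd i G x *
      (KN.lgd i G x / g x * ψ x)) t := by
    rw [← SuppSymb.oscInt_sum hδ0 hδ hR hF _ (fun i _ => hs1 i) hlN]
    refine oscInt_congr (fun x hx => ?_) hδ0 hR h.2 (fun x hx => by simp [h.2 x hx]) t
    have hgx : g x ≠ 0 := he.ne_zero hδ hx
    have : ∀ i, KN.lgd i G x * (KN.lgd i G x / g x * ψ x) =
        ψ x / g x * (KN.lgd i G x * KN.lgd i G x) := fun i => by ring
    simp only [this, ← Finset.mul_sum]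
    exact (div_mul_cancel₀ _ hgx).symm
  rw [oscInt_const_mul, SuppSymb.oscInt_sum hδ0 hδ hR hF _ (fun i _ => hri' i) hN, e3,
    Finset.mul_sum, Finset.mul_sum]
  refine Finset.sum_congr rfl fun i _ => ?_
  have h1 := e2 i
  have h2 := Complex.I_mul_I
  linear_combination (-Complex.I) * h1 +
    t * oscInt F (fun x => KN.lgd i G x * (KN.lgd i G x / g x * ψ x)) t * h2

/-- Decay of oscillatory integrals whose amplitude vanishes to high order. -/
theorem SuppSymb.exists_decay (hδ0 : 0 < δ) (hδ : δ ≤ 1) (hR : R < δ)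
    (hF : Symb S δ l fun x => (F x : ℂ)) (hl : WNonneg S l)
    (he : WElliptic S δ (l + l) fun x => ∑ i, KN.lgd i (fun x => (F x : ℂ)) x *
      KN.lgd i (fun x => (F x : ℂ)) x) (m : ℕ) (h : SuppSymb S δ R N ψ)
    (hN : WNonneg S (N - m • l)) :
    ∃ C : ℝ, ∀ t : ℝ, 0 < t → t ^ m * ‖oscInt F ψ t‖ ≤ C := by
  induction m generalizing N ψ with
  | zero =>
    simp only [zero_smul, sub_zero] at hN
    have hi := h.integrable_osc hδ0 hδ hR hF hN 0
    refine ⟨∫ x, ‖ψ x‖, fun t _ => ?_⟩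
    rw [pow_zero, one_mul]
    refine (norm_integral_le_integral_norm _).trans (le_of_eq ?_)
    simp only [norm_mul, norm_exp_osc, one_mul]
  | succ m ih =>
    have h1 : WNonneg S (N - l - m • l) := by
      have : N - l - m • l = N - (m + 1) • l := by rw [succ_nsmul]; abel
      rwa [this]
    have h2 : WNonneg S (N - l) := fun a ha => by
      have h3 := h1 a ha
      have h4 : 0 ≤ (m • l) a := by
        rw [Pi.smul_apply]; exact nsmul_nonneg (hl a ha) m
      simp only [Pi.sub_apply] at h3 ⊢
      linarith
    obtain ⟨ψ', hψ', e⟩ := h.exists_mul_oscInt hδ0 hδ hR hF hl he h2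
    obtain ⟨C, hC⟩ := ih hψ' h1
    refine ⟨C, fun t ht => ?_⟩
    have := hC t ht
    rw [← e t, norm_mul, Complex.norm_real, Real.norm_eq_abs, abs_of_pos ht, ← mul_assoc,
      ← pow_succ] at this
    exact this

end Oscillatory

/-- The function `t ^ α * (log t) ^ k`. -/
noncomputable def logPow (α : ℝ) (k : ℕ) (t : ℝ) : ℂ :=
  ((t ^ α : ℝ) : ℂ) * ((Real.log t ^ k : ℝ) : ℂ)

/-- Finite linear combinations of `t ^ α * (log t) ^ k` with `k < m α`. -/
noncomputable def logPowSpan (m : ℝ → ℕ) : Submodule ℂ (ℝ → ℂ) :=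
  Submodule.span ℂ ((fun p : ℝ × ℕ => logPow p.1 p.2) '' {p | p.2 < m p.1})

/-- `g` agrees up to `O(t ^ (-M))` with a combination of `t ^ α * (log t) ^ k`, `k < m α`. -/
def ExpandsTo (m : ℝ → ℕ) (M : ℝ) (g : ℝ → ℂ) : Prop :=
  ∃ e ∈ logPowSpan m, ∃ K : ℝ, ∀ t : ℝ, 1 ≤ t → ‖g t - e t‖ ≤ K * t ^ (-M)

theorem logPow_mem_span {m : ℝ → ℕ} {α : ℝ} {k : ℕ} (h : k < m α) :
    logPow α k ∈ logPowSpan m :=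
  Submodule.subset_span ⟨(α, k), h, rfl⟩

theorem logPowSpan_mono {m m' : ℝ → ℕ} (h : ∀ α, m α ≤ m' α) : logPowSpan m ≤ logPowSpan m' :=
  Submodule.span_mono (Set.image_mono fun _ hp => lt_of_lt_of_le hp (h _))

theorem ExpandsTo.of_le {m : ℝ → ℕ} {M M' : ℝ} {g : ℝ → ℂ} (h : ExpandsTo m M g)
    (hM : M' ≤ M) : ExpandsTo m M' g := by
  obtain ⟨e, he, K, hK⟩ := h
  refine ⟨e, he, |K|, fun t ht => (hK t ht).trans ?_⟩
  have h1 : t ^ (-M) ≤ t ^ (-M') := Real.rpow_le_rpow_of_exponent_le ht (by linarith)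
  have h0 : 0 ≤ t ^ (-M) := Real.rpow_nonneg (by linarith) _
  calc K * t ^ (-M) ≤ |K| * t ^ (-M) := by gcongr; exact le_abs_self K
    _ ≤ _ := by gcongr

theorem ExpandsTo.sum {ι : Type*} {m : ℝ → ℕ} {M : ℝ} (s : Finset ι) {g : ι → ℝ → ℂ}
    (h : ∀ i ∈ s, ExpandsTo m M (g i)) : ExpandsTo m M fun t => ∑ i ∈ s, g i t := by
  choose! e he K hK using h
  refine ⟨∑ i ∈ s, e i, Submodule.sum_mem _ he, ∑ i ∈ s, K i, fun t ht => ?_⟩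
  rw [Finset.sum_apply, ← Finset.sum_sub_distrib, Finset.sum_mul]
  exact norm_sum_le_of_le _ fun i hi => hK i hi t ht

theorem hasDerivAt_logPow (α : ℝ) (k : ℕ) {t : ℝ} (ht : 0 < t) :
    HasDerivAt (logPow α k)
      ((α * logPow α k t + k * logPow α (k - 1) t) / t) t := by
  have h1 : HasDerivAt (fun t : ℝ => t ^ α) (α * t ^ (α - 1)) t :=
    Real.hasDerivAt_rpow_const (Or.inl ht.ne')
  have h2 : HasDerivAt (fun t : ℝ => Real.log t ^ k) (k * Real.log t ^ (k - 1) * t⁻¹) t :=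
    (Real.hasDerivAt_log ht.ne').pow k
  have h3 := h1.ofReal_comp.mul h2.ofReal_comp
  refine h3.congr_deriv ?_
  have ht' : (t : ℂ) ≠ 0 := by exact_mod_cast ht.ne'
  rw [Real.rpow_sub_one ht.ne']
  simp only [logPow]
  push_cast
  field_simp

theorem exists_logPow_ode (lam α : ℝ) (k : ℕ) {m' : ℝ → ℕ}
    (h : k + (if α = -lam then 1 else 0) < m' α) :
    ∃ e ∈ logPowSpan m', ∃ e' : ℝ → ℂ, ∀ t : ℝ, 0 < t → HasDerivAt e (e' t) t ∧
      t * e' t + lam * e t = logPow α k t := by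
  by_cases hα : α = -lam
  · rw [if_pos hα] at h
    refine ⟨((k : ℂ) + 1)⁻¹ • logPow α (k + 1), Submodule.smul_mem _ _ (logPow_mem_span h), _,
      fun t ht => ⟨(hasDerivAt_logPow α (k + 1) ht).const_smul _, ?_⟩⟩
    have ht' : (t : ℂ) ≠ 0 := by exact_mod_cast ht.ne'
    have hk : (k : ℂ) + 1 ≠ 0 := by exact_mod_cast k.succ_ne_zero
    rw [hα]
    simp only [Pi.smul_apply, smul_eq_mul, Nat.add_sub_cancel]
    push_cast
    field_simp
    ring
  · have hc : (α : ℂ) + lam ≠ 0 := by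
      intro h0
      apply hα
      have : α + lam = 0 := by exact_mod_cast h0
      linarith
    rw [if_neg hα, add_zero] at h
    induction k with
    | zero =>
      refine ⟨((α : ℂ) + lam)⁻¹ • logPow α 0, Submodule.smul_mem _ _ (logPow_mem_span h), _,
        fun t ht => ⟨(hasDerivAt_logPow α 0 ht).const_smul _, ?_⟩⟩
      have ht' : (t : ℂ) ≠ 0 := by exact_mod_cast ht.ne'
      simp only [Pi.smul_apply, smul_eq_mul, Nat.cast_zero, zero_mul, add_zero]
      field_simp
    | succ k ih =>
      obtain ⟨e, he, e', hee⟩ := ih (by omega)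
      refine ⟨((α : ℂ) + lam)⁻¹ • (logPow α (k + 1) - ((k : ℂ) + 1) • e),
        Submodule.smul_mem _ _ (Submodule.sub_mem _ (logPow_mem_span h)
          (Submodule.smul_mem _ _ he)), _,
        fun t ht => ⟨((hasDerivAt_logPow α (k + 1) ht).sub
          ((hee t ht).1.const_smul _)).const_smul _, ?_⟩⟩
      have ht' : (t : ℂ) ≠ 0 := by exact_mod_cast ht.ne'
      have h2 := (hee t ht).2
      simp only [Pi.smul_apply, Pi.sub_apply, smul_eq_mul, Nat.add_sub_cancel]
      push_cast
      field_simp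
      linear_combination (-((k : ℂ) + 1)) * h2

theorem exists_span_ode (lam : ℝ) {m m' : ℝ → ℕ}
    (hm : ∀ α, m α + (if α = -lam then 1 else 0) ≤ m' α) {p : ℝ → ℂ}
    (hp : p ∈ logPowSpan m) :
    ∃ e ∈ logPowSpan m', ∃ e' : ℝ → ℂ, ∀ t : ℝ, 0 < t → HasDerivAt e (e' t) t ∧
      t * e' t + lam * e t = p t := by
  induction hp using Submodule.span_induction with
  | mem x hx =>
    obtain ⟨⟨α, k⟩, hk, rfl⟩ := hx
    exact exists_logPow_ode lam α k (lt_of_lt_of_le (Nat.add_lt_add_right hk _) (hm α))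
  | zero => exact ⟨0, zero_mem _, fun _ => 0, fun t _ => ⟨hasDerivAt_const t 0, by simp⟩⟩
  | add x y _ _ hx hy =>
    obtain ⟨e, he, e', h⟩ := hx
    obtain ⟨d, hd, d', h'⟩ := hy
    refine ⟨e + d, add_mem he hd, _, fun t ht => ⟨(h t ht).1.add (h' t ht).1, ?_⟩⟩
    rw [Pi.add_apply, Pi.add_apply]
    linear_combination (h t ht).2 + (h' t ht).2
  | smul c x _ hx =>
    obtain ⟨e, he, e', h⟩ := hx
    refine ⟨c • e, Submodule.smul_mem _ _ he, _, fun t ht => ⟨(h t ht).1.const_smul c, ?_⟩⟩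
    simp only [Pi.smul_apply, smul_eq_mul]
    linear_combination c * (h t ht).2

/-- A function whose derivative is `O(t ^ (μ - 1))`, `μ ≠ 0`, is constant up to `O(t ^ μ)`. -/
theorem exists_const_of_deriv_bound {G G' : ℝ → ℂ} {K μ : ℝ} (hμ : μ ≠ 0)
    (hG : ∀ t, 1 ≤ t → HasDerivAt G (G' t) t)
    (hK : ∀ t, 1 ≤ t → ‖G' t‖ ≤ K * t ^ (μ - 1)) :
    ∃ c : ℂ, ∃ K', ∀ t, 1 ≤ t → ‖G t - c‖ ≤ K' * t ^ μ := by
  have hmain : ∀ s t : ℝ, 1 ≤ s → s ≤ t →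
      ‖G t - G s‖ ≤ K * t ^ μ / μ - K * s ^ μ / μ := by
    intro s t hs hst
    refine image_norm_le_of_norm_deriv_right_le_deriv_boundary' (f := fun x => G x - G s)
      (f' := G') (B := fun x => K * x ^ μ / μ - K * s ^ μ / μ)
      (B' := fun x => K * x ^ (μ - 1)) (a := s) (b := t)
      (fun x hx => ((hG x (hs.trans hx.1)).continuousAt.sub
        continuousAt_const).continuousWithinAt)
      (fun x hx => ((hG x (hs.trans hx.1)).sub_const _).hasDerivWithinAt) (by simp)
      (fun x hx => ?_) (fun x hx => ?_) (fun x hx => hK x (hs.trans hx.1)) ⟨hst, le_rfl⟩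
    · have hx0 : x ≠ 0 := by have := hx.1; linarith
      exact (((Real.continuousAt_rpow_const _ _ (Or.inl hx0)).const_mul K).div_const μ
        |>.sub continuousAt_const).continuousWithinAt
    · have hx0 : x ≠ 0 := by have := hx.1; linarith
      refine HasDerivAt.hasDerivWithinAt ?_
      refine ((((Real.hasDerivAt_rpow_const (p := μ) (Or.inl hx0)).const_mul K).div_const μ).sub_const
        _).congr_deriv ?_
      field_simp
  rcases lt_or_gt_of_ne hμ with hneg | hpos
  · have hB : Tendsto (fun t : ℝ => K * t ^ μ / μ) atTop (𝓝 0) := by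
      have := ((tendsto_rpow_neg_atTop (neg_pos.2 hneg)).const_mul K).div_const μ
      simpa using this
    have hcau : Cauchy (map G atTop) := by
      rw [Metric.cauchy_iff]
      refine ⟨inferInstance, fun ε hε => ?_⟩
      have h1 := hB.eventually (Metric.ball_mem_nhds 0 (half_pos hε))
      obtain ⟨T, hT⟩ := eventually_atTop.1 (h1.and (eventually_ge_atTop 1))
      refine ⟨G '' Ici T, image_mem_map (Ici_mem_atTop T), ?_⟩
      have key : ∀ s t, T ≤ s → s ≤ t → dist (G t) (G s) < ε := by
        intro s t hs hst
        have a1 := (hT s hs).1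
        have a2 := (hT t (hs.trans hst)).1
        rw [Real.dist_eq, sub_zero] at a1 a2
        rw [dist_eq_norm]
        refine (hmain s t (hT s hs).2 hst).trans_lt ?_
        linarith [(abs_lt.1 a1).1, (abs_lt.1 a2).2]
      rintro _ ⟨s, hs, rfl⟩ _ ⟨t, ht, rfl⟩
      rcases le_total s t with h | h
      · rw [dist_comm]; exact key s t hs h
      · exact key t s ht h
    obtain ⟨c, hc⟩ := CompleteSpace.complete hcau
    refine ⟨c, -(K / μ), fun t ht => ?_⟩
    have hlim : Tendsto (fun x => ‖G x - G t‖) atTop (𝓝 ‖c - G t‖) :=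
      (Tendsto.sub_const hc _).norm
    have := le_of_tendsto_of_tendsto hlim (hB.sub_const _)
      (eventually_atTop.2 ⟨t, fun x hx => hmain t x ht hx⟩)
    rw [norm_sub_rev]
    refine this.trans (le_of_eq ?_)
    ring
  · refine ⟨0, ‖G 1‖ + |K / μ| + K / μ, fun t ht => ?_⟩
    have h1 := hmain 1 t le_rfl ht
    have h2 : 1 ≤ t ^ μ := Real.one_le_rpow ht hpos.le
    have h3 : ‖G t‖ ≤ ‖G t - G 1‖ + ‖G 1‖ := by
      simpa using norm_add_le (G t - G 1) (G 1)
    rw [sub_zero]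
    have h4 : -(K / μ) ≤ |K / μ| := neg_le_abs _
    rw [Real.one_rpow, mul_one, mul_div_right_comm] at h1
    nlinarith [norm_nonneg (G 1), abs_nonneg (K / μ)]

/-- Solutions of `t g' + λ g = h` inherit an expansion from `h`. -/
theorem ExpandsTo.of_ode {m m' : ℝ → ℕ} {M lam : ℝ} {g g' h : ℝ → ℂ}
    (hh : ExpandsTo m M h) (hM : lam ≠ M)
    (hm : ∀ α, m α + (if α = -lam then 1 else 0) ≤ m' α)
    (hg : ∀ t, 1 ≤ t → HasDerivAt g (g' t) t)
    (hode : ∀ t : ℝ, 1 ≤ t → t * g' t + lam * g t = h t) : ExpandsTo m' M g := by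
  obtain ⟨p, hp, K, hK⟩ := hh
  obtain ⟨e, he, e', hee⟩ := exists_span_ode lam hm hp
  have hd : ∀ t : ℝ, 1 ≤ t → HasDerivAt (fun t => ((t ^ lam : ℝ) : ℂ) * (g t - e t))
      (((t ^ (lam - 1) : ℝ) : ℂ) * (h t - p t)) t := by
    intro t ht
    have ht0 : 0 < t := by linarith
    have ht' : (t : ℂ) ≠ 0 := by exact_mod_cast ht0.ne'
    have h1 := (Real.hasDerivAt_rpow_const (p := lam) (Or.inl ht0.ne')).ofReal_comp
    refine (h1.mul ((hg t ht).sub (hee t ht0).1)).congr_deriv ?_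
    rw [← hode t ht, ← (hee t ht0).2, Real.rpow_sub_one ht0.ne']
    push_cast
    simp only [Pi.sub_apply]
    field_simp
    ring
  obtain ⟨c, K', hc⟩ := exists_const_of_deriv_bound (sub_ne_zero.2 hM) hd (K := K)
    fun t ht => by
      have ht0 : 0 < t := by linarith
      rw [norm_mul, Complex.norm_real, Real.norm_of_nonneg (Real.rpow_nonneg ht0.le _)]
      calc _ ≤ t ^ (lam - 1) * (K * t ^ (-M)) := by gcongr; exact hK t ht
        _ = K * t ^ (lam - M - 1) := by
          rw [mul_left_comm, ← Real.rpow_add ht0]; ring_nf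
  refine ⟨e + c • logPow (-lam) 0, add_mem he (Submodule.smul_mem _ _ (logPow_mem_span ?_)), K',
    fun t ht => ?_⟩
  · have := hm (-lam)
    rw [if_pos rfl] at this
    omega
  · have ht0 : 0 < t := by linarith
    have h1 : g t - (e + c • logPow (-lam) 0) t =
        ((t ^ (-lam) : ℝ) : ℂ) * (((t ^ lam : ℝ) : ℂ) * (g t - e t) - c) := by
      rw [mul_sub, ← mul_assoc, ← Complex.ofReal_mul, ← Real.rpow_add ht0, neg_add_cancel,
        Real.rpow_zero]
      simp [logPow]
      ring
    rw [h1, norm_mul, Complex.norm_real, Real.norm_of_nonneg (Real.rpow_nonneg ht0.le _)]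
    calc _ ≤ t ^ (-lam) * (K' * t ^ (lam - M)) := by gcongr; exact hc t ht
      _ = K' * t ^ (-M) := by rw [mul_left_comm, ← Real.rpow_add ht0]; ring_nf

theorem logPow_eq (α : ℝ) (k : ℕ) (t : ℝ) :
    logPow α k t = ((t ^ α * Real.log t ^ k : ℝ) : ℂ) := by
  simp [logPow]

theorem isLittleO_logPow {α α' : ℝ} {k k' : ℕ} (h : α' < α ∨ α' = α ∧ k' < k) :
    logPow α' k' =o[atTop] logPow α k := by
  have key : (fun t : ℝ => t ^ α' * Real.log t ^ k') =o[atTop]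
      fun t : ℝ => t ^ α * Real.log t ^ k := by
    rcases h with h | ⟨rfl, h⟩
    · have h1 : (fun t : ℝ => Real.log t ^ (k' : ℝ)) =o[atTop] fun t : ℝ => t ^ (α - α') :=
        isLittleO_log_rpow_rpow_atTop _ (sub_pos.2 h)
      have h2 := (Asymptotics.isBigO_refl (fun t : ℝ => t ^ α') atTop).mul_isLittleO h1
      have h3 : (fun t : ℝ => t ^ α' * t ^ (α - α')) =O[atTop]
          fun t : ℝ => t ^ α * Real.log t ^ k := by
        refine Asymptotics.IsBigO.of_bound 1 ?_
        filter_upwards [eventually_ge_atTop (Real.exp 1)] with t ht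
        have ht0 : 0 < t := (Real.exp_pos 1).trans_le ht
        have hl : 1 ≤ Real.log t := (Real.le_log_iff_exp_le ht0).2 ht
        have hk : 1 ≤ Real.log t ^ k := one_le_pow₀ hl
        have ha : 0 ≤ t ^ α := Real.rpow_nonneg ht0.le _
        rw [← Real.rpow_add ht0, add_sub_cancel, one_mul, Real.norm_of_nonneg ha,
          Real.norm_of_nonneg (by positivity)]
        nlinarith
      simpa only [Real.rpow_natCast] using h2.trans_isBigO h3
    · exact (Asymptotics.isBigO_refl (fun t : ℝ => t ^ α') atTop).mul_isLittleO
        ((Asymptotics.isLittleO_pow_pow_atTop_of_lt h).comp_tendsto Real.tendsto_log_atTop)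
  have h1 : ∀ α k, logPow α k = fun t => ((t ^ α * Real.log t ^ k : ℝ) : ℂ) := fun α k =>
    funext (logPow_eq α k)
  rw [h1, h1]
  refine (Asymptotics.isLittleO_norm_norm).1 ?_
  simpa only [Complex.norm_real, Asymptotics.isLittleO_norm_norm] using key

theorem eventually_logPow_ne_zero (α : ℝ) (k : ℕ) : ∀ᶠ t in atTop, logPow α k t ≠ 0 := by
  filter_upwards [eventually_gt_atTop 1] with t ht
  rw [logPow_eq]
  have := Real.log_pos ht
  have := Real.rpow_pos_of_pos (zero_lt_one.trans ht) α
  exact_mod_cast (by positivity)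

/-- Coefficients of a sum of `t ^ α * (log t) ^ k` that is `O(t ^ (-M))` vanish for `α > -M`. -/
theorem coeff_eq_zero_of_isBigO (c : ℝ × ℕ →₀ ℂ) {M : ℝ}
    (h : (fun t => ∑ p ∈ c.support, c p * logPow p.1 p.2 t) =O[atTop] logPow (-M) 0)
    {p : ℝ × ℕ} (hp : -M < p.1) : c p = 0 := by
  by_contra hne
  obtain ⟨q, hq, hmax⟩ := c.support.exists_max_image (fun p => toLex p)
    ⟨p, Finsupp.mem_support_iff.2 hne⟩
  have hqM : -M < q.1 := by
    have := hmax p (Finsupp.mem_support_iff.2 hne)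
    rw [Prod.Lex.toLex_le_toLex] at this
    rcases this with h1 | h1
    · exact hp.trans h1
    · exact hp.trans_eq h1.1
  have h1 : (fun t => ∑ p ∈ c.support, c p * logPow p.1 p.2 t) =o[atTop] logPow q.1 q.2 :=
    h.trans_isLittleO (isLittleO_logPow (Or.inl hqM))
  have h2 : (fun t => ∑ p ∈ c.support.erase q, c p * logPow p.1 p.2 t) =o[atTop]
      logPow q.1 q.2 := by
    refine Asymptotics.IsLittleO.fun_sum fun p' hp' => ?_
    refine (isLittleO_logPow ?_).const_mul_left _
    have hlt : toLex p' < toLex q :=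
      lt_of_le_of_ne (hmax p' (Finset.mem_of_mem_erase hp')) fun he =>
        Finset.ne_of_mem_erase hp' (toLex.injective he)
    exact (Prod.Lex.toLex_lt_toLex).1 hlt
  have h3 : (fun t => c q * logPow q.1 q.2 t) =o[atTop] logPow q.1 q.2 := by
    refine (h1.sub h2).congr_left fun t => ?_
    rw [← Finset.add_sum_erase _ _ hq, add_sub_cancel_right]
  have h4 : logPow q.1 q.2 =o[atTop] logPow q.1 q.2 := by
    have := h3.const_mul_left (c q)⁻¹
    refine this.congr_left fun t => ?_
    rw [inv_mul_cancel_left₀ (Finsupp.mem_support_iff.1 hq)]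
  exact Asymptotics.isLittleO_irrefl (eventually_logPow_ne_zero q.1 q.2).frequently h4

theorem exists_logPow_bound {α M : ℝ} (h : α < -M) (k : ℕ) :
    ∃ K, ∀ t, 1 ≤ t → ‖logPow α k t‖ ≤ K * t ^ (-M) := by
  have hε : 0 < (-M - α) / (k + 1) := div_pos (by linarith) (by positivity)
  set ε := (-M - α) / (k + 1) with hε'
  refine ⟨1 / ε ^ k, fun t ht => ?_⟩
  have ht0 : 0 < t := by linarith
  have h1 : Real.log t ≤ t ^ ε / ε := Real.log_le_rpow_div ht0.le hε
  have h0 := Real.log_nonneg ht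
  have h2 : t ^ α * (t ^ ε) ^ k ≤ t ^ (-M) := by
    rw [← Real.rpow_natCast, ← Real.rpow_mul ht0.le, ← Real.rpow_add ht0]
    refine Real.rpow_le_rpow_of_exponent_le ht ?_
    have : ε * (k + 1) = -M - α := by rw [hε']; field_simp
    nlinarith
  rw [logPow_eq, Complex.norm_real, Real.norm_of_nonneg (by positivity)]
  calc t ^ α * Real.log t ^ k ≤ t ^ α * (t ^ ε / ε) ^ k := by gcongr
    _ = 1 / ε ^ k * (t ^ α * (t ^ ε) ^ k) := by rw [div_pow]; ring
    _ ≤ _ := by gcongr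

/-- Expansions to arbitrarily high order assemble to an asymptotic expansion. -/
theorem exists_hasAsympExpansion {m : ℝ → ℕ} {g : ℝ → ℂ} {E : Set ℝ} (hm : ∀ α, m α ≤ n)
    (hE : ∀ α, 0 < m α → α ∈ E) (h : ∀ M, ExpandsTo m M g) :
    ∃ C, HasAsympExpansion n g E C := by
  have h' : ∀ M : ℝ, ∃ c : ℝ × ℕ →₀ ℂ, (∀ p, c p ≠ 0 → p.2 < m p.1) ∧ ∃ K, ∀ t, 1 ≤ t →
      ‖g t - ∑ p ∈ c.support, c p * logPow p.1 p.2 t‖ ≤ K * t ^ (-M) := by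
    intro M
    obtain ⟨e, he, K, hK⟩ := h M
    obtain ⟨c, hc, rfl⟩ := (Finsupp.mem_span_image_iff_linearCombination ℂ).1 he
    refine ⟨c, fun p hp => hc (Finsupp.mem_support_iff.2 hp), K, fun t ht => ?_⟩
    convert hK t ht using 3
    simp [Finsupp.linearCombination_apply, Finsupp.sum, Finset.sum_apply]
  choose c hcm K hK using h'
  have huniq : ∀ M M' p, M ≤ M' → -M < p.1 → c M p = c M' p := by
    intro M M' p hMM hp
    rw [← sub_eq_zero, ← Finsupp.sub_apply]
    refine coeff_eq_zero_of_isBigO (c M - c M') (M := M) ?_ hp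
    refine Asymptotics.IsBigO.of_bound (|K M| + |K M'|) ?_
    filter_upwards [eventually_ge_atTop 1] with t ht
    have ht0 : 0 < t := by linarith
    have e1 : ∑ p ∈ (c M - c M').support, (c M - c M') p * logPow p.1 p.2 t =
        (g t - ∑ p ∈ (c M').support, c M' p * logPow p.1 p.2 t) -
          (g t - ∑ p ∈ (c M).support, c M p * logPow p.1 p.2 t) := by
      have := Finsupp.sum_sub_index (f := c M) (g := c M')
        (h := fun p a => a * logPow p.1 p.2 t) (fun p a b => sub_mul _ _ _)
      simp only [Finsupp.sum] at this
      rw [this]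
      ring
    have hle : t ^ (-M') ≤ t ^ (-M) := Real.rpow_le_rpow_of_exponent_le ht (by linarith)
    have h0 : 0 ≤ t ^ (-M') := Real.rpow_nonneg ht0.le _
    rw [e1, logPow_eq, Complex.norm_real, pow_zero, mul_one,
      Real.norm_of_nonneg (Real.rpow_nonneg ht0.le _)]
    calc _ ≤ K M' * t ^ (-M') + K M * t ^ (-M) :=
          (norm_sub_le _ _).trans (add_le_add (hK M' t ht) (hK M t ht))
      _ ≤ |K M'| * t ^ (-M) + |K M| * t ^ (-M) := by
          gcongr
          · exact le_abs_self _
          · exact le_abs_self _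
      _ = _ := by ring
  refine ⟨fun α k => if 1 ≤ k then c (1 - α) (α, k - 1) else 0, fun α k hk => ?_, fun M => ?_⟩
  · beta_reduce at hk
    by_cases h1 : 1 ≤ k
    · rw [if_pos h1] at hk
      have : k - 1 < m α := hcm _ _ hk
      have := hm α
      refine ⟨hE α ?_, h1, ?_⟩ <;> omega
    · rw [if_neg h1] at hk
      exact absurd rfl hk
  · set d := c (M + 1) with hd
    set A : Finset ℝ := d.support.image Prod.fst with hA
    set T : ℝ → ℝ → ℂ := fun t α => ∑ k ∈ Finset.range n, d (α, k) * logPow α k t with hT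
    have hsum : ∀ t, ∑ p ∈ d.support, d p * logPow p.1 p.2 t = ∑ α ∈ A, T t α := by
      intro t
      rw [hT, ← Finset.sum_product' (f := fun α k => d (α, k) * logPow α k t)]
      refine Finset.sum_subset (fun p hp => ?_) fun p _ hp => ?_
      · rw [Finset.mem_product, Finset.mem_range]
        have h1 := hcm _ _ (Finsupp.mem_support_iff.1 hp)
        exact ⟨Finset.mem_image_of_mem _ hp, h1.trans_le (hm _)⟩
      · rw [Finsupp.notMem_support_iff.1 hp, zero_mul]
    have hpart : ∀ t, partialSum n E (fun α k => if 1 ≤ k then c (1 - α) (α, k - 1) else 0) M t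
        = ∑ α ∈ A.filter (fun α => -M ≤ α), T t α := by
      intro t
      have hTeq : ∀ α, -M ≤ α → ∑ k ∈ Finset.Icc 1 n,
          (if 1 ≤ k then c (1 - α) (α, k - 1) else 0) * ((t ^ α : ℝ) : ℂ) *
            (((Real.log t) ^ (k - 1) : ℝ) : ℂ) = T t α := by
        intro α hα
        rw [hT, Finset.range_eq_Ico]
        change _ = ∑ k ∈ Finset.Ico 0 n, _
        have := Finset.sum_Ico_add' (fun k => (if 1 ≤ k then c (1 - α) (α, k - 1) else 0) *
          ((t ^ α : ℝ) : ℂ) * (((Real.log t) ^ (k - 1) : ℝ) : ℂ)) 0 n 1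
        rw [zero_add] at this
        have hI : Finset.Icc 1 n = Finset.Ico 1 (n + 1) := by
          ext k; simp only [Finset.mem_Icc, Finset.mem_Ico]; omega
        rw [hI, ← this]
        refine Finset.sum_congr rfl fun k _ => ?_
        rw [if_pos (by omega), Nat.add_sub_cancel, mul_assoc,
          huniq (1 - α) (M + 1) (α, k) (by linarith) (by simp only; linarith), logPow]
      rw [partialSum, finsum_mem_congr rfl fun α hα => hTeq α hα.2]
      refine finsum_mem_eq_sum_of_inter_support_eq _ ?_
      ext α
      simp only [Set.mem_inter_iff, Finset.coe_filter, Function.mem_support]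
      refine and_congr_left fun hα => ?_
      obtain ⟨k, _, hk⟩ := Finset.exists_ne_zero_of_sum_ne_zero hα
      have hk' : d (α, k) ≠ 0 := left_ne_zero_of_mul hk
      have hEα : α ∈ E := hE α (Nat.zero_lt_of_lt (hcm _ _ hk'))
      have hAα : α ∈ A := Finset.mem_image.2 ⟨(α, k), Finsupp.mem_support_iff.2 hk', rfl⟩
      exact ⟨fun h => ⟨hAα, h.2⟩, fun h => ⟨hEα, h.2⟩⟩
    have hrest : ∃ L, ∀ t, 1 ≤ t →
        ‖∑ α ∈ A.filter (fun α => ¬ -M ≤ α), T t α‖ ≤ L * t ^ (-M) := by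
      have h1 : ∀ α ∈ A.filter (fun α => ¬ -M ≤ α), ∀ k ∈ Finset.range n,
          ∃ L, ∀ t, 1 ≤ t → ‖d (α, k) * logPow α k t‖ ≤ L * t ^ (-M) := by
        intro α hα k _
        obtain ⟨L, hL⟩ := exists_logPow_bound (not_le.1 (Finset.mem_filter.1 hα).2) k
        refine ⟨‖d (α, k)‖ * L, fun t ht => ?_⟩
        rw [norm_mul, mul_assoc]
        exact mul_le_mul_of_nonneg_left (hL t ht) (norm_nonneg _)
      choose! L hL using h1
      refine ⟨∑ α ∈ A.filter (fun α => ¬ -M ≤ α), ∑ k ∈ Finset.range n, L α k,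
        fun t ht => ?_⟩
      simp only [Finset.sum_mul]
      exact norm_sum_le_of_le _ fun α hα => norm_sum_le_of_le _ fun k hk => hL α hα k hk t ht
    obtain ⟨L, hL⟩ := hrest
    refine ⟨|K (M + 1)| + L, fun t ht => ?_⟩
    have ht1 : 1 ≤ t := by linarith
    have h1 := hK (M + 1) t ht1
    rw [← hd, hsum, ← Finset.sum_filter_add_sum_filter_not A (fun α => -M ≤ α)] at h1
    rw [hpart]
    have hle : t ^ (-(M + 1)) ≤ t ^ (-M) :=
      Real.rpow_le_rpow_of_exponent_le ht1 (by linarith)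
    have h0 : 0 ≤ t ^ (-(M + 1)) := Real.rpow_nonneg (by linarith) _
    have h2 : K (M + 1) * t ^ (-(M + 1)) ≤ |K (M + 1)| * t ^ (-M) :=
      (mul_le_mul_of_nonneg_right (le_abs_self _) h0).trans
        (mul_le_mul_of_nonneg_left hle (abs_nonneg _))
    calc _ = ‖(g t - (∑ α ∈ A.filter (fun α => -M ≤ α), T t α +
          ∑ α ∈ A.filter (fun α => ¬ -M ≤ α), T t α)) +
          ∑ α ∈ A.filter (fun α => ¬ -M ≤ α), T t α‖ := by congr 1; ring
      _ ≤ _ := (norm_add_le _ _).trans (add_le_add (h1.trans h2) (hL t ht1))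
      _ = _ := by ring

theorem ExpandsTo.mono {m m' : ℝ → ℕ} {M : ℝ} {g : ℝ → ℂ} (h : ExpandsTo m M g)
    (hm : ∀ α, m α ≤ m' α) : ExpandsTo m' M g := by
  obtain ⟨e, he, hK⟩ := h
  exact ⟨e, logPowSpan_mono hm he, hK⟩

section CellExpansion

variable {Γ : Set (Fin n → ℝ)} {S : SimplicialSubdivision n Γ} {δ R : ℝ} {N l : Weight n}
  {ψ : (Fin n → ℝ) → ℂ} {F : (Fin n → ℝ) → ℝ}

open Classical in
/-- The number of rays of the cone `σ` which can contribute to the exponent `α` for an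
amplitude of weight `N`. -/
noncomputable def cellMult (S : SimplicialSubdivision n Γ) (l : Weight n) (σ : S.ι)
    (N : Weight n) (α : ℝ) : ℕ :=
  (Finset.univ.filter fun j : Fin n => 0 < l (S.gen σ j) ∧ ∃ ν : ℕ, N (S.gen σ j) ≤ ν ∧
    α = -((∑ i, (S.gen σ j i : ℝ)) + ν) / l (S.gen σ j)).card

theorem cellMult_le (σ : S.ι) (α : ℝ) : cellMult S l σ N α ≤ n :=
  (Finset.card_le_univ _).trans_eq (Fintype.card_fin n)

theorem cellMult_add_single_le (σ : S.ι) (hN : WNonneg S N) {j : Fin n}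
    (hl : 0 < l (S.gen σ j)) (α : ℝ) :
    cellMult S l σ (N + Pi.single (S.gen σ j) 1) α +
      (if α = -(((∑ i, (S.gen σ j i : ℝ)) + N (S.gen σ j)) / l (S.gen σ j)) then 1 else 0) ≤
      cellMult S l σ N α := by
  classical
  have hle : ∀ a, N a ≤ (N + Pi.single (S.gen σ j) 1 : Weight n) a := fun a => by
    rw [Pi.add_apply]
    have : (0 : ℤ) ≤ (Pi.single (S.gen σ j) 1 : Weight n) a := by
      by_cases h : a = S.gen σ j <;> simp [h]
    omega
  have hsub : (Finset.univ.filter fun k : Fin n => 0 < l (S.gen σ k) ∧ ∃ ν : ℕ,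
      (N + Pi.single (S.gen σ j) 1 : Weight n) (S.gen σ k) ≤ ν ∧
        α = -((∑ i, (S.gen σ k i : ℝ)) + ν) / l (S.gen σ k)) ⊆
      Finset.univ.filter fun k : Fin n => 0 < l (S.gen σ k) ∧ ∃ ν : ℕ, N (S.gen σ k) ≤ ν ∧
        α = -((∑ i, (S.gen σ k i : ℝ)) + ν) / l (S.gen σ k) := by
    intro k hk
    simp only [Finset.mem_filter, Finset.mem_univ, true_and] at hk ⊢
    obtain ⟨h0, ν, h1, h2⟩ := hk
    exact ⟨h0, ν, (hle _).trans h1, h2⟩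
  unfold cellMult
  split_ifs with hα
  · refine Nat.succ_le_of_lt (Finset.card_lt_card (Finset.ssubset_iff_subset_ne.2 ⟨hsub, ?_⟩))
    intro heq
    have hl' : (l (S.gen σ j) : ℝ) ≠ 0 := by exact_mod_cast hl.ne'
    have hj : j ∈ Finset.univ.filter fun k : Fin n => 0 < l (S.gen σ k) ∧ ∃ ν : ℕ,
        N (S.gen σ k) ≤ ν ∧ α = -((∑ i, (S.gen σ k i : ℝ)) + ν) / l (S.gen σ k) := by
      simp only [Finset.mem_filter, Finset.mem_univ, true_and]
      obtain ⟨ν, hν⟩ := Int.eq_ofNat_of_zero_le (hN _ ⟨σ, j, rfl⟩)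
      refine ⟨hl, ν, hν.le, ?_⟩
      rw [hα, hν]
      push_cast
      ring
    rw [← heq] at hj
    simp only [Finset.mem_filter, Finset.mem_univ, true_and, Pi.add_apply,
      Pi.single_eq_same] at hj
    obtain ⟨_, ν, h1, h2⟩ := hj
    rw [hα] at h2
    field_simp at h2
    have h3 : (N (S.gen σ j) : ℝ) = ν := by linarith
    have h4 : N (S.gen σ j) = ν := by exact_mod_cast h3
    omega
  · exact Finset.card_le_card hsub

theorem SuppSymb.expandsTo_cell (hδ0 : 0 < δ) (hδ : δ ≤ 1) (hR : R < δ)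
    (hF : Symb S δ l fun x => (F x : ℂ)) (hl : WNonneg S l)
    (he : WElliptic S δ (l + l) fun x => ∑ i, KN.lgd i (fun x => (F x : ℂ)) x *
      KN.lgd i (fun x => (F x : ℂ)) x) (σ : S.ι) {m : ℕ} {K : ℤ}
    (hK : ∀ a ∈ sigma1 S, m * l a ≤ K) {M : ℝ} (hM : Irrational M) (hMm : M ≤ m)
    (h : SuppSymb S δ R N ψ) (hN : WNonneg S N)
    (hoff : ∀ a ∈ sigma1 S, a ∉ Set.range (S.gen σ) → K ≤ N a) :
    ExpandsTo (cellMult S l σ N) M (oscInt F ψ) := by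
  induction hs : ∑ j, (if 0 < l (S.gen σ j) then (K - N (S.gen σ j)).toNat else 0) using
    Nat.strong_induction_on generalizing N ψ with
  | _ s ih =>
  by_cases hj : ∃ j, 0 < l (S.gen σ j) ∧ N (S.gen σ j) < K
  · obtain ⟨j, hlj, hNj⟩ := hj
    obtain ⟨ψ', hψ', hode⟩ := h.exists_ode hδ0 hδ hR hF hl he hN ⟨σ, j, rfl⟩ hlj
    have hle : ∀ a, N a ≤ (N + Pi.single (S.gen σ j) 1 : Weight n) a := fun a => by
      rw [Pi.add_apply]
      have : (0 : ℤ) ≤ (Pi.single (S.gen σ j) 1 : Weight n) a := by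
        by_cases h : a = S.gen σ j <;> simp [h]
      omega
    have hlt : ∑ k, (if 0 < l (S.gen σ k) then
        (K - (N + Pi.single (S.gen σ j) 1 : Weight n) (S.gen σ k)).toNat else 0) < s := by
      rw [← hs]
      refine Finset.sum_lt_sum (fun k _ => ?_) ⟨j, Finset.mem_univ _, ?_⟩
      · have := hle (S.gen σ k)
        split_ifs <;> omega
      · rw [if_pos hlj, if_pos hlj, Pi.add_apply, Pi.single_eq_same]
        omega
    have hexp := ih _ hlt hψ' (fun a ha => (hN a ha).trans (hle a))
      (fun a ha hr => (hoff a ha hr).trans (hle a)) rfl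
    refine hexp.of_ode (g' := deriv (oscInt F ψ)) ?_ (cellMult_add_single_le σ hN hlj)
      (fun t _ => ?_) fun t _ => hode t
    · rintro rfl
      refine hM ⟨((∑ i, (S.gen σ j i : ℚ)) + N (S.gen σ j)) / l (S.gen σ j), ?_⟩
      push_cast
      rfl
    · have := h.hasDerivAt_oscInt hδ0 hδ hR hF hl hN t
      rwa [← this.deriv] at this
  · push Not at hj
    have hdec : WNonneg S (N - m • l) := by
      intro a ha
      have h1 := hK a ha
      have h2 := hN a ha
      have h3 := hl a ha
      have hval : (N - m • l) a = N a - m * l a := by simp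
      rw [hval]
      by_cases hr : a ∈ Set.range (S.gen σ)
      · obtain ⟨j, rfl⟩ := hr
        rcases h3.eq_or_lt with h4 | h4
        · rw [← h4, mul_zero]; omega
        · have := hj j h4; omega
      · have := hoff a ha hr; omega
    obtain ⟨C, hC⟩ := h.exists_decay hδ0 hδ hR hF hl he m hdec
    refine ExpandsTo.of_le (M := m) ⟨0, zero_mem _, C, fun t ht => ?_⟩ hMm
    have ht0 : 0 < t := by linarith
    rw [Pi.zero_apply, sub_zero, Real.rpow_neg ht0.le, Real.rpow_natCast,
      ← div_eq_mul_inv, le_div_iff₀ (pow_pos ht0 m), mul_comm]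
    exact hC t ht0

open Classical in
theorem SuppSymb.expandsTo (hδ0 : 0 < δ) (hδ : δ ≤ 1) (hR : R < δ)
    (hF : Symb S δ l fun x => (F x : ℂ)) (hl : WNonneg S l)
    (he : WElliptic S δ (l + l) fun x => ∑ i, KN.lgd i (fun x => (F x : ℂ)) x *
      KN.lgd i (fun x => (F x : ℂ)) x) (h : SuppSymb S δ R 0 ψ) {E : Set ℝ}
    (hE : ∀ a ∈ sigma1 S, 0 < l a → ∀ ν : ℕ, -((∑ i, (a i : ℝ)) + ν) / l a ∈ E) (M : ℝ) :
    ExpandsTo (fun α => if α ∈ E then n else 0) M (oscInt F ψ) := by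
  let := S.fin
  obtain ⟨χ, hχ, hχ1⟩ := exists_partition S hδ
  obtain ⟨M', hM', hMM', -⟩ := exists_irrational_btwn (lt_add_one M)
  refine ExpandsTo.of_le ?_ hMM'.le
  obtain ⟨K', hK'⟩ := ((finite_sigma1 S).image fun a => (⌈M'⌉₊ : ℤ) * l a).bddAbove
  set K := max K' 0
  have hK : ∀ a ∈ sigma1 S, (⌈M'⌉₊ : ℤ) * l a ≤ K := fun a ha =>
    (hK' (Set.mem_image_of_mem _ ha)).trans (le_max_left _ _)
  set N : S.ι → Weight n := fun σ a => if a ∈ Set.range (S.gen σ) then 0 else K with hNdef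
  have hN : ∀ σ, WNonneg S (N σ) := fun σ a _ => by
    simp only [hNdef]
    split_ifs
    · exact le_rfl
    · exact le_max_right _ _
  have hs : ∀ σ, SuppSymb S δ R (N σ) fun x => χ σ x * ψ x := fun σ => by
    have := SuppSymb.mul (hχ σ (N σ) fun j => by simp [hNdef]) h
    rwa [add_zero] at this
  have h0 : WNonneg S 0 := fun _ _ => le_rfl
  have hsum : oscInt F ψ = fun t => ∑ σ, oscInt F (fun x => χ σ x * ψ x) t := by
    funext t
    have hs0 : ∀ σ ∈ Finset.univ, SuppSymb S δ R 0 fun x => χ σ x * ψ x := fun σ _ =>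
      (hs σ).anti fun a ha => hN σ a ha
    rw [← SuppSymb.oscInt_sum hδ0 hδ hR hF Finset.univ hs0 h0]
    refine oscInt_congr (fun x hx => ?_) hδ0 hR h.2 (fun x hx => by simp [h.2 x hx]) t
    rw [← Finset.sum_mul, hχ1 x hx, one_mul]
  rw [hsum]
  refine ExpandsTo.sum _ fun σ _ => ?_
  refine ((hs σ).expandsTo_cell hδ0 hδ hR hF hl he σ hK hM' (Nat.le_ceil M') (hN σ)
    fun a _ hr => by simp only [hNdef, if_neg hr, le_refl]).mono fun α => ?_
  split_ifs with hα
  · exact cellMult_le σ α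
  · refine (Finset.card_eq_zero.2 (Finset.filter_eq_empty_iff.2 ?_)).le
    rintro j - ⟨hl0, ν, -, rfl⟩
    exact hα (hE _ ⟨σ, j, rfl⟩ hl0 ν)

end CellExpansion

theorem lgd_ofReal {F : (Fin n → ℝ) → ℝ} (hF : Differentiable ℝ F) (i : Fin n)
    (x : Fin n → ℝ) : lgd i (fun x => (F x : ℂ)) x = ((x i * pderiv1 i F x : ℝ) : ℂ) := by
  have h : HasFDerivAt (fun x => (F x : ℂ)) (Complex.ofRealCLM.comp (fderiv ℝ F x)) x :=
    Complex.ofRealCLM.hasFDerivAt.comp x (hF x).hasFDerivAt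
  simp [lgd, h.fderiv, pderiv1]

theorem symb_phase {F : (Fin n → ℝ) → ℝ} (hF : ContDiff ℝ (⊤ : ℕ∞) F) {δ δ' : ℝ}
    (hδ : δ' ≤ δ)
    (hlim : ∀ x : Fin n → ℝ, (∀ i, |x i| < δ) → ∀ a : Fin n → ℕ,
      ∃ c : ℝ, Tendsto (fun t : ℝ => F (scaleAction a t x) / t ^ lnat F a) (𝓝[>] (0:ℝ)) (𝓝 c))
    {Γ : Set (Fin n → ℝ)} (S : SimplicialSubdivision n Γ) :
    Symb S δ' (fun a => (lnat F a : ℤ)) fun x => (F x : ℂ) := by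
  obtain ⟨N, κ, _, p, g, P, -, hg, -, hP, -, hFx⟩ :=
    good_expansion hF hlim (finite_sigma1 S).toFinset 0
  have h1 : Symb S δ' (fun a => (lnat F a : ℤ)) fun x =>
      ∑ k ∈ P, (mono (p k) x : ℂ) * (g k x : ℂ) := by
    refine Symb.sum P fun k hk => symb_mono_mul (p k)
      (Complex.ofRealCLM.contDiff.comp (hg k)) fun a ha => ?_
    exact_mod_cast (hP k).1 hk a ((finite_sigma1 S).mem_toFinset.2 ha)
  refine h1.congr fun x hx => ?_
  simp only [hFx x fun i => (hx i).2.trans_le hδ]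
  push_cast
  rfl

theorem wElliptic_phase {F : (Fin n → ℝ) → ℝ} (hF : Differentiable ℝ F) {δ c : ℝ}
    (hc : 0 < c)
    (h : ∀ x ∈ torusBox n δ, ∀ q, taylorCoeff F q ≠ 0 →
      c * mono q x ^ 2 ≤ ∑ i, (x i * pderiv1 i F x) ^ 2)
    (S : SimplicialSubdivision n (NewtonPolyhedron F)) :
    WElliptic S δ ((fun a => (lnat F a : ℤ)) + fun a => (lnat F a : ℤ)) fun x =>
      ∑ i, lgd i (fun x => (F x : ℂ)) x * lgd i (fun x => (F x : ℂ)) x := by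
  intro σ
  obtain ⟨q, hq, hql⟩ := exists_dotN_gen_eq_lnat S σ
  refine ⟨c, hc, fun x hx d hd => ?_⟩
  have h1 : ∑ i, lgd i (fun x => (F x : ℂ)) x * lgd i (fun x => (F x : ℂ)) x =
      ((∑ i, (x i * pderiv1 i F x) ^ 2 : ℝ) : ℂ) := by
    simp only [lgd_ofReal hF, sq, Complex.ofReal_sum, Complex.ofReal_mul]
  have h2 := h x hx q hq
  rw [← sq_abs, abs_mono_of_onCell hd q, ← Real.exp_nat_mul] at h2
  beta_reduce
  rw [h1, Complex.norm_real, Real.norm_of_nonneg (Finset.sum_nonneg fun i _ => sq_nonneg _)]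
  refine le_trans (le_of_eq ?_) h2
  congr 2
  simp only [hql, Pi.add_apply]
  push_cast
  rw [mul_neg, Finset.mul_sum]
  congr 1
  exact Finset.sum_congr rfl fun j _ => by ring

open Classical in
/-- The asymptotic expansion for a globally smooth phase. -/
theorem exists_expansion_smooth {F : (Fin n → ℝ) → ℝ} (hF : ContDiff ℝ (⊤ : ℕ∞) F) {δ : ℝ}
    (hδ : 0 < δ)
    (hlim : ∀ x : Fin n → ℝ, (∀ i, |x i| < δ) → ∀ a : Fin n → ℕ,
      ∃ c : ℝ, Tendsto (fun t : ℝ => F (scaleAction a t x) / t ^ lnat F a) (𝓝[>] (0:ℝ)) (𝓝 c))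
    (hnd : Nondegenerate F {x | ∀ i, |x i| < δ}) (hΓ : (NewtonPolyhedron F).Nonempty) :
    ∃ R > 0, ∀ φ : (Fin n → ℝ) → ℂ, ContDiff ℝ (⊤ : ℕ∞) φ → (∀ x, R < ‖x‖ → φ x = 0) →
      ∀ S : SimplicialSubdivision n (NewtonPolyhedron F),
        ∃ C, HasAsympExpansion n (oscInt F φ) (expSet (NewtonPolyhedron F) S) C := by
  by_cases hS : Nonempty (SimplicialSubdivision n (NewtonPolyhedron F))
  · obtain ⟨S₀⟩ := hS
    obtain ⟨δ₁, hδ₁, c, hc, hni⟩ := exists_nondeg_inequality hF hδ hlim hnd S₀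
    set δ' := min δ₁ (min δ 1) with hδ'def
    have hδ'0 : 0 < δ' := lt_min hδ₁ (lt_min hδ one_pos)
    have hδ'1 : δ' ≤ 1 := (min_le_right _ _).trans (min_le_right _ _)
    have hδ'δ : δ' ≤ δ := (min_le_right _ _).trans (min_le_left _ _)
    refine ⟨δ' / 2, half_pos hδ'0, fun φ hφ hsupp S => ?_⟩
    have hsymb : SuppSymb S δ' (δ' / 2) 0 φ := ⟨symb_of_contDiff hφ, hsupp⟩
    refine exists_hasAsympExpansion
      (m := fun α => if α ∈ expSet (NewtonPolyhedron F) S then n else 0) (fun α => ?_)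
      (fun α hα => ?_) fun M => ?_
    · split_ifs <;> omega
    · by_contra h
      simp [h] at hα
    · refine hsymb.expandsTo hδ'0 hδ'1 (half_lt_self hδ'0) (symb_phase hF hδ'δ hlim S)
        (fun a _ => Int.natCast_nonneg _)
        (wElliptic_phase (hF.differentiable (by simp)) hc (fun x hx => hni x fun i =>
          ⟨(hx i).1, (hx i).2.trans_le (min_le_left _ _)⟩) S) (fun a ha hl ν => ?_) M
      refine Or.inl ⟨a, ha, ?_, ν, ?_⟩
      · rw [lval_newton hΓ]
        exact_mod_cast hl
      · rw [lval_newton hΓ, Int.cast_natCast]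
  · exact ⟨1, one_pos, fun φ _ _ S => absurd ⟨S⟩ hS⟩

/-- A smooth function on a neighbourhood of a point agrees near that point with a globally
smooth one. -/
theorem exists_contDiff_eqOn_ball {U : Set (Fin n → ℝ)} (hU : IsOpen U)
    (hU0 : (0 : Fin n → ℝ) ∈ U) {f : (Fin n → ℝ) → ℝ} (hf : ContDiffOn ℝ (⊤ : ℕ∞) f U) :
    ∃ F : (Fin n → ℝ) → ℝ, ContDiff ℝ (⊤ : ℕ∞) F ∧ ∃ δ > 0, Metric.ball 0 δ ⊆ U ∧
      EqOn F f (Metric.ball 0 δ) := by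
  obtain ⟨r, hr, hrU⟩ := Metric.nhds_basis_closedBall.mem_iff.1 (hU.mem_nhds hU0)
  let χ : ContDiffBump (0 : Fin n → ℝ) := ⟨r / 2, r, half_pos hr, half_lt_self hr⟩
  refine ⟨fun x => χ x * f x, contDiff_iff_contDiffAt.2 fun x => ?_, r / 2, half_pos hr,
    ((Metric.ball_subset_ball (half_le_self hr.le)).trans Metric.ball_subset_closedBall).trans
      hrU, fun x hx => ?_⟩
  · by_cases hx : x ∈ U
    · exact χ.contDiff.contDiffAt.mul (hf.contDiffAt (hU.mem_nhds hx))
    · have hx' : x ∈ (Metric.closedBall (0 : Fin n → ℝ) r)ᶜ := fun h => hx (hrU h)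
      refine (contDiffAt_const (c := (0 : ℝ))).congr_of_eventuallyEq ?_
      filter_upwards [Metric.isClosed_closedBall.isOpen_compl.mem_nhds hx'] with y hy
      have : χ y = 0 := χ.zero_of_le_dist (not_le.1 fun h => hy h).le
      simp [this]
  · have : χ x = 1 := χ.one_of_mem_closedBall (Metric.ball_subset_closedBall hx)
    simp [this]

theorem lnat_congr {f F : (Fin n → ℝ) → ℝ} (e : f =ᶠ[𝓝 0] F) (a : Fin n → ℕ) :
    lnat f a = lnat F a := by
  simp only [lnat, taylorCoeff_congr e]

theorem newtonPolyhedron_congr {f F : (Fin n → ℝ) → ℝ} (e : f =ᶠ[𝓝 0] F) :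
    NewtonPolyhedron f = NewtonPolyhedron F := by
  simp only [NewtonPolyhedron, taylorCoeff_congr e]

theorem gammaPartPoly_congr {f F : (Fin n → ℝ) → ℝ} (e : f =ᶠ[𝓝 0] F) (γ : Set (Fin n → ℝ)) :
    gammaPartPoly f γ = gammaPartPoly F γ := by
  funext x
  simp only [gammaPartPoly, taylorCoeff_congr e]

theorem nondegenerate_congr {f F : (Fin n → ℝ) → ℝ} (e : f =ᶠ[𝓝 0] F) {U V : Set (Fin n → ℝ)}
    (hVU : V ⊆ U) (h : Nondegenerate f U) : Nondegenerate F V := by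
  intro γ hγ hne hc x hx hx0
  rw [← gammaPartPoly_congr e]
  rw [← newtonPolyhedron_congr e] at hγ
  exact h γ hγ hne hc x (hVU hx) hx0

/-- Theorem 3.3: if `f` satisfies condition (C) and the support of `φ` is
contained in a sufficiently small neighborhood of the origin, then `I(t;φ)` admits an
asymptotic expansion `Σ_α Σ_{k=1}^n C_{αk}(φ) t^α (log t)^{k-1}` as `t → +∞`, where the
exponents `α` run over `{-(⟨a⟩+ν)/l(a) : ν ∈ ℤ₊, a ∈ Σ̃^{(1)}} ∪ (-ℕ)`, a set of finitely
many arithmetic progressions of negative rationals determined only by `Γ₊(f)`. -/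
theorem statement0 {n : ℕ} (U : Set (Fin n → ℝ)) (hUopen : IsOpen U)
    (hU0 : (0 : Fin n → ℝ) ∈ U)
    (f : (Fin n → ℝ) → ℝ) (hf : ContDiffOn ℝ (⊤ : ℕ∞) f U)
    (hf0 : f 0 = 0) (hdf0 : fderiv ℝ f 0 = 0)
    (hΓ : (NewtonPolyhedron f).Nonempty)
    (hC : ConditionC U f) :
    ∃ V ∈ 𝓝 (0 : Fin n → ℝ), ∀ φ : (Fin n → ℝ) → ℂ, IsAmplitude U V φ →
      ∀ S : SimplicialSubdivision n (NewtonPolyhedron f),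
        ∃ C : ℝ → ℕ → ℂ,
          HasAsympExpansion n (oscInt f φ) (expSet (NewtonPolyhedron f) S) C := by
  obtain ⟨F, hF, δ, hδ, hδU, hFf⟩ := exists_contDiff_eqOn_ball hUopen hU0 hf
  have e : f =ᶠ[𝓝 0] F := by
    filter_upwards [Metric.ball_mem_nhds 0 hδ] with x hx using (hFf hx).symm
  have hmem : MemEhatP (NewtonPolyhedron f) U f := by
    rcases hC.1 with h | h
    · exact absurd h.1 hΓ.ne_empty
    · exact h.2
  have hbox : {x : Fin n → ℝ | ∀ i, |x i| < δ} ⊆ Metric.ball 0 δ := fun x hx =>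
    mem_ball_zero_iff.2 ((pi_norm_lt_iff hδ).2 hx)
  have hlim : ∀ x : Fin n → ℝ, (∀ i, |x i| < δ) → ∀ a : Fin n → ℕ,
      ∃ c : ℝ, Tendsto (fun t : ℝ => F (scaleAction a t x) / t ^ lnat F a)
        (𝓝[>] (0:ℝ)) (𝓝 c) := by
    intro x hx a
    obtain ⟨c, hc⟩ := exists_limit_of_memEhatP hmem a (hδU (hbox hx))
    refine ⟨c, hc.congr' ?_⟩
    filter_upwards [Ioo_mem_nhdsGT (zero_lt_one' ℝ)] with t ht
    rw [← lnat_congr e, hFf (hbox fun i => scaleAction_mem_box ht.1.le ht.2.le hx i)]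
  have hnd := nondegenerate_congr e (hbox.trans hδU) hC.2
  rw [newtonPolyhedron_congr e] at hΓ ⊢
  obtain ⟨R, hR, hmain⟩ := exists_expansion_smooth hF hδ hlim hnd hΓ
  refine ⟨Metric.ball 0 (min R δ), Metric.ball_mem_nhds 0 (lt_min hR hδ), fun φ hφ S => ?_⟩
  have hsupp : ∀ x, min R δ ≤ ‖x‖ → φ x = 0 := fun x hx => by
    by_contra h0
    exact not_lt.2 hx (mem_ball_zero_iff.1 (hφ.2.2 (subset_tsupport φ h0)).2)
  have hosc : oscInt f φ = oscInt F φ := by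
    funext t
    refine integral_congr_ae (Eventually.of_forall fun x => ?_)
    rcases lt_or_ge ‖x‖ δ with h | h
    · simp only [hFf (mem_ball_zero_iff.2 h)]
    · simp only [hsupp x ((min_le_right _ _).trans h), mul_zero]
  rw [hosc]
  exact hmain φ hφ.1 (fun x hx => hsupp x ((min_le_left _ _).trans hx.le)) S

end KN
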